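/- arXiv:2108.10589 — 9 statements merged into one kernel-verified Lean document; each statement's English description precedes it below -/
import Mathlib

section
/- Let (s₀, i₀) satisfy 0 ≤ s₀ ≤ γ/β, 0 ≤ i₀ ≤ i_M and s₀ + i₀ ≤ 1. Then for EVERY admissible control b, the associated trajectory satisfies i^{s₀,i₀,b}(t) ≤ i_M, s^{s₀,i₀,b}(t) ≤ γ/β and (s^{s₀,i₀,b}(t), i^{s₀,i₀,b}(t)) ∈ 𝕋 for all t ≥ 0; that is, the set 𝒜₀ := ([0, γ/β] × [0, i_M]) ∩ 𝕋 is invariant for the controlled SIR system. -/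
open MeasureTheory Set Real
open scoped ENNReal

noncomputable section

/-- An admissible control: a Borel-measurable function with values in `[βs, β]`. -/
def IsAdmissible (βs β : ℝ) (b : ℝ → ℝ) : Prop :=
  Measurable b ∧ ∀ t, b t ∈ Set.Icc βs β

/-- `(s, i)` is the trajectory of the controlled SIR system `s' = -b s i`,
`i' = b s i - γ i` issued from `(s₀, i₀)`, in integral (Carathéodory) form. -/
def IsTrajectory (γ : ℝ) (b : ℝ → ℝ) (s₀ i₀ : ℝ) (s i : ℝ → ℝ) : Prop :=
  Continuous s ∧ Continuous i ∧
    (∀ t : ℝ, s t = s₀ - ∫ r in (0:ℝ)..t, b r * s r * i r) ∧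
    (∀ t : ℝ, i t = i₀ + ∫ r in (0:ℝ)..t, (b r * s r - γ) * i r)

/-- Membership in the triangle `𝕋 = {(s,i) : s ≥ 0, i ≥ 0, s + i ≤ 1}`. -/
def MemT (s i : ℝ) : Prop := 0 ≤ s ∧ 0 ≤ i ∧ s + i ≤ 1

/-- The boundary functions `Φ_A` (with `βx = β`, `sM = s_M`) and `Φ_B`
(with `βx = β_*`, `sM = s_M^*`). -/
def Phi (γ βx iM sM : ℝ) (s : ℝ) : ℝ :=
  if s ≤ γ / βx then iM
  else if s < sM then iM - s + γ / βx + (γ / βx) * Real.log (βx * s / γ)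
  else 0

/-- The cost functional `J(t_f, b) = ∫₀^{t_f} (λ₁ + λ₂ (β - b(t))) dt`. -/
def cost (β lam1 lam2 tf : ℝ) (b : ℝ → ℝ) : ℝ :=
  ∫ t in (0:ℝ)..tf, (lam1 + lam2 * (β - b t))

theorem nonneg_aux (a x : ℝ → ℝ) (x₀ K T : ℝ) (hT : 0 ≤ T) (hx : Continuous x) (hx₀ : 0 ≤ x₀)
    (hint : ∀ u v, IntervalIntegrable (fun r => a r * x r) volume u v)
    (heq : ∀ t, x t = x₀ + ∫ r in (0:ℝ)..t, a r * x r)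
    (hK : ∀ r ∈ Set.Icc 0 T, a r ≤ K) : 0 ≤ x T := by
  by_contra! hneg
  have h0 : x 0 = x₀ := by simpa using heq 0
  have hcpt : IsCompact (Set.Icc 0 T ∩ {r | 0 ≤ x r}) :=
    isCompact_Icc.inter_right (isClosed_le continuous_const hx)
  have hne : (Set.Icc 0 T ∩ {r | 0 ≤ x r}).Nonempty :=
    ⟨0, ⟨le_refl _, hT⟩, by simpa [h0] using hx₀⟩
  obtain ⟨τ, ⟨⟨hτ0, hτT⟩, hτx⟩, hτmax⟩ := hcpt.exists_isGreatest hne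
  have hτx' : 0 ≤ x τ := hτx
  have hlt : ∀ r, τ < r → r ≤ T → x r < 0 := by
    intro r h1 h2
    by_contra! h3
    exact absurd (hτmax ⟨⟨hτ0.trans h1.le, h2⟩, h3⟩) (not_le.mpr h1)
  have hle : ∀ t ∈ Set.Icc τ T, K * (∫ r in τ..t, x r) ≤ x t := by
    intro t ht
    have h1 : x t = x τ + ∫ r in τ..t, a r * x r := by
      rw [heq t, heq τ, add_assoc, intervalIntegral.integral_add_adjacent_intervals
        (hint _ _) (hint _ _)]
    have h2 : (∫ r in τ..t, K * x r) ≤ ∫ r in τ..t, a r * x r := by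
      apply intervalIntegral.integral_mono_on_of_le_Ioo ht.1
        ((continuous_const.mul hx).intervalIntegrable _ _) (hint _ _)
      intro r hr
      have := hlt r hr.1 (hr.2.le.trans ht.2)
      have := hK r ⟨hτ0.trans hr.1.le, hr.2.le.trans ht.2⟩
      show K * x r ≤ a r * x r
      nlinarith
    rw [intervalIntegral.integral_const_mul] at h2
    linarith
  have hd : ∀ t, HasDerivAt (fun t => (∫ r in τ..t, x r) * exp (-K * t))
      (x t * exp (-K * t) + (∫ r in τ..t, x r) * (exp (-K * t) * (-K))) t := by
    intro t
    have h1 : HasDerivAt (fun t => ∫ r in τ..t, x r) (x t) t :=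
      intervalIntegral.integral_hasDerivAt_right (hx.intervalIntegrable _ _)
        hx.aestronglyMeasurable.stronglyMeasurableAtFilter hx.continuousAt
    have h2 : HasDerivAt (fun t => exp (-K * t)) (exp (-K * t) * (-K)) t := by
      simpa using ((hasDerivAt_id t).const_mul (-K)).exp
    exact h1.mul h2
  have hmono : MonotoneOn (fun t => (∫ r in τ..t, x r) * exp (-K * t)) (Set.Icc τ T) := by
    apply monotoneOn_of_deriv_nonneg (convex_Icc _ _)
    · exact fun t _ => (hd t).continuousAt.continuousWithinAt
    · exact fun t _ => (hd t).differentiableAt.differentiableWithinAt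
    · intro t ht
      rw [(hd t).deriv]
      have := hle t (interior_subset ht)
      nlinarith [exp_pos (-K * t)]
  have hG : 0 ≤ ∫ r in τ..T, x r := by
    have := hmono ⟨le_refl _, hτT⟩ ⟨hτT, le_refl _⟩ hτT
    simp only [intervalIntegral.integral_same, zero_mul] at this
    exact nonneg_of_mul_nonneg_left this (exp_pos _)
  have hτlt : τ < T := by
    rcases hτT.lt_or_eq with h | h
    · exact h
    · rw [h] at hτx'; linarith
  have hG2 : 0 < ∫ r in τ..T, - x r := by
    apply intervalIntegral.intervalIntegral_pos_of_pos_on (hx.neg.intervalIntegrable _ _) _ hτlt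
    intro r hr
    have := hlt r hr.1 hr.2.le
    show 0 < - x r
    linarith
  rw [intervalIntegral.integral_neg] at hG2
  linarith

/-- the set `𝒜₀ = ([0, γ/β] × [0, i_M]) ∩ 𝕋` is invariant:
from any initial datum in it, EVERY admissible control keeps the trajectory in
`𝒜₀` (in particular `i(t) ≤ i_M`, `s(t) ≤ γ/β` and `(s(t), i(t)) ∈ 𝕋`)
for all `t ≥ 0`. -/
theorem stmt0 (γ βs β iM : ℝ) (hγ : 0 < γ) (hβs : 0 < βs) (hβ : βs < β)
    (hiM : 0 < iM) (hiM1 : iM < 1)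
    (s₀ i₀ : ℝ) (hs₀ : 0 ≤ s₀) (hs₀' : s₀ ≤ γ / β) (hi₀ : 0 ≤ i₀)
    (hi₀' : i₀ ≤ iM) (hsum : s₀ + i₀ ≤ 1) :
    ∀ b : ℝ → ℝ, IsAdmissible βs β b →
      ∀ s i : ℝ → ℝ, IsTrajectory γ b s₀ i₀ s i →
        ∀ t : ℝ, 0 ≤ t → i t ≤ iM ∧ s t ≤ γ / β ∧ MemT (s t) (i t) := by
  intro b hb s i htr t ht
  obtain ⟨hbm, hbb⟩ := hb
  obtain ⟨hs, hi, hse, hie⟩ := htr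
  have hβ0 : 0 < β := hβs.trans hβ
  have hbint : ∀ u v, IntervalIntegrable b volume u v := by
    intro u v
    apply (intervalIntegrable_const (c := β)).mono_fun hbm.aestronglyMeasurable
    refine Filter.Eventually.of_forall fun r => ?_
    have := hbb r
    simp only [Real.norm_eq_abs]
    rw [abs_of_pos (hβs.trans_le this.1), abs_of_pos hβ0]
    exact this.2
  have hsint : ∀ u v, IntervalIntegrable (fun r => b r * s r) volume u v :=
    fun u v => (hbint u v).mul_continuousOn hs.continuousOn
  have hsiint : ∀ u v, IntervalIntegrable (fun r => b r * s r * i r) volume u v :=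
    fun u v => (hsint u v).mul_continuousOn hi.continuousOn
  have hiint : ∀ u v, IntervalIntegrable (fun r => (b r * s r - γ) * i r) volume u v :=
    fun u v => ((hsint u v).sub intervalIntegrable_const).mul_continuousOn hi.continuousOn
  have hinn : ∀ T, 0 ≤ T → 0 ≤ i T := by
    intro T hT
    obtain ⟨C, hC⟩ := (isCompact_Icc (a := (0:ℝ)) (b := T)).exists_bound_of_continuousOn
      hs.continuousOn
    refine nonneg_aux (fun r => b r * s r - γ) i i₀ (β * C) T hT hi hi₀ hiint hie ?_
    intro r hr
    have h1 := hC r hr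
    rw [Real.norm_eq_abs] at h1
    have h2 := hbb r
    have h3 := le_abs_self (s r)
    have h4 := abs_nonneg (s r)
    have h5 : b r * s r ≤ b r * C := mul_le_mul_of_nonneg_left (h3.trans h1) (hβs.le.trans h2.1)
    have h6 : b r * C ≤ β * C := mul_le_mul_of_nonneg_right h2.2 (h4.trans h1)
    linarith
  have hsnn : ∀ T, 0 ≤ T → 0 ≤ s T := by
    intro T hT
    have e : ∀ r, -(b r * s r * i r) = -(b r * i r) * s r := fun r => by ring
    refine nonneg_aux (fun r => -(b r * i r)) s s₀ 0 T hT hs hs₀ ?_ ?_ ?_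
    · intro u v
      have := (hsiint u v).neg
      simpa only [Pi.neg_def, e] using this
    · intro t
      rw [hse t, sub_eq_add_neg, ← intervalIntegral.integral_neg]
      simp only [e]
    · intro r hr
      have := mul_nonneg (hβs.le.trans (hbb r).1) (hinn r hr.1)
      linarith
  have hsle : ∀ T, 0 ≤ T → s T ≤ s₀ := by
    intro T hT
    have : 0 ≤ ∫ r in (0:ℝ)..T, b r * s r * i r := by
      apply intervalIntegral.integral_nonneg hT
      intro r hr
      exact mul_nonneg (mul_nonneg (hβs.le.trans (hbb r).1) (hsnn r hr.1)) (hinn r hr.1)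
    rw [hse T]; linarith
  have hile : i t ≤ i₀ := by
    have : (∫ r in (0:ℝ)..t, (b r * s r - γ) * i r) ≤ ∫ r in (0:ℝ)..t, (0:ℝ) := by
      apply intervalIntegral.integral_mono_on ht (hiint _ _) intervalIntegrable_const
      intro r hr
      have h1 : b r * s r ≤ β * s r := mul_le_mul_of_nonneg_right (hbb r).2 (hsnn r hr.1)
      have h2 : s r ≤ γ / β := (hsle r hr.1).trans hs₀'
      rw [le_div_iff₀ hβ0] at h2
      exact mul_nonpos_of_nonpos_of_nonneg (by linarith) (hinn r hr.1)
    rw [intervalIntegral.integral_zero] at this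
    rw [hie t]; linarith
  have h := hsle t ht
  exact ⟨hile.trans hi₀', h.trans hs₀', hsnn t ht, hinn t ht, by linarith⟩
end
end

section
/- Let (s₀, i₀) satisfy 0 ≤ s₀ ≤ γ/β_*, 0 ≤ i₀ ≤ i_M and s₀ + i₀ ≤ 1. Then the constant control b ≡ β_* keeps the trajectory within the ICU constraint: i^{s₀,i₀,β_*}(t) ≤ i_M for all t ≥ 0. In particular, every point of ℬ₀ := ([0, γ/β_*] × [0, i_M]) ∩ 𝕋 belongs to the viable zone ℬ, defined as the set of initial data from which some admissible control keeps i(t) ≤ i_M for all t ≥ 0. -/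
open MeasureTheory Set Real
open scoped ENNReal

noncomputable section

lemma aux_global (G : ℝ → ℝ) (K L : NNReal) (hK : LipschitzWith K G) (hL : ∀ x, ‖G x‖ ≤ L) :
    ∃ z : ℝ → ℝ, z 0 = 0 ∧ ∀ t, HasDerivAt z (G (z t)) t := by
  have hex : ∀ n : ℕ, ∃ z : ℝ → ℝ, z 0 = 0 ∧
      ∀ t ∈ Ioo (-(n:ℝ)) n, HasDerivAt z (G (z t)) t := by
    intro n
    have hn : (0:ℝ) ≤ n := Nat.cast_nonneg n
    have hP : IsPicardLindelof (fun _ => G) (tmin := -(n:ℝ)) (tmax := n)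
        ⟨0, by constructor <;> linarith⟩ (0:ℝ) (L * n) 0 L K := by
      apply IsPicardLindelof.of_time_independent
      · intro x _
        exact hL x
      · exact hK.lipschitzOnWith
      · simp
    obtain ⟨z, hz0, hz⟩ := hP.exists_eq_forall_mem_Icc_hasDerivWithinAt₀
    refine ⟨z, hz0, fun t ht => ?_⟩
    exact (hz t (Ioo_subset_Icc_self ht)).hasDerivAt (Icc_mem_nhds ht.1 ht.2)
  choose Z hZ0 hZ using hex
  have hagree : ∀ m n : ℕ, m ≤ n → ∀ t ∈ Ioo (-(m:ℝ)) m, Z m t = Z n t := by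
    intro m n hmn t ht
    have hmn' : (m:ℝ) ≤ n := Nat.cast_le.2 hmn
    have hm : (0:ℝ) < m := by linarith [ht.1, ht.2]
    exact ODE_solution_unique_of_mem_Ioo (v := fun _ => G) (s := fun _ => univ) (t₀ := 0)
      (fun t _ => hK.lipschitzOnWith) ⟨by linarith, hm⟩
      (fun t ht => ⟨hZ m t ht, trivial⟩)
      (fun t ht => ⟨hZ n t ⟨by linarith [ht.1], by linarith [ht.2]⟩, trivial⟩)
      ((hZ0 m).trans (hZ0 n).symm) ht
  have hin : ∀ t : ℝ, t ∈ Ioo (-((⌊|t|⌋₊ + 1 : ℕ):ℝ)) ((⌊|t|⌋₊ + 1 : ℕ):ℝ) := by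
    intro t
    have h := Nat.lt_floor_add_one |t|
    have := abs_lt.1 h
    push_cast
    exact this
  refine ⟨fun t => Z (⌊|t|⌋₊ + 1) t, hZ0 _, fun t => ?_⟩
  have hev : (fun t => Z (⌊|t|⌋₊ + 1) t) =ᶠ[nhds t] Z (⌊|t|⌋₊ + 1) := by
    filter_upwards [isOpen_Ioo.mem_nhds (hin t)] with x hx
    rcases le_total (⌊|x|⌋₊ + 1) (⌊|t|⌋₊ + 1) with h | h
    · exact hagree _ _ h x (hin x)
    · exact (hagree _ _ h x hx).symm
  exact (hZ _ t (hin t)).congr_of_eventuallyEq hev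

lemma aux_scalar (F F' : ℝ → ℝ) (a b C : ℝ) (ha : a ≤ 0) (hb : 0 ≤ b)
    (hF : ∀ x, HasDerivAt F (F' x) x) (hC : ∀ x ∈ Icc a b, |F' x| ≤ C)
    (hFa : F a = 0) (hFb : F b = 0) :
    ∃ z : ℝ → ℝ, z 0 = 0 ∧ ∀ t, HasDerivAt z (F (z t)) t := by
  have hab : a ≤ b := ha.trans hb
  have hlip : LipschitzOnWith C.toNNReal F (Icc a b) := by
    apply (convex_Icc a b).lipschitzOnWith_of_nnnorm_hasDerivWithin_le
      (fun x _ => (hF x).hasDerivWithinAt)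
    intro x hx
    rw [← NNReal.coe_le_coe]
    simpa using Or.inl (hC x hx)
  have hcont : Continuous F := continuous_iff_continuousAt.2 fun x => (hF x).continuousAt
  obtain ⟨L, hL⟩ := isCompact_Icc.exists_bound_of_continuousOn (hcont.continuousOn (s := Icc a b))
  let c : ℝ → ℝ := fun x => max a (min b x)
  have hc : LipschitzWith 1 c := (LipschitzWith.id.const_min b).const_max a
  have hcm : ∀ x, c x ∈ Icc a b := fun x =>
    ⟨le_max_left _ _, max_le hab (min_le_left _ _)⟩
  have hG : LipschitzWith C.toNNReal (fun x => F (c x)) := by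
    have := hlip.comp (hc.lipschitzOnWith (s := univ)) (fun x _ => hcm x)
    rw [lipschitzOnWith_univ, mul_one] at this
    exact this
  obtain ⟨z, hz0, hz⟩ := aux_global (fun x => F (c x)) C.toNNReal L.toNNReal hG
    (fun x => (hL _ (hcm x)).trans (Real.le_coe_toNNReal L))
  have hzc : Continuous z := continuous_iff_continuousAt.2 fun x => (hz x).continuousAt
  have hca : c a = a := by simp [c, hab]
  have hcb : c b = b := by simp [c, hab]
  have key : ∀ e, F (c e) = 0 → ∀ t₀, z t₀ = e → e = 0 ∧ ∀ t, z t = e := by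
    intro e he t₀ ht₀
    have : z = fun _ => e := ODE_solution_unique_univ (v := fun _ x => F (c x))
      (s := fun _ => univ) (t₀ := t₀) (fun _ => hG.lipschitzOnWith)
      (fun t => ⟨hz t, trivial⟩)
      (fun t => ⟨by rw [he]; exact hasDerivAt_const t e, trivial⟩) ht₀
    refine ⟨?_, fun t => by rw [this]⟩
    rw [← hz0, this]
  have hmem : ∀ t, z t ∈ Icc a b := by
    intro t
    constructor
    · by_contra h
      push Not at h
      obtain ⟨t₀, h0⟩ := mem_range_of_exists_le_of_exists_ge hzc ⟨t, h.le⟩ ⟨0, by rw [hz0]; exact ha⟩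
      have := (key a (by rw [hca, hFa]) t₀ h0).2 t
      linarith
    · by_contra h
      push Not at h
      obtain ⟨t₀, h0⟩ := mem_range_of_exists_le_of_exists_ge hzc ⟨0, by rw [hz0]; exact hb⟩ ⟨t, h.le⟩
      have := (key b (by rw [hcb, hFb]) t₀ h0).2 t
      linarith
  refine ⟨z, hz0, fun t => ?_⟩
  have h1 : c (z t) = z t := by
    obtain ⟨h1, h2⟩ := hmem t
    simp [c, h1, h2]
  have := hz t
  rwa [h1] at this

lemma aux_exists (γ β s₀ i₀ : ℝ) (hγ : 0 < γ) (hβ : 0 < β) (hs : 0 ≤ s₀) (hi : 0 ≤ i₀) :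
    ∃ s i, IsTrajectory γ (fun _ => β) s₀ i₀ s i := by
  suffices h : ∃ s i : ℝ → ℝ, s 0 = s₀ ∧ i 0 = i₀ ∧ (∀ t, HasDerivAt s (-(β * s t * i t)) t) ∧
      ∀ t, HasDerivAt i ((β * s t - γ) * i t) t by
    obtain ⟨s, i, hs0, hi0, hs', hi'⟩ := h
    have cs : Continuous s := continuous_iff_continuousAt.2 fun x => (hs' x).continuousAt
    have ci : Continuous i := continuous_iff_continuousAt.2 fun x => (hi' x).continuousAt
    refine ⟨s, i, cs, ci, fun t => ?_, fun t => ?_⟩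
    · have := intervalIntegral.integral_eq_sub_of_hasDerivAt (a := 0) (b := t)
        (fun x _ => hs' x) ((by fun_prop : Continuous _).intervalIntegrable _ _)
      rw [intervalIntegral.integral_neg, hs0] at this
      linarith
    · have := intervalIntegral.integral_eq_sub_of_hasDerivAt (a := 0) (b := t)
        (fun x _ => hi' x) ((by fun_prop : Continuous _).intervalIntegrable _ _)
      rw [hi0] at this
      linarith
  rcases hs.eq_or_lt with hs | hs
  · refine ⟨fun _ => 0, fun t => i₀ * Real.exp (-γ * t), hs, by simp, fun t => ?_, fun t => ?_⟩
    · simpa using hasDerivAt_const t (0:ℝ)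
    · have := ((((hasDerivAt_id t).const_mul (-γ)).exp).const_mul i₀)
      refine this.congr_deriv ?_
      simp; ring
  let F : ℝ → ℝ := fun z => i₀ + s₀ - γ * z - s₀ * Real.exp (-β * z)
  let F' : ℝ → ℝ := fun z => -γ + s₀ * β * Real.exp (-β * z)
  have hF : ∀ x, HasDerivAt F (F' x) x := by
    intro x
    have h1 := ((((hasDerivAt_id x).const_mul (-β)).exp).const_mul s₀)
    have h2 := (((hasDerivAt_id x).const_mul γ).const_sub (i₀ + s₀)).sub h1
    refine h2.congr_deriv ?_
    simp [F']; ring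
  have hcont : Continuous F := continuous_iff_continuousAt.2 fun x => (hF x).continuousAt
  have hF0 : F 0 = i₀ := by simp [F]
  obtain ⟨b, hb, hFb⟩ : ∃ b, 0 ≤ b ∧ F b = 0 := by
    have hB : 0 ≤ (i₀ + s₀) / γ := by positivity
    have hFB : F ((i₀ + s₀) / γ) ≤ 0 := by
      have : γ * ((i₀ + s₀) / γ) = i₀ + s₀ := by field_simp
      have h2 := mul_pos hs (Real.exp_pos (-β * ((i₀ + s₀) / γ)))
      simp only [F, this]; linarith
    obtain ⟨b, hb, h⟩ := intermediate_value_Icc' hB hcont.continuousOn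
      (show (0:ℝ) ∈ Icc _ _ from ⟨hFB, by rw [hF0]; exact hi⟩)
    exact ⟨b, hb.1, h⟩
  obtain ⟨a, ha, hFa⟩ : ∃ a, a ≤ 0 ∧ F a = 0 := by
    -- exp y ≥ y^2/2 with y = β x
    obtain ⟨x, hx, hx2⟩ : ∃ x : ℝ, 0 ≤ x ∧ i₀ + s₀ + γ * x ≤ s₀ * ((β * x) ^ 2 / 2) := by
      have hk : 0 < s₀ * β ^ 2 / 2 := by positivity
      refine ⟨1 + (i₀ + s₀ + γ) / (s₀ * β ^ 2 / 2), by positivity, ?_⟩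
      set k := s₀ * β ^ 2 / 2 with hkd
      set q := (i₀ + s₀ + γ) / k with hq
      have hkq : k * q = i₀ + s₀ + γ := by rw [hq]; field_simp
      have hq0 : 0 ≤ q := by positivity
      have e : s₀ * ((β * (1 + q)) ^ 2 / 2) = k * (1 + q) ^ 2 := by rw [hkd]; ring
      have e2 : k * (1 + q) ^ 2 = k * (1 + q) + (i₀ + s₀ + γ) * (1 + q) := by rw [← hkq]; ring
      rw [e, e2]
      have : 0 ≤ k * (1 + q) := by positivity
      nlinarith [mul_nonneg hi hq0, mul_nonneg hs.le hq0]
    have hFx : F (-x) ≤ 0 := by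
      have h1 := Real.quadratic_le_exp_of_nonneg (show 0 ≤ β * x by positivity)
      have h2 : s₀ * ((β * x) ^ 2 / 2) ≤ s₀ * Real.exp (β * x) := by
        apply mul_le_mul_of_nonneg_left _ hs.le
        have : 0 ≤ β * x := by positivity
        linarith
      have h3 : -β * -x = β * x := by ring
      simp only [F, h3]; linarith
    obtain ⟨a, ha, h⟩ := intermediate_value_Icc (show -x ≤ 0 by linarith) hcont.continuousOn
      (show (0:ℝ) ∈ Icc _ _ from ⟨hFx, by rw [hF0]; exact hi⟩)
    exact ⟨a, ha.2, h⟩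
  obtain ⟨C, hC⟩ := isCompact_Icc.exists_bound_of_continuousOn
    (f := F') (s := Icc a b) (by fun_prop)
  obtain ⟨z, hz0, hz⟩ := aux_scalar F F' a b C ha hb hF hC hFa hFb
  refine ⟨fun t => s₀ * Real.exp (-β * z t), fun t => F (z t), by simp [hz0], by
    simp only [hz0, hF0], fun t => ?_, fun t => ?_⟩
  · refine ((((hz t).const_mul (-β)).exp).const_mul s₀).congr_deriv ?_
    ring
  · refine ((hF (z t)).comp t (hz t)).congr_deriv ?_
    simp only [F']; ring

lemma aux_lin (y g : ℝ → ℝ) (hg : Continuous g) (hy : ∀ t, HasDerivAt y (g t * y t) t) (t : ℝ) :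
    y t = y 0 * Real.exp (∫ r in (0:ℝ)..t, g r) := by
  have hA : ∀ t, HasDerivAt (fun t => ∫ r in (0:ℝ)..t, g r) (g t) t := fun t =>
    intervalIntegral.integral_hasDerivAt_right (hg.intervalIntegrable _ _)
      (hg.stronglyMeasurableAtFilter _ _) hg.continuousAt
  have hd : ∀ t, HasDerivAt (fun t => y t * Real.exp (-∫ r in (0:ℝ)..t, g r)) 0 t := by
    intro t
    refine ((hy t).mul (hA t).neg.exp).congr_deriv ?_
    ring
  have := is_const_of_deriv_eq_zero (fun t => (hd t).differentiableAt) (fun t => (hd t).deriv) t 0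
  simp only [intervalIntegral.integral_same, neg_zero, Real.exp_zero, mul_one] at this
  rw [← this, mul_assoc, ← Real.exp_add]
  simp

lemma aux_bound (γ β s₀ i₀ : ℝ) (hβ : 0 < β) (hs : 0 ≤ s₀) (hi : 0 ≤ i₀)
    (hs' : s₀ ≤ γ / β) (s i : ℝ → ℝ) (h : IsTrajectory γ (fun _ => β) s₀ i₀ s i)
    (t : ℝ) (ht : 0 ≤ t) : i t ≤ i₀ := by
  obtain ⟨cs, ci, es, ei⟩ := h
  have s0 : s 0 = s₀ := by rw [es]; simp
  have i0 : i 0 = i₀ := by rw [ei]; simp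
  have hint : ∀ f : ℝ → ℝ, Continuous f → ∀ t,
      HasDerivAt (fun t => ∫ r in (0:ℝ)..t, f r) (f t) t := fun f hg t =>
    intervalIntegral.integral_hasDerivAt_right (hg.intervalIntegrable _ _)
      (hg.stronglyMeasurableAtFilter _ _) hg.continuousAt
  have ds : ∀ t, HasDerivAt s ((-(β * i t)) * s t) t := by
    intro t
    have := (hint (fun r => β * s r * i r) (by fun_prop) t).const_sub s₀
    rw [← funext es] at this
    exact this.congr_deriv (by ring)
  have di : ∀ t, HasDerivAt i ((β * s t - γ) * i t) t := by
    intro t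
    have := (hint (fun r => (β * s r - γ) * i r) (by fun_prop) t).const_add i₀
    rw [← funext ei] at this
    exact this
  have ipos : ∀ t, 0 ≤ i t := by
    intro t
    rw [aux_lin i _ (by fun_prop) di t, i0]
    positivity
  have sle : ∀ t, 0 ≤ t → s t ≤ s₀ := by
    intro t ht
    rw [aux_lin s _ (by fun_prop) ds t, s0]
    apply mul_le_of_le_one_right hs
    rw [Real.exp_le_one_iff, intervalIntegral.integral_neg, neg_nonpos]
    exact intervalIntegral.integral_nonneg ht fun u _ => mul_nonneg hβ.le (ipos u)
  have hle : ∫ r in (0:ℝ)..t, (β * s r - γ) * i r ≤ 0 := by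
    rw [← neg_nonneg, ← intervalIntegral.integral_neg]
    refine intervalIntegral.integral_nonneg ht fun u hu => ?_
    have h1 := (sle u hu.1).trans hs'
    rw [le_div_iff₀ hβ] at h1
    nlinarith [mul_nonneg (show 0 ≤ γ - β * s u by linarith) (ipos u)]
  have := ei t
  simp only at this
  linarith

/-- from any point of `ℬ₀ = ([0, γ/β_*] × [0, i_M]) ∩ 𝕋`, the
constant control `b ≡ β_*` keeps `i(t) ≤ i_M` for all `t ≥ 0`; in particular
such a point belongs to the viable zone `ℬ` (some admissible control keeps
`i(t) ≤ i_M` for all `t ≥ 0`). -/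
theorem stmt1 (γ βs β iM : ℝ) (hγ : 0 < γ) (hβs : 0 < βs) (hβ : βs < β)
    (hiM : 0 < iM) (hiM1 : iM < 1)
    (s₀ i₀ : ℝ) (hs₀ : 0 ≤ s₀) (hs₀' : s₀ ≤ γ / βs) (hi₀ : 0 ≤ i₀)
    (hi₀' : i₀ ≤ iM) (hsum : s₀ + i₀ ≤ 1) :
    (∀ s i : ℝ → ℝ, IsTrajectory γ (fun _ => βs) s₀ i₀ s i →
      ∀ t : ℝ, 0 ≤ t → i t ≤ iM) ∧
    (∃ b s i, IsAdmissible βs β b ∧ IsTrajectory γ b s₀ i₀ s i ∧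
      ∀ t : ℝ, 0 ≤ t → i t ≤ iM) := by
  have key := fun s i h t ht =>
    (aux_bound γ βs s₀ i₀ hβs hs₀ hi₀ hs₀' s i h t ht).trans hi₀'
  refine ⟨key, ?_⟩
  obtain ⟨s, i, h⟩ := aux_exists γ βs s₀ i₀ hγ hβs hs₀ hi₀
  exact ⟨fun _ => βs, s, i, ⟨measurable_const, fun _ => ⟨le_rfl, hβ.le⟩⟩, h, key s i h⟩
end
end

section
/- Let (s₀, i₀) ∈ 𝕋 and 0 < i₁ ≤ i₀. Then: (i) if there exists an admissible control b such that i^{s₀,i₀,b}(t) ≤ i_M for all t ≥ 0, then there exists an admissible control b' such that i^{s₀,i₁,b'}(t) ≤ i_M for all t ≥ 0; (ii) if i^{s₀,i₀,β}(t) ≤ i_M for all t ≥ 0 (constant control β), then i^{s₀,i₁,β}(t) ≤ i_M for all t ≥ 0; (iii) if i^{s₀,i₀,b}(t) ≤ i_M for all t ≥ 0 and every admissible control b, then i^{s₀,i₁,b}(t) ≤ i_M for all t ≥ 0 and every admissible control b. -/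
open MeasureTheory Set Real
open scoped ENNReal

noncomputable section

def NiceG (g : ℝ → ℝ) : Prop := Measurable g ∧ ∀ R : ℝ, ∃ C : ℝ, ∀ t, |t| ≤ R → |g t| ≤ C

lemma NiceG.of_cont {g : ℝ → ℝ} (hg : Continuous g) : NiceG g := by
  refine ⟨hg.measurable, fun R => ?_⟩
  obtain ⟨C, hC⟩ := (isCompact_Icc (a := -R) (b := R)).exists_bound_of_continuousOn hg.continuousOn
  exact ⟨C, fun t ht => hC t (abs_le.1 ht)⟩

lemma NiceG.mul {f g : ℝ → ℝ} (hf : NiceG f) (hg : NiceG g) : NiceG (fun t => f t * g t) := by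
  refine ⟨hf.1.mul hg.1, fun R => ?_⟩
  obtain ⟨C, hC⟩ := hf.2 R
  obtain ⟨D, hD⟩ := hg.2 R
  refine ⟨C * D, fun t ht => ?_⟩
  rw [abs_mul]
  exact mul_le_mul (hC t ht) (hD t ht) (abs_nonneg _) ((abs_nonneg _).trans (hC t ht))

lemma NiceG.sub {f g : ℝ → ℝ} (hf : NiceG f) (hg : NiceG g) : NiceG (fun t => f t - g t) := by
  refine ⟨hf.1.sub hg.1, fun R => ?_⟩
  obtain ⟨C, hC⟩ := hf.2 R
  obtain ⟨D, hD⟩ := hg.2 R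
  refine ⟨C + D, fun t ht => ?_⟩
  exact (abs_sub _ _).trans (add_le_add (hC t ht) (hD t ht))

lemma NiceG.of_bdd {g : ℝ → ℝ} (hg : Measurable g) {p q : ℝ} (h : ∀ t, g t ∈ Icc p q) :
    NiceG g := by
  refine ⟨hg, fun R => ⟨max |p| |q|, fun t _ => ?_⟩⟩
  exact abs_le_max_abs_abs (h t).1 (h t).2

lemma NiceG.intervalIntegrable {g : ℝ → ℝ} (hg : NiceG g) (a b : ℝ) :
    IntervalIntegrable g volume a b := by
  obtain ⟨C, hC⟩ := hg.2 (max |a| |b|)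
  have h0 : IntervalIntegrable (fun _ : ℝ => C) volume a b := intervalIntegrable_const
  refine h0.mono_fun' hg.1.aestronglyMeasurable ?_
  refine (ae_restrict_iff' measurableSet_uIoc).2 (Filter.Eventually.of_forall fun t ht => ?_)
  have := uIoc_subset_uIcc ht
  apply hC
  rcases mem_uIcc.1 this with h | h
  · exact abs_le_max_abs_abs h.1 h.2
  · rw [max_comm]; exact abs_le_max_abs_abs h.1 h.2

lemma NiceG.locLip {g : ℝ → ℝ} (hg : NiceG g) :
    LocallyLipschitz (fun t => ∫ r in (0:ℝ)..t, g r) := by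
  intro x
  obtain ⟨C, hC⟩ := hg.2 (|x| + 1)
  refine ⟨C.toNNReal, Metric.ball x 1, Metric.ball_mem_nhds x one_pos,
    LipschitzOnWith.of_dist_le_mul fun y hy z hz => ?_⟩
  rw [Real.dist_eq, intervalIntegral.integral_interval_sub_left
    (hg.intervalIntegrable _ _) (hg.intervalIntegrable _ _)]
  have hC0 : 0 ≤ C := (abs_nonneg _).trans (hC x (by linarith))
  rw [Real.coe_toNNReal _ hC0, Real.dist_eq]
  rw [← Real.norm_eq_abs]
  refine intervalIntegral.norm_integral_le_of_norm_le_const fun u hu => ?_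
  rw [Real.norm_eq_abs]
  apply hC
  rw [Metric.mem_ball, Real.dist_eq, abs_lt] at hy hz
  have := uIoc_subset_uIcc hu
  rw [abs_le]
  have h1 := le_abs_self x
  have h2 := neg_abs_le x
  rcases mem_uIcc.1 this with h | h <;> constructor <;> linarith

lemma ac_of_locLip {f : ℝ → ℝ} (hf : LocallyLipschitz f) (a b : ℝ) :
    AbsolutelyContinuousOnInterval f a b := by
  obtain ⟨K, hK⟩ := (hf.locallyLipschitzOn (s := uIcc a b)).exists_lipschitzOnWith_of_compact
    isCompact_uIcc
  exact hK.absolutelyContinuousOnInterval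

lemma NiceG.ae_deriv {g : ℝ → ℝ} (hg : NiceG g) :
    ∀ᵐ x, HasDerivAt (fun t => ∫ r in (0:ℝ)..t, g r) (g x) x := by
  have : LocallyIntegrable g volume := by
    intro x
    have := (hg.intervalIntegrable (x-1) (x+1)).1
    exact ⟨Ioc (x-1) (x+1), Ioc_mem_nhds (by linarith) (by linarith), this⟩
  filter_upwards [LocallyIntegrable.ae_hasDerivAt_integral this] with x hx using hx 0

lemma expForm {g : ℝ → ℝ} (hg : NiceG g) (y0 t : ℝ) :
    y0 * exp (∫ r in (0:ℝ)..t, g r)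
      = y0 + ∫ r in (0:ℝ)..t, g r * (y0 * exp (∫ u in (0:ℝ)..r, g u)) := by
  have hE : LocallyLipschitz (fun x : ℝ => y0 * exp x) :=
    ContDiff.locallyLipschitz (𝕂 := ℝ) (by fun_prop)
  have h := (ac_of_locLip (hE.comp hg.locLip) 0 t).integral_deriv_eq_sub
  simp only [Function.comp_def, intervalIntegral.integral_same, exp_zero, mul_one] at h
  have h2 : ∫ r in (0:ℝ)..t, g r * (y0 * exp (∫ u in (0:ℝ)..r, g u)) =
     ∫ (x : ℝ) in (0:ℝ)..t, deriv (fun x ↦ y0 * rexp (∫ (r : ℝ) in (0:ℝ)..x, g r)) x := by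
    apply intervalIntegral.integral_congr_ae
    filter_upwards [hg.ae_deriv] with x hx _
    rw [(hx.exp.const_mul y0).deriv]; ring
  rw [h2, h]; ring

lemma expUniq {g y : ℝ → ℝ} (hg : NiceG g) (hy : Continuous y) (y0 : ℝ)
    (h : ∀ t, y t = y0 + ∫ r in (0:ℝ)..t, g r * y r) (t : ℝ) :
    y t = y0 * exp (∫ r in (0:ℝ)..t, g r) := by
  have hgy := hg.mul (NiceG.of_cont hy)
  have hE : LocallyLipschitz (fun x : ℝ => exp (-x)) :=
    ContDiff.locallyLipschitz (𝕂 := ℝ) (by fun_prop)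
  have hA : LocallyLipschitz (fun x : ℝ => y0 + x) :=
    ContDiff.locallyLipschitz (𝕂 := ℝ) (by fun_prop)
  have h1 := ac_of_locLip (hE.comp hg.locLip) 0 t
  have h2 := ac_of_locLip (hA.comp hgy.locLip) 0 t
  have h3 := (h2.fun_mul h1).integral_deriv_eq_sub
  simp only [Function.comp, intervalIntegral.integral_same, neg_zero, exp_zero, mul_one,
    add_zero] at h3
  have h4 : ∫ (x : ℝ) in (0:ℝ)..t, deriv (fun x ↦ (y0 + ∫ r in (0:ℝ)..x, g r * y r) *
      rexp (-∫ (r : ℝ) in (0:ℝ)..x, g r)) x = ∫ (x : ℝ) in (0:ℝ)..t, 0 := by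
    apply intervalIntegral.integral_congr_ae
    filter_upwards [hg.ae_deriv, hgy.ae_deriv] with x hx hx2 _
    have hd := (hx2.const_add y0).fun_mul hx.fun_neg.exp
    rw [hd.deriv, ← h x]; ring
  rw [h4, ← h t, intervalIntegral.integral_zero, exp_neg] at h3
  have := exp_pos (∫ r in (0:ℝ)..t, g r)
  field_simp at h3
  linarith

lemma ode_bdd {F : ℝ → ℝ} {K : NNReal} (hF : LipschitzWith K F) {L : ℝ} (hL : ∀ u, |F u| ≤ L) :
    ∃ τ : ℝ → ℝ, τ 0 = 0 ∧ ∀ t, HasDerivAt τ (F (τ t)) t := by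
  have hL0 : 0 ≤ L := (abs_nonneg _).trans (hL 0)
  have key : ∀ n : ℕ, ∃ α : ℝ → ℝ, α 0 = 0 ∧
      ∀ t ∈ Ioo (-(n:ℝ) - 1) (n + 1), HasDerivAt α (F (α t)) t := by
    intro n
    have hn : (0:ℝ) ≤ n := n.cast_nonneg
    have hP : IsPicardLindelof (fun _ => F) (tmin := -(n:ℝ) - 1) (tmax := n + 1)
        ⟨0, by constructor <;> linarith⟩ (0:ℝ) (L.toNNReal * (n + 1)) 0 L.toNNReal K := by
      constructor
      · intro t _; exact hF.lipschitzOnWith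
      · intro x _; exact continuousOn_const
      · intro t _ x _; rw [Real.coe_toNNReal _ hL0]; exact hL x
      · simp [Real.coe_toNNReal _ hL0]
        rw [show (n:ℝ) + 1 = 1 + n by ring]
        simp
    obtain ⟨α, h0, h⟩ := hP.exists_eq_forall_mem_Icc_hasDerivWithinAt₀
    exact ⟨α, h0, fun t ht => (h t (Ioo_subset_Icc_self ht)).hasDerivAt (Icc_mem_nhds ht.1 ht.2)⟩
  choose α h0 h using key
  have agree : ∀ m n : ℕ, m ≤ n → EqOn (α m) (α n) (Ioo (-(m:ℝ) - 1) (m + 1)) := by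
    intro m n hmn
    have hm : (0:ℝ) ≤ m := m.cast_nonneg
    have hmn' : (m:ℝ) ≤ n := by exact_mod_cast hmn
    refine ODE_solution_unique_of_mem_Ioo (v := fun _ => F) (s := fun _ => univ) (K := K) (t₀ := 0)
      (fun t _ => hF.lipschitzOnWith) ⟨by linarith, by linarith⟩
      (fun t ht => ⟨h m t ht, trivial⟩) (fun t ht => ⟨h n t ⟨?_, ?_⟩, trivial⟩) ?_
    · linarith [ht.1]
    · linarith [ht.2]
    · rw [h0, h0]
  refine ⟨fun t => α ⌈|t|⌉₊ t, by simp [h0], fun t => ?_⟩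
  set N := ⌈|t|⌉₊ with hN
  have hNt : |t| ≤ N := Nat.le_ceil _
  have ht' := abs_le.1 hNt
  have hin : t ∈ Ioo (-((N:ℕ):ℝ) - 1) (N + 1) := ⟨by linarith, by linarith⟩
  refine (h N t hin).congr_of_eventuallyEq ?_
  filter_upwards [isOpen_Ioo.mem_nhds hin] with x hx
  have hxm : x ∈ Ioo (-((⌈|x|⌉₊:ℕ):ℝ) - 1) (⌈|x|⌉₊ + 1) := by
    have := abs_le.1 (Nat.le_ceil |x|)
    exact ⟨by linarith, by linarith⟩
  rcases le_total ⌈|x|⌉₊ N with hle | hle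
  · exact agree _ _ hle hxm
  · exact (agree _ _ hle hx).symm

lemma ode_trap {F : ℝ → ℝ} (hF : LocallyLipschitz F) (h0 : 0 < F 0) {a b : ℝ} (ha : a ≤ 0)
    (hb : 0 ≤ b) (hFa : F a ≤ 0) (hFb : F b ≤ 0) :
    ∃ τ : ℝ → ℝ, τ 0 = 0 ∧ ∀ t, HasDerivAt τ (F (τ t)) t ∧ 0 < F (τ t) := by
  have hab : a ≤ b := ha.trans hb
  obtain ⟨K, hK⟩ := (hF.locallyLipschitzOn (s := Icc a b)).exists_lipschitzOnWith_of_compact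
    isCompact_Icc
  set G : ℝ → ℝ := fun u => F (projIcc a b hab u) with hG
  have hGL : LipschitzWith K G := by
    refine LipschitzWith.of_dist_le_mul fun x y => ?_
    refine (hK.dist_le_mul _ (projIcc a b hab x).2 _ (projIcc a b hab y).2).trans ?_
    gcongr
    have := (LipschitzWith.projIcc hab).dist_le_mul x y
    rw [NNReal.coe_one, one_mul] at this
    exact this
  obtain ⟨L, hL⟩ := (isCompact_Icc (a := a) (b := b)).exists_bound_of_continuousOn
    hF.continuous.continuousOn
  obtain ⟨τ, hτ0, hτ⟩ := ode_bdd hGL (L := L) (fun u => hL _ (projIcc a b hab u).2)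
  have hG0 : G 0 = F 0 := by simp only [hG]; rw [projIcc_of_mem hab ⟨ha, hb⟩]
  have hne : ∀ t, G (τ t) ≠ 0 := by
    intro t ht
    have : τ = fun _ => τ t := ODE_solution_unique_univ (v := fun _ => G) (s := fun _ => univ)
      (K := K) (t₀ := t) (fun _ => hGL.lipschitzOnWith) (fun r => ⟨hτ r, trivial⟩)
      (fun r => ⟨by simp only [ht]; exact hasDerivAt_const _ _, trivial⟩) rfl
    have h1 := congrFun this 0
    simp only [hτ0] at h1
    rw [← h1, hG0] at ht
    exact h0.ne' ht
  have hτc : Continuous τ := continuous_iff_continuousAt.2 fun t => (hτ t).continuousAt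
  have hpos : ∀ t, 0 < G (τ t) := by
    intro t
    by_contra hneg
    have hc : Continuous fun t => G (τ t) := hGL.continuous.comp hτc
    have : (0:ℝ) ∈ range (fun t => G (τ t)) :=
      mem_range_of_exists_le_of_exists_ge hc ⟨t, not_lt.1 hneg⟩
        ⟨0, by simp only [hτ0, hG0]; exact h0.le⟩
    obtain ⟨r, hr⟩ := this
    exact hne r hr
  have hGF : ∀ t, G (τ t) = F (τ t) := by
    intro t
    have hp := hpos t
    simp only [hG] at hp ⊢
    rcases le_total (τ t) a with h | h
    · rw [projIcc_of_le_left hab h] at hp; simp at hp; linarith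
    rcases le_total b (τ t) with h' | h'
    · rw [projIcc_of_right_le hab h'] at hp; simp at hp; linarith
    rw [projIcc_of_mem hab ⟨h, h'⟩]
  exact ⟨τ, hτ0, fun t => ⟨hGF t ▸ hτ t, hGF t ▸ hpos t⟩⟩

def Fc (c : ℝ → ℝ) (γ s₀ i₀ u : ℝ) : ℝ := i₀ + s₀ - s₀ * exp (-∫ r in (0:ℝ)..u, c r) - γ * u

lemma Fc_locLip {c : ℝ → ℝ} (hc : NiceG c) (γ s₀ i₀ : ℝ) : LocallyLipschitz (Fc c γ s₀ i₀) := by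
  have hE : LocallyLipschitz (fun x : ℝ × ℝ => i₀ + s₀ - s₀ * exp (-x.1) - γ * x.2) :=
    ContDiff.locallyLipschitz (𝕂 := ℝ) (by fun_prop)
  have hB := hc.locLip
  have hP : LocallyLipschitz (fun t : ℝ => ((∫ r in (0:ℝ)..t, c r, t) : ℝ × ℝ)) :=
    LocallyLipschitz.prodMk hB LocallyLipschitz.id
  have e : Fc c γ s₀ i₀ = (fun x : ℝ × ℝ => i₀ + s₀ - s₀ * exp (-x.1) - γ * x.2) ∘
      (fun t : ℝ => ((∫ r in (0:ℝ)..t, c r, t) : ℝ × ℝ)) := by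
    funext u
    simp only [Fc, Function.comp_apply]
  rw [e]
  exact LocallyLipschitz.comp hE hP

lemma exists_tau {βs β γ s₀ i₀ : ℝ} {c : ℝ → ℝ} (hβs : 0 < βs) (hγ : 0 < γ)
    (hc : IsAdmissible βs β c) (hs : 0 ≤ s₀) (hi : 0 < i₀) :
    ∃ τ : ℝ → ℝ, τ 0 = 0 ∧ ∀ t, HasDerivAt τ (Fc c γ s₀ i₀ (τ t)) t ∧ 0 < Fc c γ s₀ i₀ (τ t) := by
  have hcn : NiceG c := NiceG.of_bdd hc.1 hc.2
  rcases hs.eq_or_lt with rfl | hs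
  · have hval : ∀ t, Fc c γ 0 i₀ (i₀ / γ * (1 - exp (-(γ * t)))) = i₀ * exp (-(γ * t)) := by
      intro t; unfold Fc; field_simp; ring
    refine ⟨fun t => i₀ / γ * (1 - exp (-(γ * t))), by simp, fun t => ⟨?_, ?_⟩⟩
    · rw [hval]
      have hd : HasDerivAt (fun t : ℝ => i₀ / γ * (1 - exp (-(γ * t))))
          (i₀ / γ * -(exp (-(γ * t)) * -(γ * 1))) t :=
        ((((hasDerivAt_id t).const_mul γ).fun_neg.exp).const_sub 1).const_mul (i₀ / γ)
      have he : i₀ / γ * -(exp (-(γ * t)) * -(γ * 1)) = i₀ * exp (-(γ * t)) := by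
        field_simp
      rw [he] at hd
      exact hd
    · rw [hval]; positivity
  · set A : ℝ := 1 + 2 * (i₀ + γ) / (s₀ * βs ^ 2) with hA
    have hA1 : 1 ≤ A := by rw [hA]; have : 0 ≤ 2 * (i₀ + γ) / (s₀ * βs ^ 2) := by positivity
                           linarith
    have hA2 : 2 * (i₀ + γ) ≤ s₀ * βs ^ 2 * A := by
      have h1 : 0 < s₀ * βs ^ 2 := by positivity
      have h2 : s₀ * βs ^ 2 * (2 * (i₀ + γ) / (s₀ * βs ^ 2)) = 2 * (i₀ + γ) := by field_simp
      rw [hA]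
      linarith
    have hcint : βs * A ≤ -∫ r in (0:ℝ)..(-A), c r := by
      rw [← intervalIntegral.integral_symm]
      have := intervalIntegral.integral_mono_on (a := -A) (b := 0) (f := fun _ => βs) (g := c)
        (by linarith) intervalIntegrable_const (hcn.intervalIntegrable _ _)
        (fun x _ => (hc.2 x).1)
      simp at this
      linarith
    refine ode_trap (Fc_locLip hcn γ s₀ i₀) (by simp [Fc, hi]) (a := -A) (b := (i₀ + s₀) / γ)
      (by linarith) (by positivity) ?_ ?_
    · unfold Fc
      have h1 := exp_le_exp.2 hcint
      have h2 := Real.quadratic_le_exp_of_nonneg (x := βs * A) (by positivity)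
      have h3 : s₀ * (1 + βs * A + (βs * A) ^ 2 / 2) ≤ s₀ * exp (-∫ r in (0:ℝ)..(-A), c r) :=
        mul_le_mul_of_nonneg_left (h2.trans h1) hs.le
      have h4 : 2 * (i₀ + γ) * A ≤ s₀ * βs ^ 2 * A * A := by gcongr
      have h5 : 0 ≤ s₀ * (βs * A) := by positivity
      have h6 : i₀ ≤ i₀ * A := by nlinarith
      nlinarith
    · unfold Fc
      rw [mul_div_cancel₀ _ hγ.ne']
      have : 0 < s₀ * exp (-∫ r in (0:ℝ)..((i₀ + s₀) / γ), c r) := by positivity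
      linarith

lemma cov {c τ i : ℝ → ℝ} (h0 : τ 0 = 0) (hτ : ∀ t, HasDerivAt τ (i t) t) (hi : ∀ t, 0 < i t)
    (t : ℝ) : ∫ r in (0:ℝ)..t, c (τ r) * i r = ∫ u in (0:ℝ)..τ t, c u := by
  have := intervalIntegral.integral_comp_mul_deriv_of_deriv_nonneg (a := 0) (b := t) (f := τ)
    (f' := i) (g := c) (HasDerivAt.continuousOn fun x _ => hτ x) (fun x _ => hτ x)
    (fun x _ => (hi x).le)
  rw [h0] at this
  exact this

lemma tau_int {τ i : ℝ → ℝ} (h0 : τ 0 = 0) (hτ : ∀ t, HasDerivAt τ (i t) t) (hi : Continuous i)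
    (t : ℝ) : ∫ r in (0:ℝ)..t, i r = τ t := by
  rw [intervalIntegral.integral_eq_sub_of_hasDerivAt (fun x _ => hτ x)
    (hi.intervalIntegrable _ _), h0, sub_zero]

lemma existence {βs β γ s₀ i₀ : ℝ} {c : ℝ → ℝ} (hβs : 0 < βs) (hγ : 0 < γ)
    (hc : IsAdmissible βs β c) (hs : 0 ≤ s₀) (hi : 0 < i₀) :
    ∃ b s i τ : ℝ → ℝ, IsAdmissible βs β b ∧ IsTrajectory γ b s₀ i₀ s i ∧ τ 0 = 0 ∧
      ∀ t, HasDerivAt τ (i t) t ∧ 0 < i t ∧ i t = Fc c γ s₀ i₀ (τ t) := by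
  obtain ⟨τ, h0, hτ⟩ := exists_tau hβs hγ hc hs hi
  have hcn : NiceG c := NiceG.of_bdd hc.1 hc.2
  have hτc : Continuous τ := continuous_iff_continuousAt.2 fun t => (hτ t).1.continuousAt
  set i : ℝ → ℝ := fun t => Fc c γ s₀ i₀ (τ t) with hidef
  have hic : Continuous i := (Fc_locLip hcn γ s₀ i₀).continuous.comp hτc
  set s : ℝ → ℝ := fun t => s₀ * exp (-∫ r in (0:ℝ)..τ t, c r) with hsdef
  have hsc : Continuous s := by
    have := hcn.locLip.continuous.comp hτc
    exact continuous_const.mul this.neg.rexp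
  have hb : IsAdmissible βs β (fun t => c (τ t)) := ⟨hc.1.comp hτc.measurable, fun t => hc.2 _⟩
  have hbn : NiceG (fun t => c (τ t)) := NiceG.of_bdd hb.1 hb.2
  have hin := NiceG.of_cont hic
  have hsn := NiceG.of_cont hsc
  have hg : NiceG (fun t => 0 - c (τ t) * i t) := (NiceG.of_cont continuous_const).sub (hbn.mul hin)
  have hG : ∀ t, ∫ r in (0:ℝ)..t, (0 - c (τ r) * i r) = -∫ r in (0:ℝ)..τ t, c r := by
    intro t
    rw [← cov h0 (fun t => (hτ t).1) (fun t => (hτ t).2) t, ← intervalIntegral.integral_neg]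
    simp only [zero_sub, hidef]
  have hS : ∀ t, s t = s₀ - ∫ r in (0:ℝ)..t, c (τ r) * s r * i r := by
    intro t
    have := expForm hg s₀ t
    simp only [hG] at this
    rw [sub_eq_add_neg, ← intervalIntegral.integral_neg]
    refine this.trans ?_
    congr 2
    funext r
    simp only [hsdef]; ring
  refine ⟨fun t => c (τ t), s, i, τ, hb, ⟨hsc, hic, hS, ?_⟩, h0, fun t => ⟨(hτ t).1, (hτ t).2, rfl⟩⟩
  intro t
  have h1 : ∫ r in (0:ℝ)..t, (c (τ r) * s r - γ) * i r
      = (∫ r in (0:ℝ)..t, c (τ r) * s r * i r) - ∫ r in (0:ℝ)..t, γ * i r := by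
    rw [← intervalIntegral.integral_sub (((hbn.mul hsn).mul hin).intervalIntegrable _ _)
      ((hic.const_mul γ).intervalIntegrable _ _)]
    congr 1; funext r; ring
  rw [h1, intervalIntegral.integral_const_mul, tau_int h0 (fun t => (hτ t).1) hic]
  have h2 := hS t
  have h3 : i t = i₀ + s₀ - s t - γ * τ t := rfl
  linarith

lemma representation {βs β γ s₀ i₀ : ℝ} {b s i : ℝ → ℝ} (hβ : βs < β)
    (hb : IsAdmissible βs β b) (hi : 0 < i₀) (hT : IsTrajectory γ b s₀ i₀ s i) :
    ∃ c τ : ℝ → ℝ, IsAdmissible βs β c ∧ τ 0 = 0 ∧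
      (∀ t, HasDerivAt τ (i t) t ∧ 0 < i t ∧ i t = Fc c γ s₀ i₀ (τ t)) ∧
      ((∀ t, b t = β) → c = fun _ => β) := by
  obtain ⟨hsc, hic, hS, hI⟩ := hT
  have hbn : NiceG b := NiceG.of_bdd hb.1 hb.2
  have hin := NiceG.of_cont hic
  have hsn := NiceG.of_cont hsc
  have hpos : ∀ t, 0 < i t := by
    intro t
    rw [expUniq ((hbn.mul hsn).sub (NiceG.of_cont (continuous_const (y := γ)))) hic i₀ hI t]
    positivity
  set τ : ℝ → ℝ := fun t => ∫ r in (0:ℝ)..t, i r with hτdef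
  have hτ : ∀ t, HasDerivAt τ (i t) t := fun t =>
    intervalIntegral.integral_hasDerivAt_right (hic.intervalIntegrable _ _)
      (hic.stronglyMeasurableAtFilter _ _) hic.continuousAt
  have h0 : τ 0 = 0 := by simp [hτdef]
  have hτc : Continuous τ := continuous_iff_continuousAt.2 fun t => (hτ t).continuousAt
  have hmono : StrictMono τ := strictMono_of_deriv_pos fun t => by rw [(hτ t).deriv]; exact hpos t
  have hemb : MeasurableEmbedding τ := hτc.measurableEmbedding hmono.injective
  set c : ℝ → ℝ := Function.extend τ b (fun _ => β) with hcdef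
  have hcτ : ∀ t, c (τ t) = b t := fun t => hmono.injective.extend_apply _ _ _
  have hcor : ∀ u, (∃ t, c u = b t) ∨ c u = β := by
    intro u
    by_cases h : ∃ t, τ t = u
    · obtain ⟨t, rfl⟩ := h; exact Or.inl ⟨t, hcτ t⟩
    · exact Or.inr (Function.extend_apply' _ _ _ h)
  have hc : IsAdmissible βs β c := by
    refine ⟨hemb.measurable_extend hb.1 measurable_const, fun u => ?_⟩
    rcases hcor u with ⟨t, h⟩ | h <;> rw [h]
    · exact hb.2 t
    · exact ⟨hβ.le, le_rfl⟩
  refine ⟨c, τ, hc, h0, fun t => ⟨hτ t, hpos t, ?_⟩, fun hbβ => ?_⟩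
  · have hs : s t = s₀ * exp (-∫ r in (0:ℝ)..τ t, c r) := by
      rw [expUniq (g := fun t => 0 - b t * i t)
        ((NiceG.of_cont continuous_const).sub (hbn.mul hin)) hsc s₀ ?_ t]
      · rw [← cov h0 hτ hpos t, ← intervalIntegral.integral_neg]
        simp [hcτ]
      · intro t
        rw [hS t, sub_eq_add_neg, ← intervalIntegral.integral_neg]
        congr 2; funext r; ring
    have h1 : ∫ r in (0:ℝ)..t, (b r * s r - γ) * i r
        = (∫ r in (0:ℝ)..t, b r * s r * i r) - ∫ r in (0:ℝ)..t, γ * i r := by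
      rw [← intervalIntegral.integral_sub (((hbn.mul hsn).mul hin).intervalIntegrable _ _)
        ((hic.const_mul γ).intervalIntegrable _ _)]
      congr 1; funext r; ring
    have h2 := hI t
    rw [h1, intervalIntegral.integral_const_mul, tau_int h0 hτ hic] at h2
    have h3 := hS t
    unfold Fc
    rw [← hs]
    linarith
  · funext u
    rcases hcor u with ⟨t, h⟩ | h
    · rw [h, hbβ]
    · exact h

lemma compare {c τ₀ τ₁ f₀ f₁ : ℝ → ℝ} {βs β γ s₀ i₀ i₁ : ℝ} (hc : IsAdmissible βs β c)
    (hi : i₁ ≤ i₀) (h00 : τ₀ 0 = 0) (h10 : τ₁ 0 = 0)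
    (h0 : ∀ t, HasDerivAt τ₀ (f₀ t) t ∧ 0 < f₀ t ∧ f₀ t = Fc c γ s₀ i₀ (τ₀ t))
    (h1 : ∀ t, HasDerivAt τ₁ (f₁ t) t ∧ 0 < f₁ t ∧ f₁ t = Fc c γ s₀ i₁ (τ₁ t))
    {iM : ℝ} (hM : ∀ t, 0 ≤ t → f₀ t ≤ iM) : ∀ t, 0 ≤ t → f₁ t ≤ iM := by
  intro t ht
  have hF : ∀ u, Fc c γ s₀ i₁ u = Fc c γ s₀ i₀ u - (i₀ - i₁) := by intro u; unfold Fc; ring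
  have hcont : ∀ {τ f : ℝ → ℝ}, (∀ t, HasDerivAt τ (f t) t) → Continuous τ := fun h =>
    continuous_iff_continuousAt.2 fun t => (h t).continuousAt
  have hc0 := hcont fun t => (h0 t).1
  have hc1 := hcont fun t => (h1 t).1
  have m0 : StrictMono τ₀ :=
    strictMono_of_deriv_pos fun t => by rw [(h0 t).1.deriv]; exact (h0 t).2.1
  have m1 : StrictMono τ₁ :=
    strictMono_of_deriv_pos fun t => by rw [(h1 t).1.deriv]; exact (h1 t).2.1
  have hT0 : 0 ≤ τ₁ t := h10 ▸ m1.monotone ht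
  suffices h : ∃ r, 0 ≤ r ∧ τ₀ r = τ₁ t by
    obtain ⟨r, hr, hrt⟩ := h
    have := hM r hr
    rw [(h0 r).2.2, hrt] at this
    rw [(h1 t).2.2, hF]
    linarith
  by_contra hno
  have hlt : ∀ r, 0 ≤ r → τ₀ r < τ₁ t := by
    intro r hr
    by_contra hge
    obtain ⟨x, hx, hxt⟩ := intermediate_value_Icc hr hc0.continuousOn
      (show τ₁ t ∈ Icc (τ₀ 0) (τ₀ r) from ⟨h00.le.trans hT0, not_lt.1 hge⟩)
    exact hno ⟨x, hx.1, hxt⟩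
  have hFc : Continuous (Fc c γ s₀ i₀) :=
    (Fc_locLip (NiceG.of_bdd hc.1 hc.2) γ s₀ i₀).continuous
  obtain ⟨u, hu, humin⟩ := (isCompact_Icc (a := 0) (b := τ₁ t)).exists_isMinOn
    ⟨0, le_rfl, hT0⟩ hFc.continuousOn
  have hm : 0 < Fc c γ s₀ i₀ u := by
    obtain ⟨x, -, hx⟩ := intermediate_value_Icc ht hc1.continuousOn
      (show u ∈ Icc (τ₁ 0) (τ₁ t) by rw [h10]; exact hu)
    have := (h1 x).2.1
    rw [(h1 x).2.2, hx, hF] at this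
    linarith
  set m := Fc c γ s₀ i₀ u
  have hlow := (convex_Ici (0:ℝ)).mul_sub_le_image_sub_of_le_deriv (f := τ₀) (C := m)
    hc0.continuousOn (fun x _ => (h0 x).1.differentiableAt.differentiableWithinAt) (by
      intro x hx
      rw [interior_Ici] at hx
      rw [(h0 x).1.deriv, (h0 x).2.2]
      exact humin ⟨h00 ▸ m0.monotone (le_of_lt hx), (hlt x (le_of_lt hx)).le⟩)
    0 (mem_Ici.2 le_rfl) (τ₁ t / m) (mem_Ici.2 (by positivity)) (by positivity)
  rw [h00, sub_zero, sub_zero, mul_div_cancel₀ _ hm.ne'] at hlow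
  exact absurd (hlt (τ₁ t / m) (by positivity)) (not_lt.2 hlow)

/-- monotonicity of the zones `ℬ`, `𝒜`, `𝒜⁰` in the infected
variable: if `(s₀, i₀)` belongs to one of them and `0 < i₁ ≤ i₀`, then so does
`(s₀, i₁)`. -/
theorem stmt2 (γ βs β iM : ℝ) (hγ : 0 < γ) (hβs : 0 < βs) (hβ : βs < β)
    (hiM : 0 < iM) (hiM1 : iM < 1)
    (s₀ i₀ i₁ : ℝ) (hT : MemT s₀ i₀) (hi₁ : 0 < i₁) (hi₁' : i₁ ≤ i₀) :
    -- (i) viable zone ℬ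
    ((∃ b s i, IsAdmissible βs β b ∧ IsTrajectory γ b s₀ i₀ s i ∧
        ∀ t : ℝ, 0 ≤ t → i t ≤ iM) →
      (∃ b s i, IsAdmissible βs β b ∧ IsTrajectory γ b s₀ i₁ s i ∧
        ∀ t : ℝ, 0 ≤ t → i t ≤ iM)) ∧
    -- (ii) no-effort zone 𝒜 (constant control β)
    ((∃ s i, IsTrajectory γ (fun _ => β) s₀ i₀ s i ∧
        ∀ t : ℝ, 0 ≤ t → i t ≤ iM) →
      (∀ s i, IsTrajectory γ (fun _ => β) s₀ i₁ s i →
        ∀ t : ℝ, 0 ≤ t → i t ≤ iM)) ∧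
    -- (iii) all-control zone 𝒜⁰
    ((∀ b s i, IsAdmissible βs β b → IsTrajectory γ b s₀ i₀ s i →
        ∀ t : ℝ, 0 ≤ t → i t ≤ iM) →
      (∀ b s i, IsAdmissible βs β b → IsTrajectory γ b s₀ i₁ s i →
        ∀ t : ℝ, 0 ≤ t → i t ≤ iM)) := by
  have hi₀ : 0 < i₀ := hi₁.trans_le hi₁'
  refine ⟨?_, ?_, ?_⟩
  · rintro ⟨b, s, i, hb, hT0, hM⟩
    obtain ⟨c, τ, hc, h0, h, -⟩ := representation hβ hb hi₀ hT0
    obtain ⟨b', s', i', τ', hb', hT', h0', h'⟩ := existence hβs hγ hc hT.1 hi₁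
    exact ⟨b', s', i', hb', hT', compare hc hi₁' h0 h0' h h' hM⟩
  · rintro ⟨s, i, hT0, hM⟩ s' i' hT'
    have hb : IsAdmissible βs β (fun _ => β) := ⟨measurable_const, fun _ => ⟨hβ.le, le_rfl⟩⟩
    obtain ⟨c, τ, hc, h0, h, hcβ⟩ := representation hβ hb hi₀ hT0
    obtain ⟨c', τ', hc', h0', h', hcβ'⟩ := representation hβ hb hi₁ hT'
    obtain rfl : c' = c := (hcβ' fun _ => rfl).trans (hcβ fun _ => rfl).symm
    exact compare hc hi₁' h0 h0' h h' hM
  · intro hall b s i hb hT1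
    obtain ⟨c, τ, hc, h0, h, -⟩ := representation hβ hb hi₁ hT1
    obtain ⟨b', s', i', τ', hb', hT', h0', h'⟩ := existence hβs hγ hc hT.1 hi₀
    exact compare hc hi₁' h0' h0 h' h (hall b' s' i' hb' hT')
end
end

section
/- For every (s₀, i₀) ∈ 𝕋, there exists an admissible control b such that i^{s₀,i₀,b}(t) ≤ i_M for all t ≥ 0 if and only if i₀ ≤ Φ_B(s₀). In other words, the viable zone ℬ (the set of initial data in 𝕋 from which some admissible control keeps i(t) ≤ i_M for all t ≥ 0) equals {(s,i) ∈ 𝕋 : i ≤ Φ_B(s)}. -/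
open MeasureTheory Set Real
open scoped ENNReal

noncomputable section

open Filter Topology in
theorem exp_formula (a x : ℝ → ℝ) (x0 : ℝ) (ha : Measurable a)
    (hb : ∀ T, ∃ C, ∀ r ∈ Set.uIcc 0 T, |a r| ≤ C) (hx : Continuous x)
    (hi : ∀ t, x t = x0 + ∫ r in (0:ℝ)..t, a r * x r) (t : ℝ) :
    x t = x0 * Real.exp (∫ r in (0:ℝ)..t, a r) := by
  have hint : ∀ T, IntervalIntegrable a volume 0 T := by
    intro T
    obtain ⟨C, hC⟩ := hb T
    rw [intervalIntegrable_iff]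
    refine Measure.integrableOn_of_bounded (M := C) (by simp) ha.aestronglyMeasurable ?_
    refine (ae_restrict_iff' measurableSet_uIoc).2 (Filter.Eventually.of_forall ?_)
    intro r hr
    exact hC r (uIoc_subset_uIcc hr)
  have hint2 : ∀ T, IntervalIntegrable (fun r => a r * x r) volume 0 T := fun T =>
    (hint T).mul_continuousOn hx.continuousOn
  set A : ℝ → ℝ := fun t => ∫ r in (0:ℝ)..t, a r with hA
  obtain ⟨C, hC⟩ := hb t
  have hC0 : 0 ≤ C := (abs_nonneg _).trans (hC 0 left_mem_uIcc)
  have hAL : LipschitzOnWith ⟨C, hC0⟩ A (Set.uIcc 0 t) := by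
    refine LipschitzOnWith.of_dist_le_mul ?_
    intro u hu v hv
    rw [Real.dist_eq, Real.dist_eq]
    have h1 : A u - A v = ∫ r in v..u, a r :=
      intervalIntegral.integral_interval_sub_left (hint u) (hint v)
    rw [h1]
    refine intervalIntegral.norm_integral_le_of_norm_le_const (f := a) (C := C) ?_
    intro r hr
    exact hC r (Set.uIcc_subset_uIcc hv hu (uIoc_subset_uIcc hr))
  have hE1 : ContDiffOn ℝ 1 (fun y : ℝ => Real.exp (-y)) (Set.Icc (-(C * |t|)) (C * |t|)) := by
    fun_prop
  obtain ⟨K, hK⟩ := hE1.exists_lipschitzOnWith (by decide) (convex_Icc _ _) isCompact_Icc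
  have hmaps : Set.MapsTo A (Set.uIcc 0 t) (Set.Icc (-(C * |t|)) (C * |t|)) := by
    intro u hu
    have h1 := hAL.dist_le_mul u hu 0 left_mem_uIcc
    simp only [Real.dist_eq, hA, intervalIntegral.integral_same, sub_zero] at h1
    have h2 : |u| ≤ |t| := by
      have := Set.abs_sub_left_of_mem_uIcc hu
      simpa using this
    have h3 : |A u| ≤ C * |t| := h1.trans (mul_le_mul_of_nonneg_left h2 hC0)
    exact abs_le.1 h3
  have hEac : AbsolutelyContinuousOnInterval (fun y => Real.exp (-A y)) 0 t :=
    (hK.comp hAL hmaps).absolutelyContinuousOnInterval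
  have hxac : AbsolutelyContinuousOnInterval x 0 t := by
    have h1 := (hint2 t).absolutelyContinuousOnInterval_intervalIntegral
      (c := 0) left_mem_uIcc
    have h2 : AbsolutelyContinuousOnInterval (fun _ : ℝ => x0) 0 t :=
      (LipschitzWith.const x0).lipschitzOnWith.absolutelyContinuousOnInterval
    have h3 := h2.add h1
    have : x = (fun _ : ℝ => x0) + fun y => ∫ r in (0:ℝ)..y, a r * x r := by
      funext y; exact hi y
    rw [← this] at h3
    exact h3
  have hz := hxac.mul hEac
  have hd : ∀ᵐ y, y ∈ Set.uIcc 0 t → HasDerivAt (x * fun y => Real.exp (-A y)) 0 y := by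
    filter_upwards [(hint t).ae_hasDerivAt_integral, (hint2 t).ae_hasDerivAt_integral]
      with y h1 h2 hy
    have e1 := h1 hy 0 left_mem_uIcc
    have e2 := (h2 hy 0 left_mem_uIcc).const_add x0
    have : x = (fun y => x0 + ∫ r in (0:ℝ)..y, a r * x r) := by
      funext y; exact hi y
    rw [← this] at e2
    have e3 := e2.mul (e1.neg.exp)
    refine e3.congr_deriv ?_
    simp only [Pi.neg_apply]; ring
  obtain ⟨c, hc⟩ := hz.const_of_ae_hasDerivAt_zero hd
  have c0 := hc 0 left_mem_uIcc
  have c1 := hc t right_mem_uIcc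
  have x00 : x 0 = x0 := by rw [hi 0]; simp
  have hA0 : A 0 = 0 := by simp [hA]
  simp only [Pi.mul_apply, hA0, x00, neg_zero, Real.exp_zero, mul_one] at c0 c1
  rw [c0, ← c1]
  change x t = x t * Real.exp (-A t) * Real.exp (A t)
  rw [mul_assoc, ← Real.exp_add]; simp

theorem global_ode (v : ℝ → ℝ) (K : NNReal) (L : NNReal) (hv : LipschitzWith K v)
    (hL : ∀ x, |v x| ≤ L) : ∃ R : ℝ → ℝ, R 0 = 0 ∧ ∀ t, HasDerivAt R (v (R t)) t := by
  have hloc : ∀ n : ℕ, ∃ α : ℝ → ℝ, α 0 = 0 ∧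
      ∀ t ∈ Set.Ioo (-((n:ℝ)+1)) ((n:ℝ)+1), HasDerivAt α (v (α t)) t := by
    intro n
    have hn : (0:ℝ) ≤ n := Nat.cast_nonneg n
    have h0 : (0:ℝ) ∈ Set.Icc (-((n:ℝ)+1)) ((n:ℝ)+1) := ⟨by linarith, by linarith⟩
    have hpl : IsPicardLindelof (fun _ => v) (⟨0, h0⟩ : Set.Icc (-((n:ℝ)+1)) ((n:ℝ)+1)) (0:ℝ)
        (L * (n+1)) 0 L K := by
      refine ⟨fun t _ => hv.lipschitzOnWith, fun x _ => continuousOn_const,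
        fun t _ x _ => hL x, ?_⟩
      simp
    obtain ⟨α, h1, h2⟩ := hpl.exists_eq_forall_mem_Icc_hasDerivWithinAt₀
    exact ⟨α, h1, fun t ht => (h2 t (Set.Ioo_subset_Icc_self ht)).hasDerivAt
      (Icc_mem_nhds ht.1 ht.2)⟩
  choose α h1 h2 using hloc
  have huniq : ∀ m n : ℕ, m ≤ n → Set.EqOn (α m) (α n) (Set.Ioo (-((m:ℝ)+1)) ((m:ℝ)+1)) := by
    intro m n hmn
    have hm : (0:ℝ) ≤ m := Nat.cast_nonneg m
    have hmn' : (m:ℝ) ≤ n := Nat.cast_le.2 hmn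
    refine ODE_solution_unique_of_mem_Ioo (v := fun _ => v) (s := fun _ => Set.univ) (K := K)
      (t₀ := 0) (fun t _ => hv.lipschitzOnWith) ⟨by linarith, by linarith⟩
      (fun t ht => ⟨h2 m t ht, trivial⟩) (fun t ht => ⟨h2 n t ⟨?_, ?_⟩, trivial⟩)
      (by rw [h1, h1])
    · linarith [ht.1]
    · linarith [ht.2]
  have key : ∀ (n : ℕ), ∀ t ∈ Set.Ioo (-((n:ℝ)+1)) ((n:ℝ)+1), α ⌈|t|⌉₊ t = α n t := by
    intro n t ht
    have hc : |t| ≤ (⌈|t|⌉₊ : ℝ) := Nat.le_ceil _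
    have := abs_le.1 hc
    rcases le_total ⌈|t|⌉₊ n with h | h
    · exact huniq _ _ h ⟨by linarith, by linarith⟩
    · exact (huniq _ _ h ht).symm
  refine ⟨fun t => α ⌈|t|⌉₊ t, by simp [h1], ?_⟩
  intro t
  have hc : |t| ≤ (⌈|t|⌉₊ : ℝ) := Nat.le_ceil _
  have hc' := abs_le.1 hc
  have hmem : t ∈ Set.Ioo (-((⌈|t|⌉₊:ℝ)+1)) ((⌈|t|⌉₊:ℝ)+1) := ⟨by linarith, by linarith⟩
  refine (h2 ⌈|t|⌉₊ t hmem).congr_of_eventuallyEq ?_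
  filter_upwards [Ioo_mem_nhds hmem.1 hmem.2] with u hu
  exact key _ u hu

theorem scalar_ode (γ k s0 i0 : ℝ) (hγ : 0 < γ) (hk : 0 < k) (hs : 0 < s0) (hi : 0 < i0) :
    ∃ R : ℝ → ℝ, R 0 = 0 ∧
      ∀ t, HasDerivAt R (γ * (s0 + i0 - R t - s0 * Real.exp (-k * R t))) t := by
  set g : ℝ → ℝ := fun R => γ * (s0 + i0 - R - s0 * Real.exp (-k * R)) with hg
  have hgc : Continuous g := by fun_prop
  have g0 : 0 < g 0 := by simp [hg]; positivity
  obtain ⟨B, hB, hgB⟩ : ∃ B > 0, g B = 0 := by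
    have h1 : g (s0 + i0) ≤ 0 := by
      have : 0 < Real.exp (-k * (s0 + i0)) := Real.exp_pos _
      have : 0 ≤ γ * (s0 * Real.exp (-k * (s0 + i0))) := by positivity
      simp only [hg]; nlinarith
    obtain ⟨B, hB, hB'⟩ := intermediate_value_Icc' (by positivity : (0:ℝ) ≤ s0 + i0)
      hgc.continuousOn ⟨h1, g0.le⟩
    refine ⟨B, lt_of_le_of_ne hB.1 ?_, hB'⟩
    rintro rfl; exact g0.ne' hB'
  obtain ⟨A, hA, hgA⟩ : ∃ A < 0, g A = 0 := by
    -- choose `M` large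
    set M : ℝ := 2 * (i0 + 1 / k + 1 + 1 / (s0 * k ^ 2)) with hM
    obtain ⟨M, hM0, hM1⟩ : ∃ M : ℝ, 0 ≤ M ∧ s0 + i0 + M ≤ s0 * (1 + k * M + (k * M) ^ 2 / 2) := by
      refine ⟨i0 + 2 / (s0 * k ^ 2) + 2 / (s0 * k ^ 2), by positivity, ?_⟩
      set p := 2 / (s0 * k ^ 2) with hp
      have hp0 : 0 < p := by positivity
      have e : s0 * k ^ 2 * p = 2 := by rw [hp]; field_simp
      have h1 : s0 * (k * (i0 + p + p)) ^ 2 / 2 * p = (i0 + p + p) ^ 2 := by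
        calc _ = (s0 * k ^ 2 * p) * (i0 + p + p) ^ 2 / 2 := by ring
          _ = _ := by rw [e]; ring
      have h2 : i0 + (i0 + p + p) ≤ s0 * (k * (i0 + p + p)) ^ 2 / 2 := by
        refine le_of_mul_le_mul_right ?_ hp0
        rw [h1]
        nlinarith [mul_pos hi hp0, sq_nonneg i0, sq_nonneg p]
      have h3 : 0 ≤ s0 * (k * (i0 + p + p)) := by positivity
      nlinarith
    have h1 : g (-M) ≤ 0 := by
      have := Real.quadratic_le_exp_of_nonneg (by positivity : 0 ≤ k * M)
      have h4 : s0 * (1 + k * M + (k * M) ^ 2 / 2) ≤ s0 * Real.exp (k * M) := by gcongr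
      have e : -k * -M = k * M := by ring
      simp only [hg, e]
      nlinarith
    obtain ⟨A, hA, hA'⟩ := intermediate_value_Icc (by linarith : -M ≤ (0:ℝ))
      hgc.continuousOn ⟨h1, g0.le⟩
    refine ⟨A, lt_of_le_of_ne hA.2 ?_, hA'⟩
    rintro rfl; exact g0.ne' hA'
  have hAB : A ≤ B := by linarith
  have hgd : ContDiffOn ℝ 1 g (Set.Icc A B) := by fun_prop
  obtain ⟨K, hK⟩ := hgd.exists_lipschitzOnWith (by decide) (convex_Icc _ _) isCompact_Icc
  set v : ℝ → ℝ := fun x => g (max A (min B x)) with hv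
  have hmem : ∀ x, max A (min B x) ∈ Set.Icc A B := fun x =>
    ⟨le_max_left _ _, max_le hAB (min_le_left _ _)⟩
  have hvL : LipschitzWith K v := by
    have h1 : LipschitzWith 1 (fun x : ℝ => max A (min B x)) :=
      (LipschitzWith.id.const_min B).const_max A
    have := hK.comp (h1.lipschitzOnWith (s := Set.univ)) (fun x _ => hmem x)
    rw [mul_one] at this
    exact lipschitzOnWith_univ.1 this
  obtain ⟨L, hL⟩ := isCompact_Icc.exists_bound_of_continuousOn (hgc.continuousOn (s := Set.Icc A B))
  have hL0 : 0 ≤ L := (norm_nonneg _).trans (hL A ⟨le_rfl, hAB⟩)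
  obtain ⟨R, R0, hR⟩ := global_ode v K ⟨L, hL0⟩ hvL (fun x => hL _ (hmem x))
  have hRc : Continuous R := continuous_iff_continuousAt.2 fun t => (hR t).continuousAt
  have hne : ∀ c, c ≠ 0 → v c = 0 → ∀ t, R t ≠ c := by
    intro c hc hvc t htc
    have : R = fun _ => c := by
      refine ODE_solution_unique_univ (v := fun _ => v) (s := fun _ => Set.univ) (K := K)
        (t₀ := t) (fun t => hvL.lipschitzOnWith) (fun t => ⟨hR t, trivial⟩)
        (fun t => ⟨?_, trivial⟩) htc
      simp only [hvc]; exact hasDerivAt_const _ _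
    exact hc (by rw [← R0, this])
  have hvA : v A = 0 := by simp [hv, hAB, hgA]
  have hvB : v B = 0 := by simp [hv, hAB, hgB]
  have hRA : ∀ t, A < R t := by
    intro t
    by_contra h
    push Not at h
    obtain ⟨u, hu⟩ := mem_range_of_exists_le_of_exists_ge hRc ⟨t, h⟩ ⟨0, by rw [R0]; exact hA.le⟩
    exact hne A hA.ne hvA u hu
  have hRB : ∀ t, R t < B := by
    intro t
    by_contra h
    push Not at h
    obtain ⟨u, hu⟩ := mem_range_of_exists_le_of_exists_ge hRc ⟨0, by rw [R0]; exact hB.le⟩ ⟨t, h⟩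
    exact hne B hB.ne' hvB u hu
  refine ⟨R, R0, fun t => ?_⟩
  have := hR t
  simp only [hv, min_eq_right (hRB t).le, max_eq_right (hRA t).le] at this
  exact this

theorem traj_of_deriv (γ bs s0 i0 : ℝ) (s i : ℝ → ℝ) (h0 : s 0 = s0) (h1 : i 0 = i0)
    (hs : ∀ t, HasDerivAt s (-(bs * s t * i t)) t)
    (hi : ∀ t, HasDerivAt i ((bs * s t - γ) * i t) t) :
    IsTrajectory γ (fun _ => bs) s0 i0 s i := by
  have hsc : Continuous s := continuous_iff_continuousAt.2 fun t => (hs t).continuousAt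
  have hic : Continuous i := continuous_iff_continuousAt.2 fun t => (hi t).continuousAt
  refine ⟨hsc, hic, fun t => ?_, fun t => ?_⟩
  · have := intervalIntegral.integral_eq_sub_of_hasDerivAt (a := 0) (b := t)
      (fun x _ => hs x) (Continuous.intervalIntegrable (by fun_prop) _ _)
    rw [intervalIntegral.integral_neg, h0] at this
    linarith
  · have := intervalIntegral.integral_eq_sub_of_hasDerivAt (a := 0) (b := t)
      (fun x _ => hi x) (Continuous.intervalIntegrable (by fun_prop) _ _)
    rw [h1] at this
    linarith

theorem exists_traj (γ bs s0 i0 : ℝ) (hγ : 0 < γ) (hb : 0 < bs) (hs : 0 ≤ s0) (hi : 0 ≤ i0) :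
    ∃ s i, IsTrajectory γ (fun _ => bs) s0 i0 s i := by
  rcases hs.eq_or_lt with h | hs
  · refine ⟨fun _ => 0, fun t => i0 * Real.exp (-γ * t),
      traj_of_deriv _ _ _ _ _ _ h (by simp) (fun t => ?_) (fun t => ?_)⟩
    · simpa using hasDerivAt_const t (0:ℝ)
    · have := (((hasDerivAt_id t).const_mul (-γ)).exp).const_mul i0
      refine this.congr_deriv ?_
      simp; ring
  rcases hi.eq_or_lt with h | hi
  · refine ⟨fun _ => s0, fun t => 0, traj_of_deriv _ _ _ _ _ _ rfl h (fun t => ?_) (fun t => ?_)⟩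
    · simpa using hasDerivAt_const t s0
    · simpa using hasDerivAt_const t (0:ℝ)
  obtain ⟨R, R0, hR⟩ := scalar_ode γ (bs / γ) s0 i0 hγ (by positivity) hs hi
  have hS : ∀ t, HasDerivAt (fun t => s0 * Real.exp (-(bs / γ) * R t))
      (-(bs * (s0 * Real.exp (-(bs / γ) * R t)) *
        (s0 + i0 - R t - s0 * Real.exp (-(bs / γ) * R t)))) t := by
    intro t
    have := (((hR t).const_mul (-(bs / γ))).exp).const_mul s0
    refine this.congr_deriv ?_
    field_simp
  refine ⟨fun t => s0 * Real.exp (-(bs / γ) * R t),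
    fun t => s0 + i0 - R t - s0 * Real.exp (-(bs / γ) * R t),
    traj_of_deriv _ _ _ _ _ _ (by simp [R0]) (by simp [R0]) hS (fun t => ?_)⟩
  have := ((hR t).const_sub (s0 + i0)).sub (hS t)
  refine this.congr_deriv ?_
  ring

/-- exponential formulas along a trajectory -/
theorem traj_formulas (γ bs β : ℝ) (hbs : 0 < bs) (b : ℝ → ℝ) (hb : IsAdmissible bs β b)
    (s0 i0 : ℝ) (s i : ℝ → ℝ) (h : IsTrajectory γ b s0 i0 s i) (t : ℝ) :
    s t = s0 * Real.exp (-∫ r in (0:ℝ)..t, b r * i r) ∧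
    i t = i0 * Real.exp (∫ r in (0:ℝ)..t, (b r * s r - γ)) ∧
    s t + i t = s0 + i0 - γ * ∫ r in (0:ℝ)..t, i r := by
  obtain ⟨hsc, hic, hs, hi⟩ := h
  obtain ⟨hbm, hbb⟩ := hb
  have hb1 : ∀ r, |b r| ≤ β := fun r => by
    rw [abs_of_pos (hbs.trans_le (hbb r).1)]; exact (hbb r).2
  have hβ0 : 0 ≤ β := (abs_nonneg _).trans (hb1 0)
  have bd : ∀ f : ℝ → ℝ, Continuous f → ∀ T, ∃ C, ∀ r ∈ Set.uIcc 0 T, |b r * f r| ≤ C := by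
    intro f hf T
    obtain ⟨C, hC⟩ := isCompact_uIcc.exists_bound_of_continuousOn
      (hf.continuousOn (s := Set.uIcc 0 T))
    refine ⟨β * C, fun r hr => ?_⟩
    rw [abs_mul]
    exact mul_le_mul (hb1 r) (hC r hr) (abs_nonneg _) hβ0
  have hbint : ∀ T, IntervalIntegrable b volume 0 T := by
    intro T
    rw [intervalIntegrable_iff]
    exact Measure.integrableOn_of_bounded (M := β) (by simp) hbm.aestronglyMeasurable
      (Filter.Eventually.of_forall hb1)
  refine ⟨?_, ?_, ?_⟩
  · rw [← intervalIntegral.integral_neg]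
    refine exp_formula (fun r => -(b r * i r)) s s0 (hbm.mul hic.measurable).neg ?_ hsc ?_ t
    · intro T; simpa only [abs_neg] using bd i hic T
    · intro t
      rw [hs t, sub_eq_add_neg, ← intervalIntegral.integral_neg]
      congr 2; funext r; ring
  · refine exp_formula (fun r => b r * s r - γ) i i0
      ((hbm.mul hsc.measurable).sub_const γ) ?_ hic hi t
    intro T
    obtain ⟨C, hC⟩ := bd s hsc T
    exact ⟨C + |γ|, fun r hr => (abs_sub _ _).trans (by linarith [hC r hr])⟩
  · have e1 : IntervalIntegrable (fun r => b r * s r * i r) volume 0 t :=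
      ((hbint t).mul_continuousOn hsc.continuousOn).mul_continuousOn hic.continuousOn
    have e2 : IntervalIntegrable (fun r => γ * i r) volume 0 t :=
      (hic.const_mul γ).intervalIntegrable _ _
    have e3 : (∫ r in (0:ℝ)..t, (b r * s r - γ) * i r)
        = (∫ r in (0:ℝ)..t, b r * s r * i r) - γ * ∫ r in (0:ℝ)..t, i r := by
      rw [← intervalIntegral.integral_const_mul, ← intervalIntegral.integral_sub e1 e2]
      congr 1; funext r; ring
    rw [hs t, hi t, e3]; ring

theorem log_ineq (c x : ℝ) (hc : 0 < c) (hx : 0 < x) :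
    c - c * Real.log c ≤ x - c * Real.log x := by
  have h := Real.log_le_sub_one_of_pos (div_pos hx hc)
  rw [Real.log_div hx.ne' hc.ne'] at h
  have h2 := mul_le_mul_of_nonneg_left h hc.le
  have : c * (x / c - 1) = x - c := by field_simp
  rw [this] at h2; linarith

theorem log_mono (c x y : ℝ) (hc : 0 < c) (hx : c ≤ x) (hy : x ≤ y) :
    x - c * Real.log x ≤ y - c * Real.log y := by
  have hx0 : 0 < x := hc.trans_le hx
  have := log_ineq x y hx0 (hx0.trans_le hy)
  have hl : Real.log x ≤ Real.log y := Real.log_le_log hx0 hy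
  nlinarith

theorem suff_dir (γ bs β iM sM : ℝ) (hγ : 0 < γ) (hb : 0 < bs) (hβ : bs < β) (hiM : 0 < iM)
    (s0 i0 : ℝ) (hT : MemT s0 i0) (h : i0 ≤ Phi γ bs iM sM s0) :
    ∃ b s i, IsAdmissible bs β b ∧ IsTrajectory γ b s0 i0 s i ∧
        ∀ t : ℝ, 0 ≤ t → i t ≤ iM := by
  obtain ⟨hs0, hi0, -⟩ := hT
  obtain ⟨s, i, htr⟩ := exists_traj γ bs s0 i0 hγ hb hs0 hi0
  have hadm : IsAdmissible bs β (fun _ => bs) := ⟨measurable_const, fun _ => ⟨le_rfl, hβ.le⟩⟩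
  refine ⟨fun _ => bs, s, i, hadm, htr, fun t ht => ?_⟩
  have F := traj_formulas γ bs β hb _ hadm s0 i0 s i htr
  have hipos : ∀ t, 0 ≤ i t := fun t => by rw [(F t).2.1]; positivity
  have hsle : ∀ t, 0 ≤ t → s t ≤ s0 := by
    intro t ht
    rw [(F t).1]
    refine mul_le_of_le_one_right hs0 (Real.exp_le_one_iff.2 ?_)
    rw [neg_nonpos]
    exact intervalIntegral.integral_nonneg ht fun r _ => mul_nonneg hb.le (hipos r)
  unfold Phi at h
  split_ifs at h with h1 h2
  · refine le_trans ?_ h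
    rw [(F t).2.1]
    refine mul_le_of_le_one_right hi0 (Real.exp_le_one_iff.2 ?_)
    rw [← neg_nonneg, ← intervalIntegral.integral_neg]
    refine intervalIntegral.integral_nonneg ht fun r hr => ?_
    have e1 := (hsle r hr.1).trans h1
    rw [le_div_iff₀ hb] at e1
    linarith
  · obtain ⟨f1, -, f3⟩ := F t
    have hc : 0 < γ / bs := by positivity
    have hs0' : 0 < s0 := by linarith
    have hst : 0 < s t := by rw [f1]; positivity
    have hl := log_ineq (γ / bs) (s t) hc hst
    have e1 : Real.log (s t) = Real.log s0 - bs * ∫ r in (0:ℝ)..t, i r := by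
      rw [f1, Real.log_mul hs0'.ne' (Real.exp_pos _).ne', Real.log_exp,
        intervalIntegral.integral_const_mul]
      ring
    have e2 : bs * s0 / γ = s0 / (γ / bs) := by field_simp
    rw [e2, Real.log_div hs0'.ne' hc.ne'] at h
    rw [e1] at hl
    have e3 : γ / bs * (Real.log s0 - bs * ∫ r in (0:ℝ)..t, i r)
        = γ / bs * Real.log s0 - γ * ∫ r in (0:ℝ)..t, i r := by
      field_simp
    rw [e3] at hl
    linarith
  · have : i0 = 0 := le_antisymm h hi0
    rw [(F t).2.1, this, zero_mul]; exact hiM.le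

theorem nec_dir (γ bs β iM sM : ℝ) (hγ : 0 < γ) (hb : 0 < bs) (hiM : 0 < iM)
    (hsMs : γ / bs < sM)
    (hsMs' : iM - sM + γ / bs + (γ / bs) * Real.log (bs * sM / γ) = 0)
    (s0 i0 : ℝ) (hT : MemT s0 i0) (b s i : ℝ → ℝ) (hadm : IsAdmissible bs β b)
    (htr : IsTrajectory γ b s0 i0 s i) (hle : ∀ t : ℝ, 0 ≤ t → i t ≤ iM) :
    i0 ≤ Phi γ bs iM sM s0 := by
  obtain ⟨hs0, hi0, -⟩ := hT
  have F := traj_formulas γ bs β hb _ hadm s0 i0 s i htr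
  have hi00 : i 0 = i0 := by rw [(F 0).2.1]; simp
  have hs00 : s 0 = s0 := by rw [(F 0).1]; simp
  have hc : 0 < γ / bs := by positivity
  by_cases h1 : s0 ≤ γ / bs
  · rw [Phi, if_pos h1, ← hi00]; exact hle 0 le_rfl
  push Not at h1
  have hlog : ∀ x, 0 < x → Real.log (bs * x / γ) = Real.log x - Real.log (γ / bs) := by
    intro x hx
    rw [← Real.log_div hx.ne' hc.ne']; congr 1; field_simp
  have hs0' : 0 < s0 := hc.trans h1
  have hPhi0 : 0 ≤ Phi γ bs iM sM s0 := by
    rw [Phi, if_neg h1.not_ge]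
    split_ifs with h2
    · have := log_mono (γ / bs) s0 sM hc h1.le h2.le
      rw [hlog s0 hs0']
      rw [hlog sM (hc.trans hsMs)] at hsMs'
      linarith
    · exact le_rfl
  rcases hi0.eq_or_lt with hz | hi0'
  · rw [← hz]; exact hPhi0
  have hipos : ∀ t, 0 < i t := fun t => by rw [(F t).2.1]; positivity
  have hsc : Continuous s := htr.1
  have hic : Continuous i := htr.2.1
  have hbint : ∀ T, IntervalIntegrable b volume 0 T := by
    intro T
    rw [intervalIntegrable_iff]
    refine Measure.integrableOn_of_bounded (M := β) (by simp) hadm.1.aestronglyMeasurable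
      (Filter.Eventually.of_forall fun r => ?_)
    rw [Real.norm_eq_abs, abs_of_pos (hb.trans_le (hadm.2 r).1)]; exact (hadm.2 r).2
  have hbi : ∀ T, IntervalIntegrable (fun r => b r * i r) volume 0 T := fun T =>
    (hbint T).mul_continuousOn hic.continuousOn
  have hmonoI : ∀ t, 0 ≤ t → bs * (∫ r in (0:ℝ)..t, i r) ≤ ∫ r in (0:ℝ)..t, b r * i r := by
    intro t ht
    rw [← intervalIntegral.integral_const_mul]
    refine intervalIntegral.integral_mono_on ht ((hic.const_mul bs).intervalIntegrable _ _) (hbi t)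
      fun r _ => mul_le_mul_of_nonneg_right (hadm.2 r).1 (hipos r).le
  -- there is a time at which `s = γ / bs`
  obtain ⟨T, hT0, hsT⟩ : ∃ T, 0 ≤ T ∧ s T = γ / bs := by
    by_contra hcon
    push Not at hcon
    have hgt : ∀ t, 0 ≤ t → γ / bs < s t := by
      intro t ht
      by_contra hlt
      push Not at hlt
      obtain ⟨u, hu, hu'⟩ := intermediate_value_Icc' ht hsc.continuousOn
        ⟨hlt, by rw [hs00]; exact h1.le⟩
      exact hcon u hu.1 hu'
    have hige : ∀ t, 0 ≤ t → i0 ≤ i t := by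
      intro t ht
      rw [(F t).2.1]
      refine le_mul_of_one_le_right hi0 (Real.one_le_exp ?_)
      refine intervalIntegral.integral_nonneg ht fun r hr => ?_
      have e1 := hgt r hr.1
      rw [div_lt_iff₀ hb] at e1
      nlinarith [(hadm.2 r).1, mul_le_mul_of_nonneg_right (hadm.2 r).1 (hc.trans (hgt r hr.1)).le]
    have hIge : ∀ t, 0 ≤ t → i0 * t ≤ ∫ r in (0:ℝ)..t, i r := by
      intro t ht
      have := intervalIntegral.integral_mono_on ht (intervalIntegrable_const (c := i0))
        (hic.intervalIntegrable 0 t) (μ := volume) fun r hr => hige r hr.1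
      simp at this; linarith
    -- `s + i` would become negative
    set t := (s0 + i0) / (γ * i0) with ht
    have ht0 : 0 ≤ t := by positivity
    have e1 := (F t).2.2
    have e2 := mul_le_mul_of_nonneg_left (hIge t ht0) hγ.le
    have e3 : γ * (i0 * t) = s0 + i0 := by rw [ht]; field_simp
    have := hgt t ht0
    have := hipos t
    linarith
  have hV : s0 + i0 - γ / bs * Real.log s0 ≤ γ / bs + iM - γ / bs * Real.log (γ / bs) := by
    obtain ⟨f1, -, f3⟩ := F T
    have e1 : Real.log (s T) = Real.log s0 - ∫ r in (0:ℝ)..T, b r * i r := by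
      rw [f1, Real.log_mul hs0'.ne' (Real.exp_pos _).ne', Real.log_exp]
      ring
    rw [hsT] at e1 f3
    have e2 := mul_le_mul_of_nonneg_left (hmonoI T hT0) hc.le
    have e3 : γ / bs * (bs * ∫ r in (0:ℝ)..T, i r) = γ * ∫ r in (0:ℝ)..T, i r := by
      field_simp
    rw [e3] at e2
    have e4 := hle T hT0
    have e5 : (∫ r in (0:ℝ)..T, b r * i r) = Real.log s0 - Real.log (γ / bs) := by linarith
    rw [e5] at e2
    linarith
  rw [Phi, if_neg h1.not_ge]
  split_ifs with h2
  · rw [hlog s0 hs0']; linarith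
  · push Not at h2
    have := log_mono (γ / bs) sM s0 hc hsMs.le h2
    rw [hlog sM (hc.trans hsMs)] at hsMs'
    linarith

/-- characterization of the viable zone:
`(s₀,i₀) ∈ 𝕋` admits an admissible control keeping `i(t) ≤ i_M` for all
`t ≥ 0` if and only if `i₀ ≤ Φ_B(s₀)`. -/
theorem stmt3 (γ βs β iM sMs : ℝ) (hγ : 0 < γ) (hβs : 0 < βs) (hβ : βs < β)
    (hiM : 0 < iM) (hiM1 : iM < 1)
    (hsMs : γ / βs < sMs)
    (hsMs' : iM - sMs + γ / βs + (γ / βs) * Real.log (βs * sMs / γ) = 0)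
    (s₀ i₀ : ℝ) (hT : MemT s₀ i₀) :
    (∃ b s i, IsAdmissible βs β b ∧ IsTrajectory γ b s₀ i₀ s i ∧
        ∀ t : ℝ, 0 ≤ t → i t ≤ iM) ↔
      i₀ ≤ Phi γ βs iM sMs s₀ := by
  constructor
  · rintro ⟨b, s, i, hadm, htr, hle⟩
    exact nec_dir γ βs β iM sMs hγ hβs hiM hsMs hsMs' s₀ i₀ hT b s i hadm htr hle
  · exact suff_dir γ βs β iM sMs hγ hβs hβ hiM s₀ i₀ hT
end
end

section
/- For every (s₀, i₀) ∈ 𝕋, the trajectory driven by the constant control β satisfies i^{s₀,i₀,β}(t) ≤ i_M for all t ≥ 0 if and only if i₀ ≤ Φ_A(s₀). In other words, the no-effort zone 𝒜 equals {(s,i) ∈ 𝕋 : i ≤ Φ_A(s)}. -/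
open MeasureTheory Set Real
open scoped ENNReal

noncomputable section

lemma lin_ode (a x : ℝ → ℝ) (x0 : ℝ) (ha : Continuous a) (hx : Continuous x)
    (h : ∀ t : ℝ, x t = x0 + ∫ r in (0:ℝ)..t, a r * x r) (t : ℝ) :
    x t = x0 * Real.exp (∫ r in (0:ℝ)..t, a r) := by
  have hA : ∀ t, HasDerivAt (fun t => ∫ r in (0:ℝ)..t, a r) (a t) t := fun t =>
    intervalIntegral.integral_hasDerivAt_right (ha.intervalIntegrable _ _)
      (ha.stronglyMeasurableAtFilter _ _) ha.continuousAt
  have hax : Continuous (fun r => a r * x r) := ha.mul hx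
  have hX : ∀ t, HasDerivAt x (a t * x t) t := by
    intro t
    have h1 : HasDerivAt (fun t => x0 + ∫ r in (0:ℝ)..t, a r * x r) (a t * x t) t :=
      (intervalIntegral.integral_hasDerivAt_right (hax.intervalIntegrable _ _)
      (hax.stronglyMeasurableAtFilter _ _) hax.continuousAt).const_add x0
    exact h1.congr_of_eventuallyEq (Filter.Eventually.of_forall h)
  have hD : ∀ t, HasDerivAt (fun t => x t * Real.exp (-∫ r in (0:ℝ)..t, a r)) 0 t := by
    intro t
    have := (hX t).mul ((hA t).neg.exp)
    refine this.congr_deriv ?_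
    simp only [Pi.neg_apply]
    ring
  have hc := is_const_of_deriv_eq_zero (fun t => (hD t).differentiableAt)
    (fun t => (hD t).deriv) t 0
  have hx0 : x 0 = x0 := by simpa using h 0
  simp only [intervalIntegral.integral_same, neg_zero, Real.exp_zero, mul_one, hx0] at hc
  rw [← hc, mul_assoc, ← Real.exp_add]
  simp

lemma log_bd {r a b : ℝ} (hr : 0 < r) (ha : r ≤ a) (hb : 0 < b) (h : r = a ∨ a ≤ b) :
    r * (Real.log b - Real.log a) ≤ b - a := by
  have ha0 : 0 < a := lt_of_lt_of_le hr ha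
  have h1 : Real.log b - Real.log a ≤ b / a - 1 := by
    rw [← Real.log_div hb.ne' ha0.ne']
    exact Real.log_le_sub_one_of_pos (by positivity)
  have h2 : r * (Real.log b - Real.log a) ≤ r * (b / a - 1) :=
    mul_le_mul_of_nonneg_left h1 hr.le
  have h3 : b / a - 1 = (b - a) / a := by field_simp
  have h4 : a * ((b - a) / a) = b - a := by field_simp
  rw [h3] at h2
  rcases h with h | h
  · rw [h] at h2 ⊢; linarith
  · have : 0 ≤ (b - a) / a := div_nonneg (by linarith) ha0.le
    nlinarith

lemma traj_facts {γ β s₀ i₀ : ℝ} {s i : ℝ → ℝ} 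
    (h : IsTrajectory γ (fun _ => β) s₀ i₀ s i) (t : ℝ) :
    s t = s₀ * Real.exp (-(β * ∫ r in (0:ℝ)..t, i r)) ∧
    i t = i₀ * Real.exp (∫ r in (0:ℝ)..t, (β * s r - γ)) ∧
    s t + i t = s₀ + i₀ - γ * ∫ r in (0:ℝ)..t, i r := by
  obtain ⟨hs, hi, h1, h2⟩ := h
  refine ⟨?_, ?_, ?_⟩
  · have := lin_ode (fun r => -(β * i r)) s s₀ (by fun_prop) hs (fun t => by
      rw [h1 t, sub_eq_add_neg, ← intervalIntegral.integral_neg]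
      congr 2; funext r; ring) t
    rw [this, intervalIntegral.integral_neg, intervalIntegral.integral_const_mul]
  · exact lin_ode (fun r => β * s r - γ) i i₀ (by fun_prop) hi h2 t
  · rw [h1 t, h2 t, ← intervalIntegral.integral_const_mul]
    have e : ∀ A B C D E: ℝ, B = A - C → D - A + (E + B) = D + E - C := by
      intros; linarith
    apply e
    rw [← intervalIntegral.integral_sub]
    · congr 1; funext r; ring
    · exact Continuous.intervalIntegrable (by fun_prop) _ _
    · exact Continuous.intervalIntegrable (by fun_prop) _ _

lemma traj_i_nonneg {γ β s₀ i₀ : ℝ} {s i : ℝ → ℝ} (hi₀ : 0 ≤ i₀)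
    (h : IsTrajectory γ (fun _ => β) s₀ i₀ s i) (t : ℝ) : 0 ≤ i t := by
  rw [(traj_facts h t).2.1]; positivity

lemma traj_cons {γ β s₀ i₀ : ℝ} {s i : ℝ → ℝ} (hβ : 0 < β) (hs₀ : 0 < s₀)
    (h : IsTrajectory γ (fun _ => β) s₀ i₀ s i) (t : ℝ) :
    0 < s t ∧ i t + s t - γ / β * Real.log (s t) = i₀ + s₀ - γ / β * Real.log s₀ := by
  obtain ⟨h1, -, h3⟩ := traj_facts h t
  have hp : 0 < s t := by rw [h1]; positivity
  refine ⟨hp, ?_⟩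
  have h4 : Real.log (s t) = Real.log s₀ - β * ∫ r in (0:ℝ)..t, i r := by
    rw [h1, Real.log_mul hs₀.ne' (Real.exp_pos _).ne', Real.log_exp]; ring
  rw [h4]
  have h5 : γ / β * (Real.log s₀ - β * ∫ r in (0:ℝ)..t, i r)
    = γ / β * Real.log s₀ - γ * ∫ r in (0:ℝ)..t, i r := by field_simp
  rw [h5]; linarith

lemma traj_hit {γ β s₀ i₀ : ℝ} {s i : ℝ → ℝ} (hγ : 0 < γ) (hβ : 0 < β) (hs₀ : γ / β < s₀)
    (hi₀ : 0 < i₀) (h : IsTrajectory γ (fun _ => β) s₀ i₀ s i) :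
    ∃ t, 0 ≤ t ∧ s t = γ / β := by
  have hρ : 0 < γ / β := by positivity
  have hsp : 0 < s₀ := hρ.trans hs₀
  have hs0 : s 0 = s₀ := by simpa using h.2.2.1 0
  have key : ∃ T, 0 ≤ T ∧ s T ≤ γ / β := by
    by_contra! hcon
    have hig : ∀ t, 0 ≤ t → i₀ ≤ i t := by
      intro t ht
      rw [(traj_facts h t).2.1]
      have : 0 ≤ ∫ r in (0:ℝ)..t, (β * s r - γ) := by
        apply intervalIntegral.integral_nonneg ht
        intro u hu
        have := (div_lt_iff₀ hβ).1 (hcon u hu.1)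
        linarith
      have := Real.one_le_exp this
      nlinarith
    set T := (Real.log s₀ - Real.log (γ / β)) / (β * i₀) with hTdef
    have hT : 0 ≤ T := div_nonneg (by linarith [Real.log_lt_log hρ hs₀]) (by positivity)
    have h1 : i₀ * T ≤ ∫ r in (0:ℝ)..T, i r := by
      have h2 : ∫ r in (0:ℝ)..T, i₀ ≤ ∫ r in (0:ℝ)..T, i r := 
        intervalIntegral.integral_mono_on hT (by simp)
          (h.2.1.intervalIntegrable _ _) (fun x hx => hig x hx.1)
      simp at h2; linarith
    have h4 : Real.log (s T) = Real.log s₀ - β * ∫ r in (0:ℝ)..T, i r := by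
      rw [(traj_facts h T).1, Real.log_mul hsp.ne' (Real.exp_pos _).ne', Real.log_exp]; ring
    have h5 := Real.log_lt_log hρ (hcon T hT)
    have h6 : β * (i₀ * T) = Real.log s₀ - Real.log (γ / β) := by
      rw [hTdef]; field_simp
    nlinarith
  obtain ⟨T, hT, hsT⟩ := key
  obtain ⟨t, ht, e⟩ := intermediate_value_Icc' hT (h.1.continuousOn)
    (show γ / β ∈ Set.Icc (s T) (s 0) from ⟨hsT, by rw [hs0]; exact hs₀.le⟩)
  exact ⟨t, ht.1, e⟩

/-- characterization of the no-effort zone: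
for `(s₀,i₀) ∈ 𝕋`, the trajectory driven by the constant control `β` keeps
`i(t) ≤ i_M` for all `t ≥ 0` if and only if `i₀ ≤ Φ_A(s₀)`. -/
theorem stmt4 (γ βs β iM sM : ℝ) (hγ : 0 < γ) (hβs : 0 < βs) (hβ : βs < β)
    (hiM : 0 < iM) (hiM1 : iM < 1)
    (hsM : γ / β < sM)
    (hsM' : iM - sM + γ / β + (γ / β) * Real.log (β * sM / γ) = 0)
    (s₀ i₀ : ℝ) (hT : MemT s₀ i₀) :
    ((∃ s i, IsTrajectory γ (fun _ => β) s₀ i₀ s i ∧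
        ∀ t : ℝ, 0 ≤ t → i t ≤ iM) →
      i₀ ≤ Phi γ β iM sM s₀) ∧
    (i₀ ≤ Phi γ β iM sM s₀ →
      ∀ s i, IsTrajectory γ (fun _ => β) s₀ i₀ s i →
        ∀ t : ℝ, 0 ≤ t → i t ≤ iM) := by
  have hβ0 : 0 < β := hβs.trans hβ
  obtain ⟨hs0, hi0, -⟩ := hT
  have hρ : 0 < γ / β := by positivity
  have hlog : ∀ x, 0 < x → Real.log (β * x / γ) = Real.log x - Real.log (γ / β) := by
    intro x hx
    rw [← Real.log_div hx.ne' hρ.ne']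
    congr 1; field_simp
  have hsMp : 0 < sM := hρ.trans hsM
  rw [hlog sM hsMp] at hsM'
  by_cases hc : s₀ ≤ γ / β
  · have hP : Phi γ β iM sM s₀ = iM := by simp [Phi, hc]
    rw [hP]
    refine ⟨?_, ?_⟩
    · rintro ⟨s, i, h, hb⟩
      have h0 : i 0 = i₀ := by simpa using h.2.2.2 0
      rw [← h0]; exact hb 0 le_rfl
    · intro hle s i h t ht
      refine le_trans ?_ hle
      rw [(traj_facts h t).2.1]
      have : ∫ r in (0:ℝ)..t, (β * s r - γ) ≤ 0 := by
        have h0 : 0 ≤ ∫ r in (0:ℝ)..t, -(β * s r - γ) := by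
          apply intervalIntegral.integral_nonneg ht
          intro u hu
          have hI : 0 ≤ ∫ r in (0:ℝ)..u, i r :=
            intervalIntegral.integral_nonneg hu.1 (fun r _ => traj_i_nonneg hi0 h r)
          have he : Real.exp (-(β * ∫ r in (0:ℝ)..u, i r)) ≤ 1 :=
            Real.exp_le_one_iff.2 (by have := mul_nonneg hβ0.le hI; linarith)
          have hsu : s u ≤ s₀ := by
            rw [(traj_facts h u).1]; exact mul_le_of_le_one_right hs0 he
          have := (le_div_iff₀ hβ0).1 (hsu.trans hc)
          linarith
        rw [intervalIntegral.integral_neg] at h0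
        linarith
      exact mul_le_of_le_one_right hi0 (Real.exp_le_one_iff.2 this)
  push Not at hc
  have hsp : 0 < s₀ := hρ.trans hc
  have hF : i₀ ≤ Phi γ β iM sM s₀ ↔
      (i₀ = 0 ∨ i₀ ≤ iM - s₀ + γ / β + (γ / β) * (Real.log s₀ - Real.log (γ / β))) := by
    by_cases hm : s₀ < sM
    · have hP : Phi γ β iM sM s₀ =
          iM - s₀ + γ / β + (γ / β) * (Real.log s₀ - Real.log (γ / β)) := by
        simp [Phi, hc.not_ge, hm, hlog s₀ hsp]
      rw [hP]
      have := log_bd hρ hc.le hsMp (Or.inr hm.le)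
      constructor
      · exact Or.inr
      · rintro (e | e)
        · rw [e]; linarith
        · exact e
    · have hP : Phi γ β iM sM s₀ = 0 := by
        simp [Phi, hc.not_ge, hm]
      rw [hP]
      push Not at hm
      have := log_bd hρ hsM.le hsp (Or.inr hm)
      constructor
      · intro e; left; linarith
      · rintro (e | e)
        · exact e.le
        · linarith
  rw [hF]
  refine ⟨?_, ?_⟩
  · rintro ⟨s, i, h, hb⟩
    rcases hi0.eq_or_lt with e | e
    · exact Or.inl e.symm
    right
    obtain ⟨t, ht, hst⟩ := traj_hit hγ hβ0 hc e h
    have h1 := (traj_cons hβ0 hsp h t).2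
    have h2 := hb t ht
    rw [hst] at h1
    linarith
  · rintro (e | e) s i h t ht
    · rw [(traj_facts h t).2.1, e]; simpa using hiM.le
    · obtain ⟨h0, h1⟩ := traj_cons hβ0 hsp h t
      have := log_bd hρ le_rfl h0 (Or.inl rfl)
      linarith
end
end

section
/- Let (s₀, i₀) ∈ 𝕋 with i₀ ≤ Φ_A(s₀). Then for EVERY admissible control b, the trajectory satisfies i^{s₀,i₀,b}(t) ≤ i_M for all t ≥ 0. (Together with the characterization of the no-effort zone via Φ_A, this says that the all-control zone 𝒜⁰ coincides with the no-effort zone 𝒜.) -/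
open MeasureTheory Set Real
open scoped ENNReal

noncomputable section

theorem ac_exp {f : ℝ → ℝ} {a b : ℝ} (hf : AbsolutelyContinuousOnInterval f a b) :
    AbsolutelyContinuousOnInterval (fun x => Real.exp (f x)) a b := by
  obtain ⟨C, hC⟩ := hf.exists_bound
  obtain ⟨K, hK⟩ := (Real.contDiff_exp (n := 1)).contDiffOn.exists_lipschitzOnWith
    (s := Icc (-C) C) (by decide) (convex_Icc _ _) isCompact_Icc
  rw [absolutelyContinuousOnInterval_iff] at hf ⊢
  intro ε hε
  obtain ⟨δ, hδ, h⟩ := hf (ε / (K + 1)) (by positivity)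
  refine ⟨δ, hδ, fun E hE hE2 => ?_⟩
  have h1 := h E hE hE2
  have hmem : ∀ x ∈ uIcc a b, f x ∈ Icc (-C) C := fun x hx => by
    have := hC x hx
    rw [Real.norm_eq_abs, abs_le] at this
    exact this
  have h2 : ∑ j ∈ Finset.range E.1, dist (Real.exp (f (E.2 j).1)) (Real.exp (f (E.2 j).2))
      ≤ (K + 1) * ∑ j ∈ Finset.range E.1, dist (f (E.2 j).1) (f (E.2 j).2) := by
    rw [Finset.mul_sum]
    refine Finset.sum_le_sum fun j hj => ?_
    have hh := hE.1 j hj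
    have := hK.dist_le_mul _ (hmem _ hh.1) _ (hmem _ hh.2)
    have h0 := dist_nonneg (x := f (E.2 j).1) (y := f (E.2 j).2)
    nlinarith
  have hK0 : (0:ℝ) < K + 1 := by positivity
  calc _ ≤ _ := h2
    _ < (K + 1) * (ε / (K + 1)) := by gcongr
    _ = ε := by field_simp

theorem lin_sol {a x : ℝ → ℝ} {x₀ : ℝ} (hx : Continuous x)
    (ha : ∀ t, IntervalIntegrable a volume 0 t)
    (h : ∀ t : ℝ, x t = x₀ + ∫ r in (0:ℝ)..t, a r * x r) (t : ℝ) :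
    x t = x₀ * Real.exp (∫ r in (0:ℝ)..t, a r) := by
  have hax : IntervalIntegrable (fun r => a r * x r) volume 0 t :=
    (ha t).mul_continuousOn hx.continuousOn
  have acA := (ha t).absolutelyContinuousOnInterval_intervalIntegral (c := 0) (by simp)
  have acE := ac_exp acA.neg
  have acX0 := hax.absolutelyContinuousOnInterval_intervalIntegral (c := 0) (by simp)
  have acc : AbsolutelyContinuousOnInterval (fun _ : ℝ => x₀) 0 t :=
    (contDiff_const.contDiffOn (n := 1)).absolutelyContinuousOnInterval
  have acX : AbsolutelyContinuousOnInterval x 0 t := by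
    have := acc.add acX0
    have e : x = (fun _ : ℝ => x₀) + fun u => ∫ r in (0:ℝ)..u, a r * x r := by
      funext r
      exact h r
    rw [← e] at this
    exact this
  have acP := acX.fun_mul acE
  obtain ⟨C, hC⟩ := acP.const_of_ae_hasDerivAt_zero (by
    filter_upwards [(ha t).ae_hasDerivAt_integral, hax.ae_hasDerivAt_integral] with r h1 h2 hr
    have h1 := h1 hr 0 (by simp)
    have h2 := (h2 hr 0 (by simp)).const_add x₀
    have h2' : HasDerivAt x (a r * x r) r := by
      convert! h2 using 1
      funext r; exact h r
    have := h2'.mul h1.neg.exp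
    convert! this using 1
    simp only [Pi.neg_apply]
    ring)
  have e0 := hC 0 (by simp)
  have et := hC t (by simp)
  have hx0 : x 0 = x₀ := by simpa using h 0
  simp only [Pi.neg_apply, intervalIntegral.integral_same, neg_zero, Real.exp_zero, mul_one, hx0] at e0 et
  rw [← e0] at et
  rw [← et, mul_assoc, ← Real.exp_add]
  simp

/-- if `(s₀,i₀) ∈ 𝕋` with `i₀ ≤ Φ_A(s₀)`, then EVERY admissible
control keeps `i(t) ≤ i_M` for all `t ≥ 0` (the all-control zone `𝒜⁰`
coincides with the no-effort zone `𝒜`). -/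
theorem stmt5 (γ βs β iM sM : ℝ) (hγ : 0 < γ) (hβs : 0 < βs) (hβ : βs < β)
    (hiM : 0 < iM) (hiM1 : iM < 1)
    (hsM : γ / β < sM)
    (hsM' : iM - sM + γ / β + (γ / β) * Real.log (β * sM / γ) = 0)
    (s₀ i₀ : ℝ) (hT : MemT s₀ i₀) (hA : i₀ ≤ Phi γ β iM sM s₀) :
    ∀ b s i, IsAdmissible βs β b → IsTrajectory γ b s₀ i₀ s i →
      ∀ t : ℝ, 0 ≤ t → i t ≤ iM := by
  intro b s i hb htr t ht
  obtain ⟨hbm, hbr⟩ := hb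
  obtain ⟨hs, hi, hse, hie⟩ := htr
  obtain ⟨hs0, hi0, -⟩ := hT
  have hβ0 : 0 < β := hβs.trans hβ
  have hbi : ∀ u, IntervalIntegrable b volume 0 u := fun u => by
    refine (intervalIntegrable_const (c := β)).mono_fun hbm.aestronglyMeasurable ?_
    refine Filter.Eventually.of_forall fun r => ?_
    have := hbr r
    beta_reduce
    rw [Real.norm_of_nonneg (hβs.le.trans this.1), Real.norm_of_nonneg hβ0.le]
    exact this.2
  have hbI : ∀ u, IntervalIntegrable (fun r => b r * i r) volume 0 u := fun u =>
    (hbi u).mul_continuousOn hi.continuousOn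
  have hbS : ∀ u, IntervalIntegrable (fun r => b r * s r - γ) volume 0 u := fun u =>
    ((hbi u).mul_continuousOn hs.continuousOn).sub intervalIntegrable_const
  have hI : ∀ u, i u = i₀ * Real.exp (∫ r in (0:ℝ)..u, (b r * s r - γ)) :=
    lin_sol hi hbS hie
  have hS : ∀ u, s u = s₀ * Real.exp (∫ r in (0:ℝ)..u, -(b r * i r)) := by
    refine lin_sol hs (fun u => (hbI u).neg) fun u => ?_
    rw [hse u, sub_eq_add_neg, ← intervalIntegral.integral_neg]
    congr 1
    refine intervalIntegral.integral_congr fun r _ => ?_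
    beta_reduce
    ring
  have hin : ∀ u, 0 ≤ i u := fun u => by rw [hI u]; positivity
  unfold Phi at hA
  split_ifs at hA with h1 h2
  · have hint : ∫ r in (0:ℝ)..t, (b r * s r - γ) ≤ 0 := by
      rw [← neg_nonneg, ← intervalIntegral.integral_neg]
      refine intervalIntegral.integral_nonneg ht fun r hr => ?_
      have hsr : s r ≤ s₀ := by
        rw [hS r, intervalIntegral.integral_neg]
        have : 0 ≤ ∫ r in (0:ℝ)..r, b r * i r :=
          intervalIntegral.integral_nonneg hr.1 fun q _ =>
            mul_nonneg (hβs.le.trans (hbr q).1) (hin q)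
        exact mul_le_of_le_one_right hs0 (Real.exp_le_one_iff.2 (by linarith))
      have h3 : β * s₀ ≤ γ := by rw [le_div_iff₀ hβ0] at h1; linarith
      have h4 : b r * s r ≤ β * s₀ := by
        have hb0 := hβs.le.trans (hbr r).1
        exact (mul_le_mul_of_nonneg_left hsr hb0).trans
          (mul_le_mul_of_nonneg_right (hbr r).2 hs0)
      linarith
    rw [hI t]
    exact (mul_le_of_le_one_right hi0 (Real.exp_le_one_iff.2 hint)).trans hA
  · have hpos : 0 < s₀ := lt_of_lt_of_le (by positivity) (not_le.1 h1).le
    have hst : 0 < s t := by rw [hS t]; positivity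
    have hbsi : IntervalIntegrable (fun r => b r * s r * i r) volume 0 t :=
      ((hbi t).mul_continuousOn hs.continuousOn).mul_continuousOn hi.continuousOn
    have hii : IntervalIntegrable (fun r => γ * i r) volume 0 t :=
      (continuous_const.mul hi).intervalIntegrable _ _
    have hsum : i t + s t = i₀ + s₀ - γ * ∫ r in (0:ℝ)..t, i r := by
      have : ∫ r in (0:ℝ)..t, (b r * s r - γ) * i r
          = (∫ r in (0:ℝ)..t, b r * s r * i r) - ∫ r in (0:ℝ)..t, γ * i r := by
        rw [← intervalIntegral.integral_sub hbsi hii]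
        refine intervalIntegral.integral_congr fun r _ => ?_
        beta_reduce
        ring
      rw [hie t, hse t, this, intervalIntegral.integral_const_mul]
      ring
    have hlog : Real.log (β * s t / γ) = Real.log (β * s₀ / γ) - ∫ r in (0:ℝ)..t, b r * i r := by
      have : β * s t / γ = (β * s₀ / γ) * Real.exp (∫ r in (0:ℝ)..t, -(b r * i r)) := by
        rw [hS t]; ring
      rw [this, Real.log_mul (by positivity) (by positivity), Real.log_exp,
        intervalIntegral.integral_neg]
      ring
    have hcmp : ∫ r in (0:ℝ)..t, b r * i r ≤ β * ∫ r in (0:ℝ)..t, i r := by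
      rw [← intervalIntegral.integral_const_mul]
      exact intervalIntegral.integral_mono_on ht (hbI t)
        ((continuous_const.mul hi).intervalIntegrable _ _)
        fun r _ => mul_le_mul_of_nonneg_right (hbr r).2 (hin r)
    have hcmp2 : (γ / β) * ∫ r in (0:ℝ)..t, b r * i r ≤ γ * ∫ r in (0:ℝ)..t, i r := by
      calc _ ≤ (γ / β) * (β * ∫ r in (0:ℝ)..t, i r) := by gcongr
        _ = _ := by field_simp
    have hl := Real.log_le_sub_one_of_pos (x := β * s t / γ) (by positivity)
    have hl2 : (γ / β) * Real.log (β * s t / γ) ≤ s t - γ / β := by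
      calc _ ≤ (γ / β) * (β * s t / γ - 1) := by gcongr
        _ = _ := by field_simp
    rw [hlog, mul_sub] at hl2
    linarith
  · have : i₀ = 0 := le_antisymm hA hi0
    rw [hI t, this, zero_mul]
    exact hiM.le
end
end

section
/- Assume s_M^* ≤ 1. Let (s₀, i₀) ∈ 𝕋 with s₀ > 0, i₀ > 0 and i₀ = Φ_B(s₀) (a boundary point of the viable zone), and let τ₀ := inf{t ≥ 0 : s^{s₀,i₀,β_*}(t) ≤ γ/β_*} (with inf ∅ = +∞). Then every admissible control b whose trajectory satisfies i^{s₀,i₀,b}(t) ≤ i_M for all t ≥ 0 must satisfy b(t) = β_* for almost every t ∈ [0, τ₀). -/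
open MeasureTheory Set Real
open scoped ENNReal

noncomputable section

theorem aux_int (b : ℝ → ℝ) (βs β : ℝ) (hb : IsAdmissible βs β b) (f : ℝ → ℝ)
    (hf : Continuous f) (x y : ℝ) : IntervalIntegrable (fun r => b r * f r) volume x y := by
  have h1 : IntervalIntegrable b volume x y := by
    rw [intervalIntegrable_iff]
    refine Measure.integrableOn_of_bounded (M := max |βs| |β|) (by simp)
      hb.1.aestronglyMeasurable ?_
    refine Filter.Eventually.of_forall fun t => ?_
    rw [Real.norm_eq_abs]
    exact abs_le_max_abs_abs (hb.2 t).1 (hb.2 t).2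
  exact h1.mul_continuousOn hf.continuousOn

theorem aux_log (b s i : ℝ → ℝ) (βs β s₀ g T : ℝ) (hb : IsAdmissible βs β b)
    (hs : Continuous s) (hi : Continuous i)
    (hst : ∀ t : ℝ, s t = s₀ - ∫ r in (0:ℝ)..t, b r * s r * i r)
    (hg : 0 < g) (hT : 0 ≤ T) (hsg : ∀ t ∈ Icc 0 T, g ≤ s t) :
    Real.log (s T) - Real.log (s 0) = - ∫ r in (0:ℝ)..T, b r * i r := by
  have hfi : ∀ x y, IntervalIntegrable (fun r => b r * s r * i r) volume x y := by
    intro x y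
    have := aux_int b βs β hb (fun r => s r * i r) (by fun_prop) x y
    simpa only [mul_assoc] using this
  obtain ⟨M, hM⟩ := isCompact_Icc.exists_bound_of_continuousOn (s := Icc 0 T)
    (f := fun r => s r * i r) (by fun_prop)
  have hM0 : 0 ≤ M := (norm_nonneg _).trans (hM 0 ⟨le_rfl, hT⟩)
  set C := max |βs| |β| * M with hC
  have hC0 : 0 ≤ C := by positivity
  have hLs : LipschitzOnWith (Real.toNNReal C) s (Icc 0 T) := by
    refine LipschitzOnWith.of_dist_le_mul fun x hx y hy => ?_
    have e : s x - s y = ∫ r in x..y, b r * s r * i r := by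
      rw [hst x, hst y, ← intervalIntegral.integral_interval_sub_left (hfi 0 y) (hfi 0 x)]
      ring
    rw [Real.dist_eq, e, Real.dist_eq, abs_sub_comm x y, Real.coe_toNNReal _ hC0]
    rw [← Real.norm_eq_abs]
    refine intervalIntegral.norm_integral_le_of_norm_le_const (E := ℝ) fun r hr => ?_
    have hr' : r ∈ Icc 0 T := by
      have := uIoc_subset_uIcc hr
      exact (uIcc_subset_Icc hx hy) this
    rw [mul_assoc, norm_mul]
    refine mul_le_mul ?_ (hM r hr') (norm_nonneg _) (by positivity)
    exact abs_le_max_abs_abs (hb.2 r).1 (hb.2 r).2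
  obtain ⟨N, hN⟩ := isCompact_Icc.exists_bound_of_continuousOn (s := Icc 0 T)
    (f := s) (by fun_prop)
  have hlog : ContDiffOn ℝ 1 Real.log (Icc g N) := by
    intro x hx
    have hx0 : x ≠ 0 := (hg.trans_le hx.1).ne'
    have h : ContDiffAt ℝ 1 Real.log x := Real.contDiffAt_log.2 hx0
    exact h.contDiffWithinAt
  obtain ⟨K, hK⟩ := hlog.exists_lipschitzOnWith (by decide) (convex_Icc _ _) isCompact_Icc
  have hcomp : LipschitzOnWith (K * Real.toNNReal C) (Real.log ∘ s) (Icc 0 T) :=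
    hK.comp hLs (fun t ht => ⟨hsg t ht, (le_abs_self _).trans (hN t ht)⟩)
  have hac : AbsolutelyContinuousOnInterval (Real.log ∘ s) 0 T :=
    LipschitzOnWith.absolutelyContinuousOnInterval (by rw [uIcc_of_le hT]; exact hcomp)
  have hD := hac.integral_deriv_eq_sub
  simp only [Function.comp] at hD
  rw [← hD, ← intervalIntegral.integral_neg]
  apply intervalIntegral.integral_congr_ae
  filter_upwards [(hfi 0 T).ae_hasDerivAt_integral] with x hx hx'
  have hx1 : x ∈ uIcc 0 T := uIoc_subset_uIcc hx'
  have hd := hx hx1 0 (by simp)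
  have hd2 : HasDerivAt s (-(b x * s x * i x)) x := by
    have := hd.const_sub s₀
    refine this.congr_of_eventuallyEq (Filter.Eventually.of_forall fun t => hst t)
  have hsx : 0 < s x := hg.trans_le (hsg x (by rwa [uIcc_of_le hT] at hx1))
  have := (hd2.log hsx.ne').deriv
  change deriv (fun t => Real.log (s t)) x = _
  rw [this]
  field_simp

theorem aux_unique (γ βs s₀ i₀ T : ℝ) (s i ss ii : ℝ → ℝ) (hT : 0 ≤ T)
    (hs : Continuous s) (hi : Continuous i) (hss : Continuous ss) (hii : Continuous ii)
    (h1 : ∀ t ∈ Icc 0 T, s t = s₀ - ∫ r in (0:ℝ)..t, βs * s r * i r)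
    (h2 : ∀ t ∈ Icc 0 T, i t = i₀ + ∫ r in (0:ℝ)..t, (βs * s r - γ) * i r)
    (h3 : ∀ t ∈ Icc 0 T, ss t = s₀ - ∫ r in (0:ℝ)..t, βs * ss r * ii r)
    (h4 : ∀ t ∈ Icc 0 T, ii t = i₀ + ∫ r in (0:ℝ)..t, (βs * ss r - γ) * ii r) :
    ss T = s T := by
  let v : ℝ × ℝ → ℝ × ℝ := fun p => (-(βs * p.1 * p.2), (βs * p.1 - γ) * p.2)
  have hv : ContDiff ℝ 1 v := by fun_prop
  have key : ∀ s i : ℝ → ℝ, Continuous s → Continuous i →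
      (∀ t ∈ Icc 0 T, s t = s₀ - ∫ r in (0:ℝ)..t, βs * s r * i r) →
      (∀ t ∈ Icc 0 T, i t = i₀ + ∫ r in (0:ℝ)..t, (βs * s r - γ) * i r) →
      ∀ t ∈ Ico 0 T, HasDerivWithinAt (fun t => (s t, i t)) (v (s t, i t)) (Ici t) t := by
    intro s i hs hi h1 h2 t ht
    have c1 : Continuous (fun r => βs * s r * i r) := by fun_prop
    have c2 : Continuous (fun r => (βs * s r - γ) * i r) := by fun_prop
    have d1 := (c1.integral_hasStrictDerivAt 0 t).hasDerivAt.const_sub s₀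
    have d2 := (c2.integral_hasStrictDerivAt 0 t).hasDerivAt.const_add i₀
    have ev : ∀ᶠ u in nhdsWithin t (Ici t), u ∈ Icc 0 T := by
      have : Icc t T ∈ nhdsWithin t (Ici t) := Icc_mem_nhdsGE ht.2
      filter_upwards [this] with u hu
      exact ⟨ht.1.trans hu.1, hu.2⟩
    have ht' : t ∈ Icc 0 T := ⟨ht.1, ht.2.le⟩
    refine HasDerivWithinAt.prodMk ?_ ?_
    · exact d1.hasDerivWithinAt.congr_of_eventuallyEq (ev.mono fun u hu => h1 u hu) (h1 t ht')
    · exact d2.hasDerivWithinAt.congr_of_eventuallyEq (ev.mono fun u hu => h2 u hu) (h2 t ht')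
  obtain ⟨M1, hM1⟩ := isCompact_Icc.exists_bound_of_continuousOn (s := Icc 0 T)
    (f := fun t => (s t, i t)) (by fun_prop)
  obtain ⟨M2, hM2⟩ := isCompact_Icc.exists_bound_of_continuousOn (s := Icc 0 T)
    (f := fun t => (ss t, ii t)) (by fun_prop)
  obtain ⟨K, hK⟩ := (hv.contDiffOn (s := Metric.closedBall 0 (max M1 M2))).exists_lipschitzOnWith
    (by decide) (convex_closedBall _ _) (isCompact_closedBall _ _)
  have h0 : (0:ℝ) ∈ Icc 0 T := ⟨le_rfl, hT⟩
  have := ODE_solution_unique_of_mem_Icc_right (v := fun _ => v)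
    (s := fun _ => Metric.closedBall 0 (max M1 M2)) (K := K) (a := 0) (b := T)
    (f := fun t => (ss t, ii t)) (g := fun t => (s t, i t))
    (fun _ _ => hK) (by fun_prop) (key ss ii hss hii h3 h4)
    (fun t ht => by
      rw [mem_closedBall_zero_iff]; exact (hM2 t ⟨ht.1, ht.2.le⟩).trans (le_max_right _ _))
    (by fun_prop) (key s i hs hi h1 h2)
    (fun t ht => by
      rw [mem_closedBall_zero_iff]; exact (hM1 t ⟨ht.1, ht.2.le⟩).trans (le_max_left _ _))
    (by simp [h1 0 h0, h2 0 h0, h3 0 h0, h4 0 h0])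
  exact congrArg Prod.fst (this ⟨hT, le_rfl⟩)

/-- first time a continuous function reaches level `g` from above -/
theorem aux_first (s : ℝ → ℝ) (hs : Continuous s) (g t : ℝ) (h0 : g < s 0) (ht : 0 ≤ t)
    (hst : s t ≤ g) : ∃ T, 0 ≤ T ∧ T ≤ t ∧ s T = g ∧ ∀ r ∈ Icc 0 T, g ≤ s r := by
  have hcl : IsClosed {r | 0 ≤ r ∧ s r ≤ g} :=
    (isClosed_le continuous_const continuous_id).inter (isClosed_le hs continuous_const)
  have hbb : BddBelow {r | 0 ≤ r ∧ s r ≤ g} := ⟨0, fun r hr => hr.1⟩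
  have hmem := hcl.csInf_mem ⟨t, ht, hst⟩ hbb
  set T := sInf {r | 0 ≤ r ∧ s r ≤ g} with hTdef
  have hlt : ∀ r, 0 ≤ r → r < T → g < s r := by
    intro r hr hrT
    by_contra hc
    exact absurd (csInf_le hbb ⟨hr, not_lt.1 hc⟩) (not_le.2 hrT)
  have hTpos : 0 < T := by
    rcases hmem.1.eq_or_lt with h | h
    · rw [← h] at hmem; exact absurd hmem.2 (not_le.2 h0)
    · exact h
  have hge : g ≤ s T := by
    have hclT : T ∈ closure (Ioo 0 T) := by
      rw [closure_Ioo hTpos.ne]; exact ⟨hTpos.le, le_rfl⟩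
    have hsub : closure (Ioo 0 T) ⊆ {r | g ≤ s r} :=
      closure_minimal (fun r hr => (hlt r hr.1.le hr.2).le) (isClosed_le continuous_const hs)
    exact hsub hclT
  refine ⟨T, hmem.1, csInf_le hbb ⟨ht, hst⟩, le_antisymm hmem.2 hge, ?_⟩
  intro r hr
  rcases hr.2.eq_or_lt with h | h
  · rw [h]; exact hge
  · exact (hlt r hr.1 h).le

/-- as long as `s ≥ γ/βs`, the infected compartment stays above its initial value -/
theorem aux_i (γ βs β s₀ i₀ T : ℝ) (b s i : ℝ → ℝ) (hβs : 0 < βs) (hγ : 0 < γ)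
    (hb : IsAdmissible βs β b) (hi : Continuous i) (hi₀ : 0 < i₀)
    (h2 : ∀ t : ℝ, i t = i₀ + ∫ r in (0:ℝ)..t, (b r * s r - γ) * i r)
    (hsg : ∀ t ∈ Icc 0 T, γ / βs ≤ s t) : ∀ t ∈ Icc 0 T, i₀ ≤ i t := by
  have i0 : i 0 = i₀ := by simp [h2 0]
  have step : ∀ t ∈ Icc 0 T, (∀ r ∈ Icc 0 t, 0 ≤ i r) → i₀ ≤ i t := by
    intro t ht hr
    rw [h2 t]
    have : 0 ≤ ∫ r in (0:ℝ)..t, (b r * s r - γ) * i r := by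
      refine intervalIntegral.integral_nonneg ht.1 fun r hr' => mul_nonneg ?_ (hr r hr')
      have h1 := hsg r ⟨hr'.1, hr'.2.trans ht.2⟩
      have h3 := (hb.2 r).1
      rw [div_le_iff₀ hβs] at h1
      have : 0 < s r := by
        by_contra hc
        nlinarith
      nlinarith
    linarith
  have nn : ∀ t ∈ Icc 0 T, 0 ≤ i t := by
    intro t ht
    by_contra hc
    obtain ⟨T', hT', hle, hz, hall⟩ := aux_first i hi 0 t (by rw [i0]; exact hi₀) ht.1
      (not_le.1 hc).le
    have := step T' ⟨hT', hle.trans ht.2⟩ hall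
    linarith
  intro t ht
  exact step t ht fun r hr => nn r ⟨hr.1, hr.2.trans ht.2⟩

/-- assume `s_M^* ≤ 1`. Starting from a boundary point of the
viable zone (`i₀ = Φ_B(s₀)`, `s₀ > 0`, `i₀ > 0`), every viable admissible
control must equal `β_*` almost everywhere on `[0, τ₀)`, where
`τ₀ = inf {t ≥ 0 : s^{s₀,i₀,β_*}(t) ≤ γ/β_*}` (with `inf ∅ = +∞`, computed
in `ℝ≥0∞`). -/
theorem stmt6 (γ βs β iM sMs : ℝ) (hγ : 0 < γ) (hβs : 0 < βs) (hβ : βs < β)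
    (hiM : 0 < iM) (hiM1 : iM < 1)
    (hsMs : γ / βs < sMs)
    (hsMs' : iM - sMs + γ / βs + (γ / βs) * Real.log (βs * sMs / γ) = 0)
    (hsMs1 : sMs ≤ 1)
    (s₀ i₀ : ℝ) (hT : MemT s₀ i₀) (hs₀ : 0 < s₀) (hi₀ : 0 < i₀)
    (hbd : i₀ = Phi γ βs iM sMs s₀)
    (ss ii : ℝ → ℝ) (htrajs : IsTrajectory γ (fun _ => βs) s₀ i₀ ss ii)
    (τ₀ : ℝ≥0∞)
    (hτ₀ : τ₀ = sInf {x : ℝ≥0∞ |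
      ∃ t : ℝ, 0 ≤ t ∧ x = ENNReal.ofReal t ∧ ss t ≤ γ / βs}) :
    ∀ b s i, IsAdmissible βs β b → IsTrajectory γ b s₀ i₀ s i →
      (∀ t : ℝ, 0 ≤ t → i t ≤ iM) →
      ∀ᵐ t : ℝ, (0 ≤ t ∧ ENNReal.ofReal t < τ₀) → b t = βs := by
  intro b s i hb htr hle
  obtain ⟨hs, hi, h1, h2⟩ := htr
  obtain ⟨hss, hii, h3, h4⟩ := htrajs
  set g := γ / βs with hgdef
  have hg : 0 < g := div_pos hγ hβs
  have hgb : g * βs = γ := div_mul_cancel₀ _ hβs.ne'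
  have s0 : s 0 = s₀ := by simp [h1 0]
  have i0 : i 0 = i₀ := by simp [h2 0]
  have hub : ∀ T : ℝ, 0 ≤ T → ss T ≤ g → τ₀ ≤ ENNReal.ofReal T := by
    intro T hT hs
    rw [hτ₀]
    exact sInf_le ⟨T, hT, rfl, hs⟩
  by_cases hc1 : s₀ ≤ g
  · have : τ₀ ≤ ENNReal.ofReal 0 := hub 0 le_rfl (by simp [h3 0, hc1])
    refine Filter.Eventually.of_forall fun t ht => ?_
    simp at this
    simp [this] at ht
  rw [Phi, if_neg hc1] at hbd
  by_cases hc2 : s₀ < sMs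
  swap
  · rw [if_neg hc2] at hbd; exact absurd hbd hi₀.ne'
  rw [if_pos hc2] at hbd
  push Not at hc1
  -- existence of a hitting time
  have hex : ∃ t, 0 ≤ t ∧ s t ≤ g := by
    by_contra hcon
    push Not at hcon
    have hge : ∀ t, 0 ≤ t → i₀ ≤ i t := fun t ht =>
      aux_i γ βs β s₀ i₀ t b s i hβs hγ hb hi hi₀ h2 (fun r hr => (hcon r hr.1).le) t ⟨ht, le_rfl⟩
    have hdec : ∀ t, 0 ≤ t → s t ≤ s₀ - (βs * g * i₀) * t := by
      intro t ht
      rw [h1 t]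
      have : ∫ r in (0:ℝ)..t, (βs * g * i₀) ≤ ∫ r in (0:ℝ)..t, b r * s r * i r := by
        refine intervalIntegral.integral_mono_on ht (by simp) ?_ ?_
        · have := aux_int b βs β hb (fun r => s r * i r) (by fun_prop) 0 t
          simpa only [mul_assoc] using this
        · intro r hr
          have a1 := (hb.2 r).1
          have a2 := hcon r hr.1
          have a3 := hge r hr.1
          have : βs * g ≤ b r * s r := mul_le_mul a1 a2.le hg.le (hβs.le.trans a1)
          exact mul_le_mul this a3 hi₀.le ((mul_pos hβs hg).le.trans this)
      rw [intervalIntegral.integral_const] at this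
      simp only [sub_zero, smul_eq_mul] at this
      linarith
    have hk : 0 < βs * g * i₀ := by positivity
    have ht0 : 0 ≤ s₀ / (βs * g * i₀) := by positivity
    have a1 := hdec _ ht0
    rw [mul_div_cancel₀ _ hk.ne'] at a1
    have a2 := hcon _ ht0
    linarith
  obtain ⟨t, ht, hst⟩ := hex
  obtain ⟨T, hT, -, hsT, hsg⟩ := aux_first s hs g t (by rw [s0]; exact hc1) ht hst
  have hige := aux_i γ βs β s₀ i₀ T b s i hβs hγ hb hi hi₀ h2 hsg
  have hL := aux_log b s i βs β s₀ g T hb hs hi h1 hg hT hsg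
  rw [hsT, s0] at hL
  have hbi := aux_int b βs β hb i hi
  have hbsi : ∀ x y, IntervalIntegrable (fun r => b r * s r * i r) volume x y := by
    intro x y
    have := aux_int b βs β hb (fun r => s r * i r) (by fun_prop) x y
    simpa only [mul_assoc] using this
  have hii' : ∀ x y, IntervalIntegrable i volume x y := fun x y => hi.intervalIntegrable x y
  have hI2 : ∀ t, ∫ r in (0:ℝ)..t, (b r * s r - γ) * i r
      = (∫ r in (0:ℝ)..t, b r * s r * i r) - γ * ∫ r in (0:ℝ)..t, i r := by
    intro t
    rw [← intervalIntegral.integral_const_mul, ← intervalIntegral.integral_sub (hbsi 0 t)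
      ((hii' 0 t).const_mul γ)]
    congr 1; ext r; ring
  have hI3 : ∫ r in (0:ℝ)..T, (b r - βs) * i r
      = (∫ r in (0:ℝ)..T, b r * i r) - βs * ∫ r in (0:ℝ)..T, i r := by
    rw [← intervalIntegral.integral_const_mul, ← intervalIntegral.integral_sub (hbi 0 T)
      ((hii' 0 T).const_mul βs)]
    congr 1; ext r; ring
  have hint3 : IntervalIntegrable (fun r => (b r - βs) * i r) volume 0 T := by
    have := (hbi 0 T).sub ((hii' 0 T).const_mul βs)
    simpa only [sub_mul] using this
  have hlogs : Real.log (βs * s₀ / γ) = Real.log s₀ - Real.log g := by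
    rw [← Real.log_div hs₀.ne' hg.ne', hgdef]
    congr 1; field_simp
  have hnn : ∀ r ∈ Icc 0 T, 0 ≤ (b r - βs) * i r := fun r hr =>
    mul_nonneg (sub_nonneg.2 (hb.2 r).1) (hi₀.le.trans (hige r hr))
  have hzero : ∫ r in (0:ℝ)..T, (b r - βs) * i r = 0 := by
    refine le_antisymm ?_ (intervalIntegral.integral_nonneg hT hnn)
    have e1 := h1 T
    have e2 := h2 T
    rw [hI2 T] at e2
    rw [hsT] at e1
    have e3 := hle T hT
    rw [hlogs] at hbd
    rw [hI3]
    set A := ∫ r in (0:ℝ)..T, b r * i r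
    set B := ∫ r in (0:ℝ)..T, i r
    have hA : A = Real.log s₀ - Real.log g := by linarith
    have : g * (A - βs * B) ≤ 0 := by
      have : g * (A - βs * B) = g * A - γ * B := by rw [← hgb]; ring
      rw [this, hA]
      linarith
    by_contra hcc
    push Not at hcc
    nlinarith [mul_pos hg hcc]
  have hae : ∀ᵐ r : ℝ, r ∈ Ioc 0 T → b r = βs := by
    rw [intervalIntegral.integral_of_le hT, integral_eq_zero_iff_of_nonneg_ae ?_ hint3.1] at hzero
    · have := (ae_restrict_iff' measurableSet_Ioc).1 hzero
      filter_upwards [this] with r hr hr'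
      have h5 := hr hr'
      have h6 := hige r ⟨hr'.1.le, hr'.2⟩
      simp only [Pi.zero_apply, mul_eq_zero] at h5
      rcases h5 with h5 | h5 <;> linarith
    · refine (ae_restrict_iff' measurableSet_Ioc).2 (Filter.Eventually.of_forall fun r hr => ?_)
      exact hnn r ⟨hr.1.le, hr.2⟩
  have hssT : ss T = s T := by
    refine aux_unique γ βs s₀ i₀ T s i ss ii hT hs hi hss hii ?_ ?_
      (fun t _ => h3 t) (fun t _ => h4 t)
    · intro t ht
      rw [h1 t]
      congr 1
      apply intervalIntegral.integral_congr_ae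
      filter_upwards [hae] with r hr hr'
      rw [uIoc_of_le ht.1] at hr'
      rw [hr ⟨hr'.1, hr'.2.trans ht.2⟩]
    · intro t ht
      rw [h2 t]
      congr 1
      apply intervalIntegral.integral_congr_ae
      filter_upwards [hae] with r hr hr'
      rw [uIoc_of_le ht.1] at hr'
      rw [hr ⟨hr'.1, hr'.2.trans ht.2⟩]
  have hτ := hub T hT (by rw [hssT, hsT])
  have hne : ∀ᵐ r : ℝ, r ≠ 0 := by
    simp [ae_iff]
  filter_upwards [hae, hne] with r hr hr0 hrt
  refine hr ⟨lt_of_le_of_ne hrt.1 (Ne.symm hr0), ?_⟩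
  have := hrt.2.trans_le hτ
  exact ((ENNReal.ofReal_lt_ofReal_iff_of_nonneg hrt.1).1 this).le
end
end

section
/- Fix t_f > 0, ε > 0, weights λ₁ ≥ 0, λ₂ ≥ 0, and an initial datum (s₀, i₀) ∈ 𝕋 with i₀ > 0. If the set of controls admissible for problem 𝒫_ε from (s₀,i₀) on [0,t_f] is nonempty, then there exists an admissible control b* attaining the minimum: J(t_f, b*) ≤ J(t_f, b) for every control b admissible for 𝒫_ε from (s₀,i₀) on [0,t_f]. -/
open MeasureTheory Set Real
open scoped ENNReal

noncomputable section

/-- A control is admissible for problem `𝒫_ε` from `(s₀,i₀)` on `[0,tf]`: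
it is an admissible control whose trajectory stays in the viable zone
(`i(t) ≤ Φ_B(s(t))` on `[0,tf]`) and satisfies `s(tf) ≤ γ/β − ε`. -/
def AdmissibleEps (γ βs β iM sMs tf ε s₀ i₀ : ℝ) (b : ℝ → ℝ) : Prop :=
  IsAdmissible βs β b ∧
    ∃ s i, IsTrajectory γ b s₀ i₀ s i ∧
      (∀ t ∈ Set.Icc (0:ℝ) tf, i t ≤ Phi γ βs iM sMs (s t)) ∧
      s tf ≤ γ / β - ε

lemma intg_of_bd {f g : ℝ → ℝ} (hf : Measurable f) (hg : Continuous g) (h : ∀ r, |f r| ≤ g r)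
    (x y : ℝ) : IntervalIntegrable f volume x y := by
  refine (hg.intervalIntegrable x y).mono_fun hf.aestronglyMeasurable ?_
  refine Filter.Eventually.of_forall fun r => ?_
  simp only [Real.norm_eq_abs]
  exact (h r).trans (le_abs_self _)

lemma lin_nonneg {a u g : ℝ → ℝ} {u0 : ℝ} (ha : Measurable a) (hg : Continuous g)
    (hag : ∀ r, |a r| ≤ g r) (hu : Continuous u) (h : ∀ t, u t = u0 + ∫ r in (0:ℝ)..t, a r * u r)
    (h0 : 0 ≤ u0) : ∀ t, 0 ≤ u t := by
  have hint : ∀ x y, IntervalIntegrable (fun r => a r * u r) volume x y := by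
    refine intg_of_bd (g := fun r => g r * |u r|) (ha.mul hu.measurable) (hg.mul hu.abs) ?_
    intro r
    rw [abs_mul]
    exact mul_le_mul_of_nonneg_right (hag r) (abs_nonneg _)
  have hdiff : ∀ x y, u y = u x + ∫ r in x..y, a r * u r := by
    intro x y
    rw [h x, h y, add_assoc, intervalIntegral.integral_add_adjacent_intervals (hint _ _) (hint _ _)]
  have hu00 : u 0 = u0 := by rw [h 0]; simp
  have hclopen : IsClopen {t | u t = 0} := by
    refine ⟨isClosed_eq hu continuous_const, ?_⟩
    rw [Metric.isOpen_iff]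
    intro t1 ht1
    have ht1 : u t1 = 0 := ht1
    obtain ⟨C, hC⟩ := (isCompact_Icc (a := t1 - 1) (b := t1 + 1)).exists_bound_of_continuousOn
      hg.continuousOn
    have hC0 : 0 ≤ C := (norm_nonneg _).trans (hC t1 ⟨by linarith, by linarith⟩)
    set δ : ℝ := 1 / (2 * (C + 1)) with hδ
    have hδ0 : 0 < δ := by positivity
    have hδ1 : δ ≤ 1 := by
      rw [hδ, div_le_one (by positivity)]; linarith
    have hCδ : C * δ ≤ 1 / 2 := by
      rw [hδ, mul_one_div, div_le_div_iff₀ (by positivity) (by norm_num)]; linarith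
    obtain ⟨x, hx, hmax⟩ := (isCompact_Icc (a := t1 - δ) (b := t1 + δ)).exists_isMaxOn
      ⟨t1, by linarith, by linarith⟩ hu.abs.continuousOn
    have hb : |u x| ≤ (C * |u x|) * |x - t1| := by
      have := hdiff t1 x
      rw [ht1, zero_add] at this
      nth_rewrite 1 [this]
      rw [← Real.norm_eq_abs (∫ r in t1..x, a r * u r)]
      refine intervalIntegral.norm_integral_le_of_norm_le_const ?_
      intro r hr
      have hr' : r ∈ Icc (t1 - δ) (t1 + δ) := by
        have h1 : uIcc t1 x ⊆ Icc (t1 - δ) (t1 + δ) :=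
          uIcc_subset_Icc ⟨by linarith, by linarith⟩ hx
        exact h1 (uIoc_subset_uIcc hr)
      rw [norm_mul]
      have h2 : ‖a r‖ ≤ C := by
        refine (hag r).trans ((le_abs_self _).trans (hC r ⟨by linarith [hr'.1], by linarith [hr'.2]⟩))
      exact mul_le_mul h2 (hmax hr') (norm_nonneg _) hC0
    have hxd : |x - t1| ≤ δ := abs_le.2 ⟨by linarith [hx.1], by linarith [hx.2]⟩
    have hux : |u x| = 0 := by
      have h3 : (C * |u x|) * |x - t1| ≤ (C * |u x|) * δ :=
        mul_le_mul_of_nonneg_left hxd (by positivity)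
      nlinarith [abs_nonneg (u x)]
    refine ⟨δ, hδ0, ?_⟩
    intro y hy
    rw [Metric.mem_ball, Real.dist_eq, abs_lt] at hy
    have : |u y| ≤ |u x| := hmax (show y ∈ Icc (t1 - δ) (t1 + δ) from ⟨by linarith, by linarith⟩)
    rw [hux] at this
    exact abs_nonpos_iff.1 this
  rcases isClopen_iff.1 hclopen with he | he
  · intro t
    by_contra! hneg
    have : (0:ℝ) ∈ uIcc (u t) (u 0) := by
      rw [mem_uIcc]; left; exact ⟨hneg.le, by rw [hu00]; exact h0⟩
    obtain ⟨z, -, hz⟩ := intermediate_value_uIcc (f := u) hu.continuousOn this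
    have : z ∈ {t | u t = 0} := hz
    rw [he] at this
    exact this
  · intro t
    have : t ∈ {t | u t = 0} := by rw [he]; trivial
    exact (show u t = 0 from this).ge

lemma traj_bounds {γ βs β s₀ i₀ : ℝ} {b s i : ℝ → ℝ} (hγ : 0 < γ) (hβs : 0 < βs)
    (hb : IsAdmissible βs β b)
    (ht : IsTrajectory γ b s₀ i₀ s i) (hT : MemT s₀ i₀) :
    ∀ T t, |t| ≤ T → (0 ≤ s t ∧ s t ≤ exp (γ * T)) ∧ (0 ≤ i t ∧ i t ≤ exp (γ * T)) := by
  obtain ⟨hbm, hbb⟩ := hb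
  obtain ⟨hs, hi, hse, hie⟩ := ht
  obtain ⟨h1, h2, h3⟩ := hT
  have hbabs : ∀ r, |b r| ≤ β := fun r => by
    rw [abs_of_nonneg (hβs.le.trans (hbb r).1)]; exact (hbb r).2
  have hs0 : ∀ t, 0 ≤ s t := by
    refine lin_nonneg (a := fun r => -(b r * i r)) (g := fun r => β * |i r|) (u0 := s₀)
      (hbm.mul hi.measurable).neg (by fun_prop) ?_ hs ?_ h1
    · intro r
      rw [abs_neg, abs_mul]
      exact mul_le_mul_of_nonneg_right (hbabs r) (abs_nonneg _)
    · intro t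
      rw [hse t, sub_eq_add_neg, ← intervalIntegral.integral_neg]
      congr 1
      refine intervalIntegral.integral_congr fun r _ => ?_
      ring
  have hi0 : ∀ t, 0 ≤ i t := by
    refine lin_nonneg (a := fun r => b r * s r - γ) (g := fun r => β * |s r| + γ) (u0 := i₀)
      ((hbm.mul hs.measurable).sub_const _) (by fun_prop) ?_ hi hie h2
    intro r
    refine (abs_sub _ _).trans ?_
    rw [abs_mul, abs_of_pos hγ]
    gcongr
    exact hbabs r
  have hint1 : ∀ x y, IntervalIntegrable (fun r => b r * s r * i r) volume x y := by
    refine intg_of_bd (g := fun r => β * |s r| * |i r|)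
      ((hbm.mul hs.measurable).mul hi.measurable) (by fun_prop) ?_
    intro r
    rw [abs_mul, abs_mul]
    gcongr
    exact hbabs r
  have hv : ∀ t, s t + i t = (s₀ + i₀) - γ * ∫ r in (0:ℝ)..t, i r := by
    intro t
    rw [hse t, hie t]
    have : ∫ r in (0:ℝ)..t, (b r * s r - γ) * i r =
        (∫ r in (0:ℝ)..t, b r * s r * i r) - γ * ∫ r in (0:ℝ)..t, i r := by
      rw [← intervalIntegral.integral_const_mul, ← intervalIntegral.integral_sub (hint1 _ _)
        ((hi.const_mul γ).intervalIntegrable _ _)]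
      refine intervalIntegral.integral_congr fun r _ => ?_
      ring
    rw [this]; ring
  have hd : ∀ t, HasDerivAt (fun t => s t + i t) (-(γ * i t)) t := by
    intro t
    have h4 : HasDerivAt (fun t => ∫ r in (0:ℝ)..t, i r) (i t) t :=
      intervalIntegral.integral_hasDerivAt_right (hi.intervalIntegrable _ _)
        hi.stronglyMeasurable.stronglyMeasurableAtFilter hi.continuousAt
    have h5 := (h4.const_mul γ).const_sub (s₀ + i₀)
    rwa [show (fun t => s t + i t) = fun t => (s₀ + i₀) - γ * ∫ r in (0:ℝ)..t, i r from funext hv]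
  have hanti : Antitone (fun t => s t + i t) :=
    antitone_of_hasDerivAt_nonpos hd fun t => neg_nonpos.2 (mul_nonneg hγ.le (hi0 t))
  have hmono : Monotone (fun t => (s t + i t) * exp (γ * t)) := by
    have hd2 : ∀ t, HasDerivAt (fun t => (s t + i t) * exp (γ * t))
        (γ * s t * exp (γ * t)) t := by
      intro t
      have h6 : HasDerivAt (fun t => exp (γ * t)) (exp (γ * t) * (γ * 1)) t :=
        ((hasDerivAt_id' t).const_mul γ).exp
      convert! (hd t).mul h6 using 1
      ring
    refine monotone_of_hasDerivAt_nonneg hd2 fun t => ?_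
    have := hs0 t
    simp only [Pi.zero_apply]
    positivity
  have h00 : s 0 + i 0 ≤ 1 := by rw [hv 0]; simpa using h3
  have key : ∀ T t, |t| ≤ T → s t + i t ≤ exp (γ * T) := by
    intro T t htT
    rcases le_total 0 t with h | h
    · have h7 : s t + i t ≤ s 0 + i 0 := hanti h
      have h8 : 1 ≤ exp (γ * T) := Real.one_le_exp (mul_nonneg hγ.le ((abs_nonneg t).trans htT))
      linarith
    · have h7 : (s t + i t) * exp (γ * t) ≤ (s 0 + i 0) * exp (γ * 0) := hmono h
      simp only [mul_zero, exp_zero, mul_one] at h7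
      have h8 : s t + i t ≤ exp (-(γ * t)) := by
        rw [Real.exp_neg, ← one_div, le_div_iff₀ (exp_pos _)]
        linarith
      refine h8.trans (Real.exp_le_exp.2 ?_)
      rw [abs_of_nonpos h] at htT
      nlinarith
  intro T t htT
  have := key T t htT
  exact ⟨⟨hs0 t, by linarith [hi0 t]⟩, ⟨hi0 t, by linarith [hs0 t]⟩⟩

def cC (γ β T : ℝ) : ℝ := β * exp (γ * T) * exp (γ * T) + γ * exp (γ * T)

def cD (γ β T : ℝ) : ℝ := 2 * β * exp (γ * T) * cC γ β T + γ * cC γ β T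

structure Good (γ βs β iM sMs tf ε s₀ i₀ : ℝ) (B s i : ℝ → ℝ) : Prop where
  B0 : B 0 = 0
  s0 : s 0 = s₀
  i0 : i 0 = i₀
  Bl : ∀ r t, r ≤ t → βs * (t - r) ≤ B t - B r
  Bu : ∀ r t, r ≤ t → B t - B r ≤ β * (t - r)
  sb : ∀ t, |s t| ≤ exp (γ * |t|)
  ib : ∀ t, |i t| ≤ exp (γ * |t|)
  sl : ∀ T r t, |r| ≤ T → |t| ≤ T → |s t - s r| ≤ cC γ β T * |t - r|
  il : ∀ T r t, |r| ≤ T → |t| ≤ T → |i t - i r| ≤ cC γ β T * |t - r|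
  sq : ∀ T r t, |r| ≤ T → |t| ≤ T →
    |s t - s r + (B t - B r) * (s r * i r)| ≤ cD γ β T * |t - r| * |t - r|
  iq : ∀ T r t, |r| ≤ T → |t| ≤ T →
    |i t - i r - (B t - B r) * (s r * i r) + γ * i r * (t - r)| ≤ cD γ β T * |t - r| * |t - r|
  con : ∀ t ∈ Set.Icc (0:ℝ) tf, i t ≤ Phi γ βs iM sMs (s t)
  fin : s tf ≤ γ / β - ε

lemma good_iff (γ βs β iM sMs tf ε s₀ i₀ : ℝ) (B s i : ℝ → ℝ) :
    Good γ βs β iM sMs tf ε s₀ i₀ B s i ↔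
    (B 0 = 0) ∧
    (s 0 = s₀) ∧
    (i 0 = i₀) ∧
    (∀ r t, r ≤ t → βs * (t - r) ≤ B t - B r) ∧
    (∀ r t, r ≤ t → B t - B r ≤ β * (t - r)) ∧
    (∀ t, |s t| ≤ exp (γ * |t|)) ∧
    (∀ t, |i t| ≤ exp (γ * |t|)) ∧
    (∀ T r t, |r| ≤ T → |t| ≤ T → |s t - s r| ≤ cC γ β T * |t - r|) ∧
    (∀ T r t, |r| ≤ T → |t| ≤ T → |i t - i r| ≤ cC γ β T * |t - r|) ∧
    (∀ T r t, |r| ≤ T → |t| ≤ T →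
    |s t - s r + (B t - B r) * (s r * i r)| ≤ cD γ β T * |t - r| * |t - r|) ∧
    (∀ T r t, |r| ≤ T → |t| ≤ T →
    |i t - i r - (B t - B r) * (s r * i r) + γ * i r * (t - r)| ≤ cD γ β T * |t - r| * |t - r|) ∧
    (∀ t ∈ Set.Icc (0:ℝ) tf, i t ≤ Phi γ βs iM sMs (s t)) ∧
    (s tf ≤ γ / β - ε) :=
  ⟨fun h => ⟨h.B0, h.s0, h.i0, h.Bl, h.Bu, h.sb, h.ib, h.sl, h.il, h.sq, h.iq, h.con, h.fin⟩,
    fun ⟨h1, h2, h3, h4, h5, h6, h7, h8, h9, h10, h11, h12, h13⟩ =>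
      ⟨h1, h2, h3, h4, h5, h6, h7, h8, h9, h10, h11, h12, h13⟩⟩

lemma uIoc_abs {r t y T : ℝ} (hr : |r| ≤ T) (ht : |t| ≤ T) (hy : y ∈ Set.uIoc r t) :
    |y| ≤ T ∧ |y - r| ≤ |t - r| := by
  have hy' := uIoc_subset_uIcc hy
  refine ⟨?_, abs_sub_left_of_mem_uIcc hy'⟩
  rw [abs_le] at *
  have := uIcc_subset_Icc (a₂ := -T) (b₂ := T) hr ht hy'
  exact this

lemma adm_good {γ βs β iM sMs tf ε s₀ i₀ : ℝ} {b s i : ℝ → ℝ} (hγ : 0 < γ) (hβs : 0 < βs)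
    (hβ : βs < β)
    (hb : IsAdmissible βs β b)
    (ht : IsTrajectory γ b s₀ i₀ s i) (hT : MemT s₀ i₀)
    (hcon : ∀ t ∈ Set.Icc (0:ℝ) tf, i t ≤ Phi γ βs iM sMs (s t))
    (hfin : s tf ≤ γ / β - ε) :
    Good γ βs β iM sMs tf ε s₀ i₀ (fun t => ∫ r in (0:ℝ)..t, b r) s i := by
  have hbd := traj_bounds hγ hβs hb ht hT
  obtain ⟨hbm, hbb⟩ := hb
  obtain ⟨hs, hi, hse, hie⟩ := ht
  have hβ0 : 0 < β := hβs.trans hβ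
  have hbabs : ∀ r, |b r| ≤ β := fun r => by
    rw [abs_of_nonneg (hβs.le.trans (hbb r).1)]; exact (hbb r).2
  have hintb : ∀ x y, IntervalIntegrable b volume x y :=
    intg_of_bd (g := fun _ => β) hbm continuous_const hbabs
  have hintc : ∀ g : ℝ → ℝ, Continuous g → ∀ x y,
      IntervalIntegrable (fun r => b r * g r) volume x y := fun g hg x y =>
    (hintb x y).mul_continuousOn hg.continuousOn
  have hint1 : ∀ x y, IntervalIntegrable (fun r => b r * s r * i r) volume x y := by
    intro x y
    simpa only [mul_assoc] using hintc (fun r => s r * i r) (hs.mul hi) x y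
  have hint2 : ∀ x y, IntervalIntegrable (fun r => (b r * s r - γ) * i r) volume x y := by
    intro x y
    have := (hint1 x y).sub ((hi.const_mul γ).intervalIntegrable x y)
    refine this.congr (fun r _ => ?_)
    ring
  have hsd : ∀ r t, s t - s r = -∫ y in r..t, b y * s y * i y := by
    intro r t
    rw [hse r, hse t, ← intervalIntegral.integral_interval_sub_left (hint1 0 t) (hint1 0 r)]
    ring
  have hid : ∀ r t, i t - i r = ∫ y in r..t, (b y * s y - γ) * i y := by
    intro r t
    rw [hie r, hie t, ← intervalIntegral.integral_interval_sub_left (hint2 0 t) (hint2 0 r)]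
    ring
  have hBd : ∀ r t, (∫ y in (0:ℝ)..t, b y) - (∫ y in (0:ℝ)..r, b y) = ∫ y in r..t, b y := by
    intro r t
    exact intervalIntegral.integral_interval_sub_left (hintb 0 t) (hintb 0 r)
  have habs : ∀ T t, |t| ≤ T → |s t| ≤ exp (γ * T) ∧ |i t| ≤ exp (γ * T) := by
    intro T t h
    obtain ⟨⟨h1, h2⟩, h3, h4⟩ := hbd T t h
    rw [abs_of_nonneg h1, abs_of_nonneg h3]
    exact ⟨h2, h4⟩
  have hsl : ∀ T r t, |r| ≤ T → |t| ≤ T → |s t - s r| ≤ cC γ β T * |t - r| := by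
    intro T r t hr ht
    rw [hsd, abs_neg, ← Real.norm_eq_abs (∫ y in r..t, b y * s y * i y)]
    refine intervalIntegral.norm_integral_le_of_norm_le_const ?_
    intro y hy
    obtain ⟨h1, h2⟩ := habs T y (uIoc_abs hr ht hy).1
    rw [Real.norm_eq_abs, abs_mul, abs_mul]
    calc |b y| * |s y| * |i y| ≤ β * exp (γ * T) * exp (γ * T) := by
          gcongr
          exact hbabs y
      _ ≤ cC γ β T := by unfold cC; have := exp_pos (γ * T); nlinarith
  have hil : ∀ T r t, |r| ≤ T → |t| ≤ T → |i t - i r| ≤ cC γ β T * |t - r| := by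
    intro T r t hr ht
    rw [hid, ← Real.norm_eq_abs (∫ y in r..t, (b y * s y - γ) * i y)]
    refine intervalIntegral.norm_integral_le_of_norm_le_const ?_
    intro y hy
    obtain ⟨h1, h2⟩ := habs T y (uIoc_abs hr ht hy).1
    rw [Real.norm_eq_abs, abs_mul]
    have h3 : |b y * s y - γ| ≤ β * exp (γ * T) + γ := by
      refine (abs_sub _ _).trans ?_
      rw [abs_mul, abs_of_pos hγ]
      gcongr
      exact hbabs y
    calc |b y * s y - γ| * |i y| ≤ (β * exp (γ * T) + γ) * exp (γ * T) := by
          gcongr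
      _ = cC γ β T := by unfold cC; ring
  have hC0 : ∀ T, 0 ≤ cC γ β T := fun T => by unfold cC; positivity
  have hprod : ∀ T r t y, |r| ≤ T → |t| ≤ T → y ∈ Set.uIoc r t →
      |b y * (s y * i y - s r * i r)| ≤ 2 * β * exp (γ * T) * cC γ β T * |t - r| := by
    intro T r t y hr ht hy
    obtain ⟨hy1, hy2⟩ := uIoc_abs hr ht hy
    have h1 := hsl T r y hr hy1
    have h2 := hil T r y hr hy1
    have h3 := habs T y hy1
    have h4 := habs T r hr
    have h5 : cC γ β T * |y - r| ≤ cC γ β T * |t - r| := mul_le_mul_of_nonneg_left hy2 (hC0 T)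
    have h6 : s y * i y - s r * i r = s y * (i y - i r) + (s y - s r) * i r := by ring
    have h7 : |s y * i y - s r * i r| ≤ exp (γ * T) * (cC γ β T * |t - r|)
        + (cC γ β T * |t - r|) * exp (γ * T) := by
      rw [h6]
      refine (abs_add_le _ _).trans ?_
      rw [abs_mul, abs_mul]
      have := hC0 T
      gcongr
      · exact h3.1
      · exact h2.trans h5
      · exact h1.trans h5
      · exact h4.2
    rw [abs_mul]
    calc |b y| * |s y * i y - s r * i r| ≤ β * (exp (γ * T) * (cC γ β T * |t - r|)
        + (cC γ β T * |t - r|) * exp (γ * T)) := by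
          gcongr
          exact hbabs y
      _ = _ := by ring
  refine ⟨by simp, by rw [hse]; simp, by rw [hie]; simp, ?_, ?_, fun t => (habs _ t le_rfl).1,
    fun t => (habs _ t le_rfl).2, hsl, hil, ?_, ?_, hcon, hfin⟩
  · intro r t hrt
    have := intervalIntegral.integral_mono_on hrt (intervalIntegrable_const (c := βs))
      (hintb r t) (fun x _ => (hbb x).1)
    rw [intervalIntegral.integral_const, smul_eq_mul] at this
    show _ ≤ (∫ y in (0:ℝ)..t, b y) - (∫ y in (0:ℝ)..r, b y)
    rw [hBd]; linarith
  · intro r t hrt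
    have := intervalIntegral.integral_mono_on hrt 
      (hintb r t) (intervalIntegrable_const (c := β)) (fun x _ => (hbb x).2)
    rw [intervalIntegral.integral_const, smul_eq_mul] at this
    show (∫ y in (0:ℝ)..t, b y) - (∫ y in (0:ℝ)..r, b y) ≤ _
    rw [hBd]; linarith
  · intro T r t hr ht
    have he : s t - s r + ((∫ y in (0:ℝ)..t, b y) - (∫ y in (0:ℝ)..r, b y)) * (s r * i r)
        = ∫ y in r..t, -(b y * (s y * i y - s r * i r)) := by
      rw [hBd, hsd, ← intervalIntegral.integral_mul_const, ← intervalIntegral.integral_neg,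
        ← intervalIntegral.integral_add (f := fun y => -(b y * s y * i y))
          (hint1 r t).neg ((hintb r t).mul_const _)]
      refine intervalIntegral.integral_congr fun y _ => ?_
      ring
    rw [he, ← Real.norm_eq_abs (∫ y in r..t, -(b y * (s y * i y - s r * i r)))]
    refine intervalIntegral.norm_integral_le_of_norm_le_const ?_
    intro y hy
    rw [Real.norm_eq_abs, abs_neg]
    refine (hprod T r t y hr ht hy).trans ?_
    gcongr
    unfold cD
    have := hC0 T
    nlinarith
  · intro T r t hr ht
    have he : i t - i r - ((∫ y in (0:ℝ)..t, b y) - (∫ y in (0:ℝ)..r, b y)) * (s r * i r)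
        + γ * i r * (t - r)
        = ∫ y in r..t, (b y * (s y * i y - s r * i r) - γ * (i y - i r)) := by
      have hc : γ * i r * (t - r) = ∫ y in r..t, γ * i r := by
        rw [intervalIntegral.integral_const, smul_eq_mul]; ring
      rw [hBd, hid, hc, ← intervalIntegral.integral_mul_const,
        ← intervalIntegral.integral_sub (hint2 r t) ((hintb r t).mul_const _),
        ← intervalIntegral.integral_add ((hint2 r t).sub ((hintb r t).mul_const _))
          intervalIntegrable_const]
      refine intervalIntegral.integral_congr fun y _ => ?_
      ring
    rw [he, ← Real.norm_eq_abs
      (∫ y in r..t, (b y * (s y * i y - s r * i r) - γ * (i y - i r)))]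
    refine intervalIntegral.norm_integral_le_of_norm_le_const ?_
    intro y hy
    obtain ⟨hy1, hy2⟩ := uIoc_abs hr ht hy
    rw [Real.norm_eq_abs]
    refine (abs_sub _ _).trans ?_
    have h1 := hprod T r t y hr ht hy
    have h2 : |γ * (i y - i r)| ≤ γ * (cC γ β T * |t - r|) := by
      rw [abs_mul, abs_of_pos hγ]
      have := hC0 T
      gcongr
      refine (hil T r y hr hy1).trans ?_
      gcongr
    unfold cD
    linarith

lemma Phi_cont {γ βs iM sMs : ℝ} (hγ : 0 < γ) (hβs : 0 < βs)
    (hsMs : γ / βs < sMs)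
    (hsMs' : iM - sMs + γ / βs + (γ / βs) * Real.log (βs * sMs / γ) = 0) :
    Continuous (Phi γ βs iM sMs) := by
  have hpos : 0 < γ / βs := by positivity
  have he : Phi γ βs iM sMs = fun x => iM - min (max x (γ / βs)) sMs + γ / βs +
      (γ / βs) * Real.log (βs * min (max x (γ / βs)) sMs / γ) := by
    funext x
    unfold Phi
    split_ifs with h1 h2
    · rw [max_eq_right h1, min_eq_left hsMs.le,
        show βs * (γ / βs) / γ = 1 by field_simp, Real.log_one]
      ring
    · push Not at h1
      rw [max_eq_left h1.le, min_eq_left h2.le]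
    · push Not at h1 h2
      rw [max_eq_left h1.le, min_eq_right h2, hsMs']
  rw [he]
  have h3 : Continuous fun x : ℝ => min (max x (γ / βs)) sMs := by fun_prop
  have h4 : Continuous fun x => Real.log (βs * min (max x (γ / βs)) sMs / γ) := by
    refine Continuous.log (by fun_prop) ?_
    intro x
    have : 0 < min (max x (γ / βs)) sMs := lt_min (lt_max_of_lt_right hpos) (hpos.trans hsMs)
    positivity
  exact ((continuous_const.sub h3).add continuous_const).add (continuous_const.mul h4)

lemma good_compact {γ βs β iM sMs tf ε s₀ i₀ : ℝ} (hP : Continuous (Phi γ βs iM sMs)) :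
    IsCompact {F : (ℝ → ℝ) × (ℝ → ℝ) × (ℝ → ℝ) |
      Good γ βs β iM sMs tf ε s₀ i₀ F.1 F.2.1 F.2.2} := by
  have hK : IsCompact ((Set.univ.pi fun t : ℝ => Icc (-(|β * t| + |βs * t|)) (|β * t| + |βs * t|)) ×ˢ
      ((Set.univ.pi fun t : ℝ => Icc (-exp (γ * |t|)) (exp (γ * |t|))) ×ˢ
      (Set.univ.pi fun t : ℝ => Icc (-exp (γ * |t|)) (exp (γ * |t|))))) :=
    (isCompact_univ_pi fun t => isCompact_Icc).prod
      ((isCompact_univ_pi fun t => isCompact_Icc).prod (isCompact_univ_pi fun t => isCompact_Icc))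
  refine hK.of_isClosed_subset ?_ ?_
  · have c1 : ∀ t : ℝ, Continuous fun F : (ℝ → ℝ) × (ℝ → ℝ) × (ℝ → ℝ) => F.1 t := by
      intro t; fun_prop
    have c2 : ∀ t : ℝ, Continuous fun F : (ℝ → ℝ) × (ℝ → ℝ) × (ℝ → ℝ) => F.2.1 t := by
      intro t; fun_prop
    have c3 : ∀ t : ℝ, Continuous fun F : (ℝ → ℝ) × (ℝ → ℝ) × (ℝ → ℝ) => F.2.2 t := by
      intro t; fun_prop
    simp only [good_iff, ofPred_and, ofPred_forall]
    refine IsClosed.inter ?_ <| IsClosed.inter ?_ <| IsClosed.inter ?_ <| IsClosed.inter ?_ <|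
      IsClosed.inter ?_ <| IsClosed.inter ?_ <| IsClosed.inter ?_ <| IsClosed.inter ?_ <|
      IsClosed.inter ?_ <| IsClosed.inter ?_ <| IsClosed.inter ?_ <| IsClosed.inter ?_ ?_
    · exact isClosed_eq (c1 _) continuous_const
    · exact isClosed_eq (c2 _) continuous_const
    · exact isClosed_eq (c3 _) continuous_const
    · refine isClosed_iInter fun r => isClosed_iInter fun t => isClosed_iInter fun _ => ?_
      exact isClosed_le continuous_const ((c1 _).sub (c1 _))
    · refine isClosed_iInter fun r => isClosed_iInter fun t => isClosed_iInter fun _ => ?_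
      exact isClosed_le ((c1 _).sub (c1 _)) continuous_const
    · refine isClosed_iInter fun t => ?_
      exact isClosed_le (c2 _).abs continuous_const
    · refine isClosed_iInter fun t => ?_
      exact isClosed_le (c3 _).abs continuous_const
    · refine isClosed_iInter fun T => isClosed_iInter fun r => isClosed_iInter fun t =>
        isClosed_iInter fun _ => isClosed_iInter fun _ => ?_
      exact isClosed_le ((c2 _).sub (c2 _)).abs continuous_const
    · refine isClosed_iInter fun T => isClosed_iInter fun r => isClosed_iInter fun t =>
        isClosed_iInter fun _ => isClosed_iInter fun _ => ?_
      exact isClosed_le ((c3 _).sub (c3 _)).abs continuous_const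
    · refine isClosed_iInter fun T => isClosed_iInter fun r => isClosed_iInter fun t =>
        isClosed_iInter fun _ => isClosed_iInter fun _ => ?_
      exact isClosed_le (((c2 _).sub (c2 _)).add
        (((c1 _).sub (c1 _)).mul ((c2 _).mul (c3 _)))).abs continuous_const
    · refine isClosed_iInter fun T => isClosed_iInter fun r => isClosed_iInter fun t =>
        isClosed_iInter fun _ => isClosed_iInter fun _ => ?_
      exact isClosed_le ((((c3 _).sub (c3 _)).sub
        (((c1 _).sub (c1 _)).mul ((c2 _).mul (c3 _)))).add
        ((continuous_const.mul (c3 _)).mul continuous_const)).abs continuous_const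
    · refine isClosed_iInter fun t => isClosed_iInter fun _ => ?_
      exact isClosed_le (c3 _) (hP.comp (c2 _))
    · exact isClosed_le (c2 _) continuous_const
  · rintro ⟨B, s, i⟩ h
    have h : Good γ βs β iM sMs tf ε s₀ i₀ B s i := h
    refine ⟨?_, ?_, ?_⟩
    · intro t _
      have a1 := le_abs_self (β * t)
      have a2 := neg_abs_le (β * t)
      have a3 := le_abs_self (βs * t)
      have a4 := neg_abs_le (βs * t)
      have a5 := abs_nonneg (βs * t)
      have a6 := abs_nonneg (β * t)
      have hB0 := h.B0
      rcases le_total 0 t with ht | ht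
      · have h1 := h.Bl 0 t ht
        have h2 := h.Bu 0 t ht
        rw [hB0] at h1 h2
        constructor <;> simp only <;> nlinarith
      · have h1 := h.Bl t 0 ht
        have h2 := h.Bu t 0 ht
        rw [hB0] at h1 h2
        constructor <;> simp only <;> nlinarith
    · intro t _
      exact abs_le.1 (h.sb t)
    · intro t _
      exact abs_le.1 (h.ib t)

lemma lip_AC {f : ℝ → ℝ} {C : ℝ → ℝ}
    (h : ∀ T r t, |r| ≤ T → |t| ≤ T → |f t - f r| ≤ C T * |t - r|) (a b : ℝ) :
    AbsolutelyContinuousOnInterval f a b := by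
  set T := max |a| |b|
  refine LipschitzOnWith.absolutelyContinuousOnInterval (K := (C T).toNNReal) ?_
  refine LipschitzOnWith.of_dist_le_mul fun x hx y hy => ?_
  have hT : ∀ z ∈ uIcc a b, |z| ≤ T := by
    intro z hz
    rw [abs_le]
    exact uIcc_subset_Icc (a₂ := -T) (b₂ := T) (abs_le.1 (le_max_left _ _))
      (abs_le.1 (le_max_right _ _)) hz
  rw [Real.dist_eq, Real.dist_eq]
  refine (h T y x (hT y hy) (hT x hx)).trans ?_
  gcongr
  exact Real.le_coe_toNNReal _

lemma lip_cont {f : ℝ → ℝ} {C : ℝ → ℝ}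
    (h : ∀ T r t, |r| ≤ T → |t| ≤ T → |f t - f r| ≤ C T * |t - r|) : Continuous f := by
  rw [continuous_iff_continuousAt]
  intro x
  have := (lip_AC h (x - 1) (x + 1)).continuousOn
  refine this.continuousAt ?_
  rw [uIcc_of_le (by linarith)]
  exact Icc_mem_nhds (by linarith) (by linarith)

lemma quad_deriv {g : ℝ → ℝ} {D : ℝ → ℝ} {r : ℝ}
    (h : ∀ T t, |r| ≤ T → |t| ≤ T → |g t - g r| ≤ D T * |t - r| * |t - r|) :
    HasDerivAt g 0 r := by
  rw [hasDerivAt_iff_isLittleO]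
  simp only [smul_zero, sub_zero]
  have h1 : (fun t => g t - g r) =O[nhds r] fun t => (t - r) ^ 2 := by
    refine Asymptotics.IsBigO.of_bound (D (|r| + 1)) ?_
    filter_upwards [Metric.ball_mem_nhds r one_pos] with t ht
    rw [Metric.mem_ball, Real.dist_eq] at ht
    have h2 : |t| ≤ |r| + 1 := by
      have := abs_sub_abs_le_abs_sub t r
      linarith
    have := h (|r| + 1) t (by linarith) h2
    rw [Real.norm_eq_abs, norm_pow, Real.norm_eq_abs]
    linarith
  refine h1.trans_isLittleO ?_
  have h3 : Filter.Tendsto (fun t : ℝ => t - r) (nhds r) (nhds 0) := by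
    have : Continuous fun t : ℝ => t - r := by fun_prop
    simpa using this.tendsto r
  exact (Asymptotics.isLittleO_pow_id (𝕜 := ℝ) (n := 2) (by norm_num)).comp_tendsto h3

lemma good_adm {γ βs β iM sMs tf ε s₀ i₀ : ℝ} {B s i : ℝ → ℝ} (hβs : 0 < βs) (hβ : βs < β)
    (h : Good γ βs β iM sMs tf ε s₀ i₀ B s i) :
    ∃ b, AdmissibleEps γ βs β iM sMs tf ε s₀ i₀ b ∧ ∫ r in (0:ℝ)..tf, b r = B tf := by
  have hBl : ∀ T r t, |r| ≤ T → |t| ≤ T → |B t - B r| ≤ (fun _ : ℝ => β) T * |t - r| := by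
    intro T r t _ _
    rcases le_total r t with hrt | hrt
    · rw [abs_of_nonneg (sub_nonneg.2 hrt), abs_le]
      constructor <;> nlinarith [h.Bl r t hrt, h.Bu r t hrt]
    · rw [abs_of_nonpos (sub_nonpos.2 hrt), abs_le]
      constructor <;> nlinarith [h.Bl t r hrt, h.Bu t r hrt]
  have hBlip : LipschitzWith β.toNNReal B := by
    refine LipschitzWith.of_dist_le_mul fun x y => ?_
    rw [Real.dist_eq, Real.dist_eq, Real.coe_toNNReal _ (by linarith)]
    exact hBl (max |y| |x|) y x (le_max_left _ _) (le_max_right _ _)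
  set b : ℝ → ℝ := fun t => max βs (min β (deriv B t)) with hbdef
  have hae : ∀ᵐ t, HasDerivAt B (b t) t := by
    filter_upwards [hBlip.ae_differentiableAt_real] with t ht
    have hd := ht.hasDerivAt
    have h1 : βs ≤ deriv B t := by
      have hm : Monotone fun x => B x - βs * x := by
        intro x y hxy
        have := h.Bl x y hxy
        simp only
        linarith
      have := (hd.sub ((hasDerivAt_id' t).const_mul βs)).nonneg_of_monotone hm
      linarith
    have h2 : deriv B t ≤ β := by
      have hm : Monotone fun x => β * x - B x := by
        intro x y hxy
        have := h.Bu x y hxy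
        simp only
        linarith
      have := (((hasDerivAt_id' t).const_mul β).sub hd).nonneg_of_monotone hm
      linarith
    have h3 : b t = deriv B t := by
      simp only [hbdef]
      rw [min_eq_right h2, max_eq_right h1]
    rw [h3]; exact hd
  have hs' : ∀ t, HasDerivAt B (b t) t → HasDerivAt s (-(b t * s t * i t)) t := by
    intro t ht
    have hg : HasDerivAt (fun x => s x + B x * (s t * i t)) 0 t := by
      refine quad_deriv (D := cD γ β) fun T x h1 h2 => ?_
      convert h.sq T t x h1 h2 using 2
      ring
    convert! hg.sub (ht.mul_const (s t * i t)) using 1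
    · funext x; simp
    · ring
  have hi' : ∀ t, HasDerivAt B (b t) t → HasDerivAt i ((b t * s t - γ) * i t) t := by
    intro t ht
    have hg : HasDerivAt (fun x => i x - B x * (s t * i t) + γ * i t * x) 0 t := by
      refine quad_deriv (D := cD γ β) fun T x h1 h2 => ?_
      convert h.iq T t x h1 h2 using 2
      ring
    convert! (hg.add (ht.mul_const (s t * i t))).sub
      ((hasDerivAt_id' t).const_mul (γ * i t)) using 1
    · funext x; simp only [Pi.sub_apply, Pi.add_apply]; ring
    · ring
  have hFTC : ∀ {f g C : ℝ → ℝ},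
      (∀ T r t, |r| ≤ T → |t| ≤ T → |f t - f r| ≤ C T * |t - r|) →
      (∀ t, HasDerivAt B (b t) t → HasDerivAt f (g t) t) →
      ∀ t, f t = f 0 + ∫ r in (0:ℝ)..t, g r := by
    intro f g C hf hg t
    have h1 := (lip_AC hf 0 t).integral_deriv_eq_sub
    have h2 : ∫ r in (0:ℝ)..t, g r = ∫ r in (0:ℝ)..t, deriv f r := by
      refine intervalIntegral.integral_congr_ae ?_
      filter_upwards [hae] with r hr _
      exact (hg r hr).deriv.symm
    rw [h2, h1]; ring
  refine ⟨b, ⟨⟨?_, ?_⟩, s, i, ⟨lip_cont h.sl, lip_cont h.il, ?_, ?_⟩, h.con, h.fin⟩, ?_⟩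
  · exact measurable_const.max (measurable_const.min (measurable_deriv B))
  · intro t
    exact ⟨le_max_left _ _, max_le hβ.le (min_le_left _ _)⟩
  · intro t
    rw [hFTC h.sl hs' t, intervalIntegral.integral_neg, h.s0]; ring
  · intro t
    rw [hFTC h.il hi' t, h.i0]
  · rw [hFTC hBl (fun t ht => ht) tf, h.B0, zero_add]

lemma cost_eq {βs β lam1 lam2 tf : ℝ} {b : ℝ → ℝ} (hβs : 0 < βs) (hb : IsAdmissible βs β b) :
    cost β lam1 lam2 tf b = (lam1 + lam2 * β) * tf - lam2 * ∫ r in (0:ℝ)..tf, b r := by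
  have hintb : IntervalIntegrable b volume 0 tf :=
    intg_of_bd (g := fun _ => β) hb.1 continuous_const (fun r => by
      rw [abs_of_nonneg (hβs.le.trans (hb.2 r).1)]; exact (hb.2 r).2) 0 tf
  unfold cost
  have : ∫ t in (0:ℝ)..tf, (lam1 + lam2 * (β - b t)) =
      ∫ t in (0:ℝ)..tf, ((lam1 + lam2 * β) - lam2 * b t) := by
    refine intervalIntegral.integral_congr fun y _ => ?_
    ring
  rw [this, intervalIntegral.integral_sub intervalIntegrable_const (hintb.const_mul _),
    intervalIntegral.integral_const, intervalIntegral.integral_const_mul, smul_eq_mul]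
  ring

/-- existence of an optimal control for problem `𝒫_ε`:
if the set of admissible controls for `𝒫_ε` from `(s₀,i₀)` on `[0,tf]` is
nonempty, then the cost `J(tf, ·)` attains its minimum over that set. -/
theorem stmt8 (γ βs β iM sMs : ℝ) (hγ : 0 < γ) (hβs : 0 < βs) (hβ : βs < β)
    (hiM : 0 < iM) (hiM1 : iM < 1)
    (hsMs : γ / βs < sMs)
    (hsMs' : iM - sMs + γ / βs + (γ / βs) * Real.log (βs * sMs / γ) = 0)
    (tf ε lam1 lam2 : ℝ) (htf : 0 < tf) (hε : 0 < ε)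
    (hl1 : 0 ≤ lam1) (hl2 : 0 ≤ lam2)
    (s₀ i₀ : ℝ) (hT : MemT s₀ i₀) (hi₀ : 0 < i₀)
    (hne : ∃ b, AdmissibleEps γ βs β iM sMs tf ε s₀ i₀ b) :
    ∃ bstar, AdmissibleEps γ βs β iM sMs tf ε s₀ i₀ bstar ∧
      ∀ b, AdmissibleEps γ βs β iM sMs tf ε s₀ i₀ b →
        cost β lam1 lam2 tf bstar ≤ cost β lam1 lam2 tf b := by
  have hcomp := good_compact (γ := γ) (βs := βs) (β := β) (iM := iM) (sMs := sMs) (tf := tf)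
    (ε := ε) (s₀ := s₀) (i₀ := i₀) (Phi_cont hγ hβs hsMs hsMs')
  have hmem : ∀ b, AdmissibleEps γ βs β iM sMs tf ε s₀ i₀ b → ∃ F ∈
      {F : (ℝ → ℝ) × (ℝ → ℝ) × (ℝ → ℝ) | Good γ βs β iM sMs tf ε s₀ i₀ F.1 F.2.1 F.2.2},
      F.1 tf = ∫ r in (0:ℝ)..tf, b r := by
    rintro b ⟨hb, s, i, ht, hcon, hfin⟩
    exact ⟨(fun t => ∫ r in (0:ℝ)..t, b r, s, i),
      adm_good hγ hβs hβ hb ht hT hcon hfin, rfl⟩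
  obtain ⟨b0, hb0⟩ := hne
  obtain ⟨F0, hF0, -⟩ := hmem b0 hb0
  obtain ⟨F, hF, hmax⟩ := hcomp.exists_isMaxOn ⟨F0, hF0⟩
    (f := fun F : (ℝ → ℝ) × (ℝ → ℝ) × (ℝ → ℝ) => F.1 tf)
    (by fun_prop : Continuous fun F : (ℝ → ℝ) × (ℝ → ℝ) × (ℝ → ℝ) => F.1 tf).continuousOn
  obtain ⟨bs, hbs, hbsint⟩ := good_adm hβs hβ hF
  refine ⟨bs, hbs, fun b hb => ?_⟩
  obtain ⟨G, hG, hGe⟩ := hmem b hb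
  rw [cost_eq hβs hbs.1, cost_eq hβs hb.1, hbsint, ← hGe]
  have h1 : G.1 tf ≤ F.1 tf := hmax hG
  have := mul_le_mul_of_nonneg_left h1 hl2
  linarith
end
end

section
/- Assume the Pontryagin data hold for the control b with trajectory (s,i). If the Hamiltonian constant satisfies k ≥ p₀λ₁ and the final multiplier satisfies p₁ = 0, then η(t) ≥ 0 for almost every t ∈ [0, t_f]. -/
open MeasureTheory Set Real
open scoped ENNReal

noncomputable section

/-- Pontryagin data for the control `b` with trajectory `(s, i)` on `[0, tf]`:
multipliers `p0, p1 ≥ 0`, a finite nonnegative Borel measure `μ` supported in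
`[0, tf]` with the complementarity condition, right-continuous BV adjoint states
`ps, pi` solving the integrated adjoint equations (with `η = pi - ps`), the
minimality condition, and the conservation of the Hamiltonian with constant `k`. -/
structure PontryaginData (γ βs β iM tf lam1 lam2 : ℝ) (b s i : ℝ → ℝ) where
  p0 : ℝ
  p1 : ℝ
  k : ℝ
  μ : Measure ℝ
  ps : ℝ → ℝ
  pii : ℝ → ℝ
  p0_nonneg : 0 ≤ p0
  p1_nonneg : 0 ≤ p1
  μ_fin : IsFiniteMeasure μ
  μ_supp : μ (Set.Icc (0:ℝ) tf)ᶜ = 0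
  complementarity : ∫ t, (i t - iM) ∂μ = 0
  ps_bv : BoundedVariationOn ps (Set.Icc 0 tf)
  pi_bv : BoundedVariationOn pii (Set.Icc 0 tf)
  ps_rc : ∀ t ∈ Set.Icc (0:ℝ) tf, ContinuousWithinAt ps (Set.Ici t) t
  pi_rc : ∀ t ∈ Set.Icc (0:ℝ) tf, ContinuousWithinAt pii (Set.Ici t) t
  adjoint_s : ∀ t ∈ Set.Icc (0:ℝ) tf,
    ps t = p1 + ∫ r in t..tf, (pii r - ps r) * b r * i r
  adjoint_i : ∀ t ∈ Set.Icc (0:ℝ) tf,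
    pii t = (∫ r in t..tf, ((pii r - ps r) * b r * s r - γ * pii r)) +
      (μ (Set.Ioc t tf)).toReal
  minimality : ∀ᵐ t ∂(volume.restrict (Set.Icc (0:ℝ) tf)),
    ∀ b' ∈ Set.Icc βs β,
      p0 * lam2 * (β - b t) + (pii t - ps t) * b t * s t * i t ≤
        p0 * lam2 * (β - b') + (pii t - ps t) * b' * s t * i t
  conservation : ∀ᵐ t ∂(volume.restrict (Set.Icc (0:ℝ) tf)),
    p0 * (lam1 + lam2 * (β - b t)) + (pii t - ps t) * b t * s t * i t -
      γ * pii t * i t = k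

/-- if the Hamiltonian constant satisfies `k ≥ p₀ λ₁` and the
final multiplier satisfies `p₁ = 0`, then `η = p_i − p_s ≥ 0` almost
everywhere on `[0, tf]`. -/
theorem stmt10 (γ βs β iM tf lam1 lam2 : ℝ)
    (hγ : 0 < γ) (hβs : 0 < βs) (hβ : βs < β) (hiM : 0 < iM) (hiM1 : iM < 1)
    (htf : 0 < tf) (hl1 : 0 ≤ lam1) (hl2 : 0 ≤ lam2)
    (b s i : ℝ → ℝ) (hb : IsAdmissible βs β b)
    (htraj : IsTrajectory γ b (s 0) (i 0) s i)
    (hpos : ∀ t ∈ Set.Icc (0:ℝ) tf, 0 < s t ∧ 0 < i t ∧ i t ≤ iM)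
    (P : PontryaginData γ βs β iM tf lam1 lam2 b s i)
    (hk : P.p0 * lam1 ≤ P.k) (hp1 : P.p1 = 0) :
    ∀ᵐ t ∂(volume.restrict (Set.Icc (0:ℝ) tf)), 0 ≤ P.pii t - P.ps t := by
  have hbv : ∀ f : ℝ → ℝ, BoundedVariationOn f (Set.Icc 0 tf) →
      IntegrableOn f (Set.Icc 0 tf) := by
    intro f hf
    obtain ⟨p, q, hp, hq, rfl⟩ := hf.locallyBoundedVariationOn.exists_monotoneOn_sub_monotoneOn
    exact (hp.integrableOn_isCompact isCompact_Icc).sub (hq.integrableOn_isCompact isCompact_Icc)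
  have hmul : ∀ f g : ℝ → ℝ, IntegrableOn f (Set.Icc 0 tf) → Continuous g →
      IntegrableOn (fun r => f r * g r) (Set.Icc 0 tf) := by
    intro f g hf hg
    exact hf.mul_continuousOn hg.continuousOn isCompact_Icc
  have hmulb : ∀ f : ℝ → ℝ, IntegrableOn f (Set.Icc 0 tf) →
      IntegrableOn (fun r => f r * b r) (Set.Icc 0 tf) := by
    intro f hf
    refine Integrable.mul_bdd (c := β) hf hb.1.aestronglyMeasurable ?_
    refine Filter.Eventually.of_forall fun t => ?_
    have := hb.2 t
    rw [Real.norm_eq_abs, abs_of_nonneg (by linarith [this.1])]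
    exact this.2
  obtain ⟨hsc, hic, -, -⟩ := htraj
  have hη := (hbv _ P.pi_bv).sub (hbv _ P.ps_bv)
  have hI1 : IntegrableOn (fun r => (P.pii r - P.ps r) * b r * i r) (Set.Icc 0 tf) :=
    hmul _ _ (hmulb _ hη) hic
  have hI2 : IntegrableOn (fun r => (P.pii r - P.ps r) * b r * s r - γ * P.pii r)
      (Set.Icc 0 tf) :=
    (hmul _ _ (hmulb _ hη) hsc).sub ((hbv _ P.pi_bv).const_mul γ)
  have hii : ∀ f : ℝ → ℝ, IntegrableOn f (Set.Icc 0 tf) → ∀ x ∈ Set.Icc 0 tf,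
      ∀ y ∈ Set.Icc 0 tf, IntervalIntegrable f volume x y := by
    intro f hf x hx y hy
    exact (hf.mono_set (Set.uIcc_subset_Icc hx hy)).intervalIntegrable
  have hmuf := P.μ_fin
  have htfm : tf ∈ Set.Icc (0:ℝ) tf := ⟨htf.le, le_rfl⟩
  have hend : P.pii tf - P.ps tf = 0 := by
    rw [P.adjoint_s tf htfm, P.adjoint_i tf htfm]
    simp [hp1]
  have key : ∀ t ∈ Set.Icc (0:ℝ) tf, 0 ≤ P.pii t - P.ps t := by
    intro t₀ ht₀
    by_contra! hneg
    set S : Set ℝ := {t | t ∈ Set.Icc t₀ tf ∧ 0 ≤ P.pii t - P.ps t} with hS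
    have hSne : S.Nonempty := ⟨tf, ⟨ht₀.2, le_rfl⟩, hend.ge⟩
    have hSb : BddBelow S := ⟨t₀, fun t ht => ht.1.1⟩
    set T := sInf S with hT
    have h0T : t₀ ≤ T := le_csInf hSne fun t ht => ht.1.1
    have hTf : T ≤ tf := csInf_le hSb ⟨⟨ht₀.2, le_rfl⟩, hend.ge⟩
    have hTm : T ∈ Set.Icc (0:ℝ) tf := ⟨ht₀.1.trans h0T, hTf⟩
    have hT0 : 0 ≤ P.pii T - P.ps T := by
      have hc : ContinuousWithinAt (fun t => P.pii t - P.ps t) S T :=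
        ((P.pi_rc T hTm).sub (P.ps_rc T hTm)).mono fun t ht => csInf_le hSb ht
      have := hc.mem_closure (t := Set.Ici 0) (csInf_mem_closure hSne hSb) (fun t ht => ht.2)
      rwa [isClosed_Ici.closure_eq] at this
    have hlt : ∀ t ∈ Set.Ico t₀ T, P.pii t - P.ps t < 0 := by
      intro t ht
      by_contra! h
      exact absurd (csInf_le hSb (show t ∈ S from ⟨⟨ht.1, ht.2.le.trans hTf⟩, h⟩))
        (not_le.mpr ht.2)
    have hint : 0 ≤ ∫ r in t₀..T, (((P.pii r - P.ps r) * b r * s r - γ * P.pii r) -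
        (P.pii r - P.ps r) * b r * i r) := by
      rw [intervalIntegral.integral_of_le h0T, ← integral_Ico_eq_integral_Ioc]
      refine integral_nonneg_of_ae ?_
      have hsub : Set.Ico t₀ T ⊆ Set.Icc 0 tf := fun t ht =>
        ⟨ht₀.1.trans ht.1, ht.2.le.trans hTf⟩
      filter_upwards [ae_restrict_of_ae_restrict_of_subset hsub P.minimality,
        ae_restrict_of_ae_restrict_of_subset hsub P.conservation,
        ae_restrict_mem measurableSet_Ico] with t hmin hcons ht
      have hn := hlt t ht
      obtain ⟨hs, hi, -⟩ := hpos t (hsub ht)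
      have hbt := hb.2 t
      have h1 := hmin β ⟨hβ.le, le_rfl⟩
      set e := P.pii t - P.ps t with he
      have h2 : 0 ≤ (e * β * s t - γ * P.pii t) * i t := by nlinarith
      have h3 : 0 ≤ e * β * s t - γ * P.pii t := nonneg_of_mul_nonneg_left h2 hi
      have h4 : 0 ≤ (-e) * (β - b t) * s t :=
        mul_nonneg (mul_nonneg (by linarith) (by linarith [hbt.2])) hs.le
      have h5 : 0 ≤ (-e) * b t * i t :=
        mul_nonneg (mul_nonneg (by linarith) (by linarith [hbt.1])) hi.le
      simp only [Pi.zero_apply]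
      nlinarith
    rw [intervalIntegral.integral_sub (hii _ hI2 _ ht₀ _ hTm) (hii _ hI1 _ ht₀ _ hTm)] at hint
    have hmono : (P.μ (Set.Ioc T tf)).toReal ≤ (P.μ (Set.Ioc t₀ tf)).toReal :=
      ENNReal.toReal_mono (measure_ne_top _ _) (measure_mono (Set.Ioc_subset_Ioc_left h0T))
    have a1 := intervalIntegral.integral_add_adjacent_intervals
      (hii _ hI1 _ ht₀ _ hTm) (hii _ hI1 _ hTm _ htfm)
    have a2 := intervalIntegral.integral_add_adjacent_intervals
      (hii _ hI2 _ ht₀ _ hTm) (hii _ hI2 _ hTm _ htfm)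
    have e1 := P.adjoint_s t₀ ht₀
    have e2 := P.adjoint_i t₀ ht₀
    have e3 := P.adjoint_s T hTm
    have e4 := P.adjoint_i T hTm
    linarith
  filter_upwards [ae_restrict_mem measurableSet_Icc] with t ht using key t ht
end
end
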